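/- arXiv:1203.5652 — 4 statements merged into one kernel-verified Lean document; each statement's English description precedes it below -/
import Mathlib

section
/- Let X be a countable set and G, H subgroups of Sym(X). For σ ∈ Sym(X), let φ_σ : G*H → Sym(X) be the homomorphism given on G by the inclusion and on H by h ↦ σ⁻¹hσ. If every G-orbit and every H-orbit on X is infinite, then the set of σ ∈ Sym(X) for which φ_σ is highly transitive is comeager in Sym(X). -/
open Monoid

/-- The topology of pointwise convergence of permutations and their inverses on `Equiv.Perm X`
(for `X` discrete). -/
def permTop (X : Type*) : TopologicalSpace (Equiv.Perm X) :=
  TopologicalSpace.induced (fun σ => ((σ : X → X), ((σ.symm : X → X))))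
    (@instTopologicalSpaceProd _ _
      (@Pi.topologicalSpace X (fun _ => X) (fun _ => ⊥))
      (@Pi.topologicalSpace X (fun _ => X) (fun _ => ⊥)))

/-- The homomorphism `G ∗ H → Sym(X)` given by the inclusion on `G` and by
`h ↦ σ⁻¹ h σ` on `H`. -/
noncomputable def phiSigma {X : Type*} (G H : Subgroup (Equiv.Perm X)) (σ : Equiv.Perm X) :
    Coprod G H →* Equiv.Perm X :=
  Coprod.lift G.subtype ((MulAut.conj σ⁻¹).toMonoidHom.comp H.subtype)

open scoped Pointwise in
theorem neumann_disjoint {X : Type*} (G : Subgroup (Equiv.Perm X))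
    (hG : ∀ x : X, (MulAction.orbit G x).Infinite) (A B : Finset X) :
    ∃ g : G, ∀ a ∈ A, (g : Equiv.Perm X) a ∉ B := by
  classical
  by_contra! hcon
  let s : Finset (X × X) := (A ×ˢ B).filter (fun p => ∃ g : G, (g : Equiv.Perm X) p.1 = p.2)
  have hch : ∀ p : X × X, ∃ g : G, p ∈ s → (g : Equiv.Perm X) p.1 = p.2 := by
    intro p
    by_cases hp : p ∈ s
    · obtain ⟨g, hg⟩ := (Finset.mem_filter.mp hp).2
      exact ⟨g, fun _ => hg⟩
    · exact ⟨1, fun h => absurd h hp⟩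
  choose c hc using hch
  have hcov : ⋃ p ∈ s, c p • ((MulAction.stabilizer G p.1 : Subgroup G) : Set G) = Set.univ := by
    refine Set.eq_univ_of_forall fun g => ?_
    obtain ⟨a, ha, hb⟩ := hcon g
    have hs : (a, (g : Equiv.Perm X) a) ∈ s :=
      Finset.mem_filter.mpr ⟨Finset.mem_product.mpr ⟨ha, hb⟩, g, rfl⟩
    refine Set.mem_iUnion₂.mpr ⟨_, hs, ?_⟩
    rw [mem_leftCoset_iff]
    have h1 := hc _ hs
    rw [SetLike.mem_coe, MulAction.mem_stabilizer_iff, mul_smul, inv_smul_eq_iff]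
    exact h1.symm
  obtain ⟨p, -, hp⟩ := Subgroup.exists_finiteIndex_of_leftCoset_cover hcov
  have : Finite (G ⧸ MulAction.stabilizer G p.1) := Subgroup.finite_quotient_of_finiteIndex
  have : Finite (MulAction.orbit G p.1) :=
    Finite.of_equiv _ (MulAction.orbitEquivQuotientStabilizer G p.1).symm
  exact hG p.1 (Set.toFinite _)

theorem exists_perm_fixing {X : Type*} (S : Set X) {k : ℕ} (u v : Fin k ↪ X)
    (hu : ∀ i, u i ∉ S) (hv : ∀ i, v i ∉ S) :
    ∃ τ : Equiv.Perm X, (∀ s ∈ S, τ s = s) ∧ ∀ i, τ (u i) = v i := by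
  classical
  let u' : Fin k ↪ {x // x ∉ S} := ⟨fun i => ⟨u i, hu i⟩, fun i j h => by simpa using h⟩
  let v' : Fin k ↪ {x // x ∉ S} := ⟨fun i => ⟨v i, hv i⟩, fun i j h => by simpa using h⟩
  obtain ⟨τ, hτ⟩ := (Equiv.Perm.isMultiplyPretransitive {x // x ∉ S} k).exists_smul_eq u' v'
  refine ⟨Equiv.Perm.ofSubtype τ, fun s hs => ?_, fun i => ?_⟩
  · exact Equiv.Perm.ofSubtype_apply_of_not_mem τ (by simpa using hs)
  · rw [Equiv.Perm.ofSubtype_apply_of_mem τ (hu i)]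
    have := congrArg (fun f => ((f i : {x // x ∉ S}) : X)) hτ
    exact this

theorem generic_high_transitivity_free_product
    {X : Type*} [Countable X] [Infinite X] (G H : Subgroup (Equiv.Perm X))
    (hG : ∀ x : X, (MulAction.orbit G x).Infinite)
    (hH : ∀ x : X, (MulAction.orbit H x).Infinite) :
    {σ : Equiv.Perm X |
        ∀ (k : ℕ) (x y : Fin k ↪ X), ∃ w : Coprod G H, ∀ i, phiSigma G H σ w (x i) = y i}
      ∈ @residual (Equiv.Perm X) (permTop X) := by
  classical
  let _ : TopologicalSpace X := ⊥
  have : DiscreteTopology X := ⟨rfl⟩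
  let _ : TopologicalSpace (Equiv.Perm X) := permTop X
  have hcont : Continuous (fun σ : Equiv.Perm X => ((σ : X → X), ((σ.symm : X → X)))) :=
    continuous_induced_dom
  have hev : ∀ a : X, Continuous (fun σ : Equiv.Perm X => σ a) := fun a =>
    (continuous_apply a).comp (continuous_fst.comp hcont)
  let V : (k : ℕ) → (Fin k ↪ X) → (Fin k ↪ X) → Set (Equiv.Perm X) := fun k x y =>
    {σ | ∃ (g₁ g₂ : G) (h : H), ∀ i,
      (h : Equiv.Perm X) (σ ((g₁ : Equiv.Perm X) (x i))) = σ ((g₂ : Equiv.Perm X) (y i))}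
  have hV : ∀ k x y, V k x y ∈ residual (Equiv.Perm X) := by
    intro k x y
    refine residual_of_dense_open ?_ ?_
    · simp only [V, Set.setOf_exists, Set.setOf_forall]
      refine isOpen_iUnion fun g₁ => isOpen_iUnion fun g₂ => isOpen_iUnion fun h =>
        isOpen_iInter_of_finite fun i => ?_
      have hc : Continuous (fun σ : Equiv.Perm X =>
          ((h : Equiv.Perm X) (σ ((g₁ : Equiv.Perm X) (x i))), σ ((g₂ : Equiv.Perm X) (y i)))) :=
        (continuous_of_discreteTopology.comp (hev _)).prodMk (hev _)
      exact (isOpen_discrete {p : X × X | p.1 = p.2}).preimage hc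
    · rw [dense_iff_inter_open]
      rintro U hU ⟨σ₀, hσ₀⟩
      obtain ⟨W, hW, rfl⟩ := isOpen_induced_iff.mp hU
      obtain ⟨W₁, W₂, hW₁, hW₂, h₁, h₂, hsub⟩ := isOpen_prod_iff.mp hW _ _ hσ₀
      obtain ⟨F₁, u₁, hu₁, hs₁⟩ := isOpen_pi_iff.mp hW₁ _ h₁
      obtain ⟨F₂, u₂, hu₂, hs₂⟩ := isOpen_pi_iff.mp hW₂ _ h₂
      let F : Finset X := F₁ ∪ F₂.image σ₀.symm
      have key : ∀ σ : Equiv.Perm X, (∀ a ∈ F, σ a = σ₀ a) →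
          ((σ : X → X), (σ.symm : X → X)) ∈ W := by
        intro σ hσ
        refine hsub ⟨hs₁ fun a ha => ?_, hs₂ fun a ha => ?_⟩
        · have : σ a = σ₀ a := hσ a (Finset.mem_union_left _ ha)
          simpa only [this] using (hu₁ a ha).2
        · have h3 : σ (σ₀.symm a) = σ₀ (σ₀.symm a) :=
            hσ _ (Finset.mem_union_right _ (Finset.mem_image_of_mem _ ha))
          have : σ.symm a = σ₀.symm a := by
            rw [Equiv.symm_apply_eq, h3, Equiv.apply_symm_apply]
          simpa only [this] using (hu₂ a ha).2
      obtain ⟨g₁, hg₁⟩ := neumann_disjoint G hG (Finset.univ.image x) F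
      obtain ⟨g₂, hg₂⟩ := neumann_disjoint G hG (Finset.univ.image y)
        (F ∪ Finset.univ.image fun i => (g₁ : Equiv.Perm X) (x i))
      let T : Finset X := (F ∪ Finset.univ.image fun i => (g₁ : Equiv.Perm X) (x i)).image σ₀
      obtain ⟨h, hh⟩ := neumann_disjoint H hH
        (Finset.univ.image fun i => σ₀ ((g₁ : Equiv.Perm X) (x i))) T
      obtain ⟨τ, hτ, hτ'⟩ := exists_perm_fixing (T : Set X)
        (y.trans ((g₂ : Equiv.Perm X).trans σ₀).toEmbedding)
        (x.trans (((g₁ : Equiv.Perm X).trans σ₀).trans (h : Equiv.Perm X)).toEmbedding)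
        (fun i hi => by
          obtain ⟨z, hz, hz'⟩ := Finset.mem_image.mp (Finset.mem_coe.mp hi)
          have := σ₀.injective hz'
          subst this
          exact hg₂ (y i) (Finset.mem_image_of_mem _ (Finset.mem_univ _)) hz)
        (fun i hi => hh _ (Finset.mem_image_of_mem _ (Finset.mem_univ i)) hi)
      refine ⟨σ₀.trans τ, key _ fun a ha => ?_, g₁, g₂, h, fun i => ?_⟩
      · exact hτ _ (Finset.mem_image_of_mem _ (Finset.mem_union_left _ ha))
      · have e1 : τ (σ₀ ((g₁ : Equiv.Perm X) (x i))) = σ₀ ((g₁ : Equiv.Perm X) (x i)) :=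
          hτ _ (Finset.mem_image_of_mem _ (Finset.mem_union_right _
            (Finset.mem_image_of_mem _ (Finset.mem_univ i))))
        have e2 := hτ' i
        change _ = τ (σ₀ ((g₂ : Equiv.Perm X) (y i)))
        change (h : Equiv.Perm X) (τ (σ₀ ((g₁ : Equiv.Perm X) (x i)))) = _
        rw [e1]
        exact e2.symm
  have : ∀ k : ℕ, Countable (Fin k ↪ X) := fun k =>
    Function.Injective.countable (f := fun (e : Fin k ↪ X) => (e : Fin k → X)) DFunLike.coe_injective
  have hall : (⋂ k, ⋂ x, ⋂ y, V k x y) ∈ residual (Equiv.Perm X) :=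
    countable_iInter_mem.mpr fun k => countable_iInter_mem.mpr fun x =>
      countable_iInter_mem.mpr fun y => hV k x y
  refine Filter.mem_of_superset hall fun σ hσ k x y => ?_
  simp only [Set.mem_iInter] at hσ
  obtain ⟨g₁, g₂, h, hw⟩ := hσ k x y
  refine ⟨Coprod.inl g₂⁻¹ * Coprod.inr h * Coprod.inl g₁, fun i => ?_⟩
  have := hw i
  simp only [phiSigma, map_mul, Coprod.lift_apply_inl, Coprod.lift_apply_inr]
  simp [this]
end

section
/- Let G and H be nontrivial finite or countable groups. The free product G*H admits a faithful highly transitive action on a countable set if and only if at least one of G, H is not isomorphic to Z/2Z. -/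
open Monoid

/-- A homomorphism to `Sym(X)` is highly transitive if for every `k` the induced action is
transitive on ordered `k`-tuples of pairwise distinct elements. -/
def IsHighlyTransitiveHom {K X : Type*} [Group K] (φ : K →* Equiv.Perm X) : Prop :=
  ∀ (k : ℕ) (x y : Fin k ↪ X), ∃ w : K, ∀ i, φ w (x i) = y i


set_option linter.unusedSectionVars false
namespace FP
open Equiv

variable {G X : Type*} [Group G]

def Dm (R : Finset (X × X)) (a : X) : Prop := ∃ b, (a, b) ∈ R
def Rn (R : Finset (X × X)) (b : X) : Prop := ∃ a, (a, b) ∈ R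

def PB (R : Finset (X × X)) : Prop :=
  (∀ a b b', (a, b) ∈ R → (a, b') ∈ R → b = b') ∧ (∀ a a' b, (a, b) ∈ R → (a', b) ∈ R → a = a')

inductive Good (ρ : G →* Perm X) (η : Perm X) (R : Finset (X × X)) : ℕ → X → Prop
  | endA (n p g) : g ≠ 1 → ¬ Dm R (ρ g p) → Good ρ η R n p
  | endB (n p g b) : g ≠ 1 → (ρ g p, b) ∈ R → ¬ Rn R (η b) → Good ρ η R n p
  | step (n p g b p') : g ≠ 1 → (ρ g p, b) ∈ R → (p', η b) ∈ R → Good ρ η R n p' →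
      Good ρ η R (n+1) p

def Ok (ρ : G →* Perm X) (η : Perm X) (R : Finset (X × X)) : Prop :=
  PB R ∧ ∀ p, Dm R p → ∃ n, Good ρ η R n p

structure Env (ρ : G →* Perm X) (η : Perm X) : Prop where
  free : ∀ g p, ρ g p = p → g = 1
  nofix : ∀ b, η b ≠ b
  fresh : ∀ R : Finset (X × X), ∃ b, (∀ g, ¬ Dm R (ρ g b)) ∧ ¬ Rn R b ∧ ¬ Rn R (η b) ∧
    (∀ c, Rn R c → η c ≠ b) ∧ ¬ Rn R (η (η b))
  third : ∀ g : G, ∃ g', g' ≠ 1 ∧ g' ≠ g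

def Tr (ρ : G →* Perm X) (η : Perm X) (R : Finset (X × X)) (p : X) (g : G) (p' : X) : Prop :=
  ∃ b, (ρ g p, b) ∈ R ∧ (p', η b) ∈ R

def Tip (ρ : G →* Perm X) (R : Finset (X × X)) (c : X) : Prop :=
  Dm R c ∧ ∀ g, g ≠ 1 → ¬ Dm R (ρ g c)

section
variable [DecidableEq X]

lemma dm_ins {R : Finset (X × X)} {p q z : X} : Dm (insert (p, q) R) z ↔ z = p ∨ Dm R z := by
  simp only [Dm, Finset.mem_insert, Prod.mk.injEq]
  grind

lemma rn_ins {R : Finset (X × X)} {p q z : X} : Rn (insert (p, q) R) z ↔ z = q ∨ Rn R z := by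
  simp only [Rn, Finset.mem_insert, Prod.mk.injEq]
  grind

lemma pb_ins {R : Finset (X × X)} {p q : X} (h : PB R) (hp : ¬ Dm R p) (hq : ¬ Rn R q) :
    PB (insert (p, q) R) := by
  simp only [Dm, Rn, PB, Finset.mem_insert, Prod.mk.injEq] at *
  grind

/-- general commit lemma -/
lemma commit {ρ : G →* Perm X} {η : Perm X} {R : Finset (X × X)} {p0 q0 : X}
    (hA : (∀ p, Dm R p → ∀ g, ρ g p ≠ p0) ∨ (¬ Rn (insert (p0, q0) R) (η q0) ∨
      ∃ p' n, (p', η q0) ∈ insert (p0, q0) R ∧ Good ρ η (insert (p0, q0) R) n p'))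
    (hB : (∀ b, Rn R b → η b ≠ q0) ∨ ∃ n, Good ρ η (insert (p0, q0) R) n p0) :
    ∀ n p, Dm R p → Good ρ η R n p → ∃ m, Good ρ η (insert (p0, q0) R) m p := by
  intro n p hp hg
  induction hg with
  | endA n p g h1 h2 =>
    by_cases h : ρ g p = p0
    · rcases hA with hA | hA | ⟨p', n, h3, h4⟩
      · exact absurd h (hA p hp g)
      · exact ⟨0, .endB _ _ g q0 h1 (by simp [h]) hA⟩
      · exact ⟨n+1, .step _ _ g q0 p' h1 (by simp [h]) h3 h4⟩
    · exact ⟨0, .endA _ _ g h1 (by rw [dm_ins]; tauto)⟩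
  | endB n p g b h1 h2 h3 =>
    by_cases h : η b = q0
    · rcases hB with hB | ⟨n, hB⟩
      · exact absurd h (hB b ⟨_, h2⟩)
      · exact ⟨n+1, .step _ _ g b p0 h1 (by simp [h2]) (by simp [h]) hB⟩
    · exact ⟨0, .endB _ _ g b h1 (by simp [h2]) (by rw [rn_ins]; tauto)⟩
  | step n p g b p' h1 h2 h3 h4 ih =>
    obtain ⟨m, hm⟩ := ih ⟨_, h3⟩
    exact ⟨m+1, .step _ _ g b p' h1 (by simp [h2]) (by simp [h3]) hm⟩

variable {ρ : G →* Perm X} {η : Perm X}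

lemma commitA (E : Env ρ η) {R : Finset (X × X)} (hR : Ok ρ η R) {p0 b : X} (hp : ¬ Dm R p0)
    (h1 : ¬ Rn R b) (h2 : ¬ Rn R (η b)) (h3 : ∀ c, Rn R c → η c ≠ b) :
    Ok ρ η (insert (p0, b) R) := by
  have key := commit (ρ := ρ) (η := η) (R := R) (p0 := p0) (q0 := b)
    (Or.inr (Or.inl (by rw [rn_ins]; have := E.nofix b; tauto))) (Or.inl h3)
  refine ⟨pb_ins hR.1 hp h1, ?_⟩
  intro p hd
  rcases dm_ins.1 hd with rfl | hd
  · obtain ⟨g, hg, -⟩ := E.third 1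
    by_cases h : Dm R (ρ g p)
    · obtain ⟨b', hb'⟩ := h
      by_cases h' : Rn R (η b')
      · obtain ⟨p', hp'⟩ := h'
        obtain ⟨n, hn⟩ := hR.2 p' ⟨_, hp'⟩
        obtain ⟨m, hm⟩ := key n p' ⟨_, hp'⟩ hn
        exact ⟨m+1, .step _ _ g b' p' hg (by simp [hb']) (by simp [hp']) hm⟩
      · exact ⟨0, .endB _ _ g b' hg (by simp [hb']) (by
          rw [rn_ins]; have := h3 b' ⟨_, hb'⟩; tauto)⟩
    · exact ⟨0, .endA _ _ g hg (by rw [dm_ins]; have := fun h => hg (E.free g p h); tauto)⟩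
  · obtain ⟨n, hn⟩ := hR.2 p hd
    exact key n p hd hn

lemma commitB (E : Env ρ η) {R : Finset (X × X)} (hR : Ok ρ η R) {a q0 : X} (hq : ¬ Rn R q0)
    (h1 : ∀ g, ¬ Dm R (ρ g a)) :
    Ok ρ η (insert (a, q0) R) := by
  have h0 : ¬ Dm R a := by simpa using h1 1
  have ga : ∃ n, Good ρ η (insert (a, q0) R) n a := by
    obtain ⟨g, hg, -⟩ := E.third 1
    exact ⟨0, .endA _ _ g hg (by
      rw [dm_ins]; have := fun h => hg (E.free g a h); have := h1 g; tauto)⟩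
  have key := commit (ρ := ρ) (η := η) (R := R) (p0 := a) (q0 := q0)
    (Or.inl (by
      rintro p hp g rfl
      apply h1 g⁻¹; simpa using hp)) (Or.inr ga)
  refine ⟨pb_ins hR.1 h0 hq, ?_⟩
  intro p hd
  rcases dm_ins.1 hd with rfl | hd
  · exact ga
  · obtain ⟨n, hn⟩ := hR.2 p hd
    exact key n p hd hn

lemma exists_dm (E : Env ρ η) {R : Finset (X × X)} (hR : Ok ρ η R) (p : X) :
    ∃ R', R ⊆ R' ∧ Ok ρ η R' ∧ Dm R' p := by
  by_cases h : Dm R p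
  · exact ⟨R, subset_rfl, hR, h⟩
  · obtain ⟨b, -, h1, h2, h3, -⟩ := E.fresh R
    exact ⟨_, Finset.subset_insert _ _, commitA E hR h h1 h2 h3, dm_ins.2 (Or.inl rfl)⟩

lemma exists_rn (E : Env ρ η) {R : Finset (X × X)} (hR : Ok ρ η R) (q : X) :
    ∃ R', R ⊆ R' ∧ Ok ρ η R' ∧ Rn R' q := by
  by_cases h : Rn R q
  · exact ⟨R, subset_rfl, hR, h⟩
  · obtain ⟨b, h1, -⟩ := E.fresh R
    exact ⟨_, Finset.subset_insert _ _, commitB E hR h h1, rn_ins.2 (Or.inl rfl)⟩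

lemma Dm.mono {R R' : Finset (X × X)} (h : R ⊆ R') {p} (hp : Dm R p) : Dm R' p :=
  hp.imp fun _ hb => h hb

lemma exists_dm_finset (E : Env ρ η) {R : Finset (X × X)} (hR : Ok ρ η R) (S : Finset X) :
    ∃ R', R ⊆ R' ∧ Ok ρ η R' ∧ ∀ p ∈ S, Dm R' p := by
  induction S using Finset.induction_on with
  | empty => exact ⟨R, subset_rfl, hR, by simp⟩
  | insert p S _ ih =>
    obtain ⟨R1, h1, h2, h3⟩ := ih
    obtain ⟨R2, h4, h5, h6⟩ := exists_dm E h2 p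
    refine ⟨R2, h1.trans h4, h5, ?_⟩
    intro q hq
    rcases Finset.mem_insert.1 hq with rfl | hq
    · exact h6
    · exact (h3 q hq).mono h4

lemma Tr.mono {R R' : Finset (X × X)} (h : R ⊆ R') {p g p'} (hp : Tr ρ η R p g p') :
    Tr ρ η R' p g p' := hp.imp fun _ hb => ⟨h hb.1, h hb.2⟩

lemma Tr.unique {R : Finset (X × X)} (h : PB R) {p g p' p''} (hp : Tr ρ η R p g p')
    (hp' : Tr ρ η R p g p'') : p' = p'' := by
  obtain ⟨b, h1, h2⟩ := hp
  obtain ⟨b', h3, h4⟩ := hp'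
  obtain rfl := h.1 _ _ _ h1 h3
  exact h.2 _ _ _ h2 h4

lemma Tr.inj {R : Finset (X × X)} (h : PB R) {p q g p'} (hp : Tr ρ η R p g p')
    (hp' : Tr ρ η R q g p') : p = q := by
  obtain ⟨b, h1, h2⟩ := hp
  obtain ⟨b', h3, h4⟩ := hp'
  have := η.injective (h.1 _ _ _ h2 h4)
  subst this
  exact (ρ g).injective (h.2 _ _ _ h1 h3)

lemma adv1 (E : Env ρ η) {R : Finset (X × X)} (hR : Ok ρ η R) {p : X} (g : G) :
    ∃ R', R ⊆ R' ∧ Ok ρ η R' ∧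
      (∃ p', Tr ρ η R' p g p' ∧ ((¬ ∃ p'', Tr ρ η R p g p'') → Tip ρ R' p' ∧ ¬ Dm R p')) ∧
      (∀ z, Dm R' z → Dm R z ∨ z = ρ g p ∨ ∀ g', ¬ Dm R (ρ g' z)) ∧
      ((∃ p'', Tr ρ η R p g p'') → R' = R) ∧
      (¬ Dm R (ρ g p) → ∀ z, Rn R' z → Rn R z ∨ ∀ c, Rn R c → η c ≠ z) := by
  by_cases hin : ∃ p'', Tr ρ η R p g p''
  · obtain ⟨p', hp'⟩ := hin
    exact ⟨R, subset_rfl, hR, ⟨p', hp', fun h => absurd ⟨p', hp'⟩ h⟩, fun z hz => Or.inl hz,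
      fun _ => rfl, fun _ z hz => Or.inl hz⟩
  by_cases hd : Dm R (ρ g p)
  · obtain ⟨b, hb⟩ := hd
    have hq : ¬ Rn R (η b) := fun ⟨a, ha⟩ => hin ⟨a, b, hb, ha⟩
    obtain ⟨a, ha, -⟩ := E.fresh R
    refine ⟨_, Finset.subset_insert _ _, commitB E hR hq ha, ⟨a, ⟨b, by simp [hb], by simp⟩,
      fun _ => ⟨⟨dm_ins.2 (Or.inl rfl), ?_⟩, by simpa using ha 1⟩⟩, ?_, fun h => absurd h hin,
      fun h => absurd ⟨b, hb⟩ h⟩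
    · intro g' hg'
      rw [dm_ins]
      have := fun h => hg' (E.free g' a h); have := ha g'; tauto
    · intro z hz
      rcases dm_ins.1 hz with rfl | hz
      · exact Or.inr (Or.inr ha)
      · exact Or.inl hz
  · obtain ⟨b, -, h1, h2, h3, -⟩ := E.fresh R
    have ok1 := commitA E hR hd h1 h2 h3
    have hq : ¬ Rn (insert (ρ g p, b) R) (η b) := by
      rw [rn_ins]; have := E.nofix b; tauto
    obtain ⟨a, ha, -⟩ := E.fresh (insert (ρ g p, b) R)
    have ha' : ∀ g, ¬ Dm R (ρ g a) := fun g h => ha g (dm_ins.2 (Or.inr h))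
    refine ⟨_, (Finset.subset_insert _ _).trans (Finset.subset_insert _ _), commitB E ok1 hq ha,
      ⟨a, ⟨b, by simp, by simp⟩,
      fun _ => ⟨⟨dm_ins.2 (Or.inl rfl), ?_⟩, by simpa using ha' 1⟩⟩, ?_, fun h => absurd h hin, ?_⟩
    · intro g' hg'
      rw [dm_ins]
      have := fun h => hg' (E.free g' a h); have := ha g'; tauto
    · intro z hz
      rcases dm_ins.1 hz with rfl | hz
      · exact Or.inr (Or.inr ha')
      · rcases dm_ins.1 hz with rfl | hz
        · exact Or.inr (Or.inl rfl)
        · exact Or.inl hz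
    · intro _ z hz
      rcases rn_ins.1 hz with rfl | hz
      · right
        intro c hc h
        exact h1 (η.injective h ▸ hc)
      · rcases rn_ins.1 hz with rfl | hz
        · exact Or.inr h3
        · exact Or.inl hz

/-- consequences of the domain-growth clause for tips -/
lemma tip_grow {R R' : Finset (X × X)} (_hs : R ⊆ R') {p : X} {g : G} (hp : Dm R p)
    (he : ∀ z, Dm R' z → Dm R z ∨ z = ρ g p ∨ ∀ g', ¬ Dm R (ρ g' z)) {q : X} (hq : Tip ρ R q) :
    ∀ g', g' ≠ 1 → Dm R' (ρ g' q) → q = p ∧ ρ g' q = ρ g p := by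
  intro g' hg' hd
  rcases he _ hd with h | h | h
  · exact absurd h (hq.2 g' hg')
  · refine ⟨?_, h⟩
    by_contra hne
    have : p = ρ (g⁻¹ * g') q := by simp [h]
    apply hq.2 (g⁻¹ * g')
    · intro h1
      rw [h1] at this
      exact hne (by simp [this])
    · rwa [← this]
  · exact absurd hq.1 (by simpa using h g'⁻¹)

lemma good_tip (E : Env ρ η) {R R' : Finset (X × X)} (hs : R ⊆ R') {p : X} {g : G}
    (hp : Tip ρ R p)
    (he : ∀ z, Dm R' z → Dm R z ∨ z = ρ g p ∨ ∀ g', ¬ Dm R (ρ g' z))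
    (hr : ∀ z, Rn R' z → Rn R z ∨ ∀ c, Rn R c → η c ≠ z) :
    ∀ n q, Dm R q → Good ρ η R n q → Good ρ η R' n q := by
  intro n q hq hg
  induction hg with
  | endA n q g1 h1 h2 =>
    by_cases h : Dm R' (ρ g1 q)
    · rcases he _ h with h' | h' | h'
      · exact absurd h' h2
      · have hqp : q = p := by
          by_contra hne
          have e : q = ρ (g1⁻¹ * g) p := by simp [← h']
          apply hp.2 (g1⁻¹ * g)
          · intro h1
            rw [h1] at e
            exact hne (by simp [e])
          · rwa [← e]
        subst hqp
        obtain ⟨g2, h3, h4⟩ := E.third g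
        refine .endA _ _ g2 h3 fun h5 => h4 ?_
        have := (tip_grow hs hq he hp g2 h3 h5).2
        have := E.free (g⁻¹ * g2) q (by simp [this])
        exact (inv_mul_eq_one.1 this).symm
      · exact absurd hq (by simpa using h' g1⁻¹)
    · exact .endA _ _ g1 h1 h
  | endB n q g1 b h1 h2 h3 =>
    refine .endB _ _ g1 b h1 (hs h2) fun h => ?_
    rcases hr _ h with h | h
    · exact h3 h
    · exact h b ⟨_, h2⟩ rfl
  | step n q g1 b q' h1 h2 h3 h4 ih =>
    exact .step _ _ g1 b q' h1 (hs h2) (hs h3) (ih ⟨_, h3⟩)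

lemma loop (E : Env ρ η) {R : Finset (X × X)} (hR : Ok ρ η R) {g : G} (hg : g ≠ 1)
    (P : Finset X) (hP : ∀ p ∈ P, Dm R p) :
    ∃ R', R ⊆ R' ∧ Ok ρ η R' ∧
      (∀ p ∈ P, ∃ p', Tr ρ η R' p g p' ∧ (Tip ρ R p → Tip ρ R' p' ∧ ¬ Dm R p')) ∧
      (∀ q, Tip ρ R q → q ∉ P → Tip ρ R' q) ∧
      (∀ q, Tip ρ R q → ∀ g', g' ≠ 1 → g' ≠ g → ¬ Dm R' (ρ g' q)) ∧
      ((∀ p ∈ P, Tip ρ R p ∨ ∃ p'', Tr ρ η R p g p'') →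
        ∀ n q, Dm R q → Good ρ η R n q → Good ρ η R' n q) := by
  induction P using Finset.induction_on with
  | empty =>
    exact ⟨R, subset_rfl, hR, by simp, fun q h _ => h, fun q h g' h1 _ => h.2 g' h1,
      fun _ n q _ h => h⟩
  | insert p P hpP ih =>
    obtain ⟨R1, s1, ok1, t1, u1, v1, w1⟩ := ih fun q hq => hP q (Finset.mem_insert_of_mem hq)
    obtain ⟨R2, s2, ok2, ⟨p', tp, tp'⟩, e2, f2, r2⟩ := adv1 E ok1 (p := p) g
    have hdp : Dm R p := hP p (Finset.mem_insert_self _ _)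
    have hdp1 := hdp.mono s1
    have tipother : ∀ q, Tip ρ R1 q → q ≠ p → Tip ρ R2 q := fun q hq hne =>
      ⟨hq.1.mono s2, fun g' hg' hd => hne (tip_grow s2 hdp1 e2 hq g' hg' hd).1⟩
    have tipnin : Tip ρ R1 p → ¬ ∃ p'', Tr ρ η R1 p g p'' := by
      rintro h ⟨p'', b, h1, h2⟩
      exact h.2 g hg ⟨b, h1⟩
    refine ⟨R2, s1.trans s2, ok2, ?_, ?_, ?_, ?_⟩
    · intro q hq
      rcases Finset.mem_insert.1 hq with rfl | hq
      · refine ⟨p', tp, fun ht => ?_⟩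
        have := tp' (tipnin (u1 q ht hpP))
        exact ⟨this.1, fun h => this.2 (h.mono s1)⟩
      · obtain ⟨q', h1, h2⟩ := t1 q hq
        refine ⟨q', h1.mono s2, fun ht => ⟨tipother _ (h2 ht).1 ?_, (h2 ht).2⟩⟩
        rintro rfl
        exact (h2 ht).2 hdp
    · intro q hq hqP
      simp only [Finset.mem_insert, not_or] at hqP
      exact tipother _ (u1 q hq hqP.2) hqP.1
    · intro q hq g' h1 h2 hd
      rcases e2 _ hd with h | h | h
      · exact v1 q hq g' h1 h2 h
      · have hqp : q = p := by
          by_contra hne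
          have e : p = ρ (g⁻¹ * g') q := by simp [h]
          apply hq.2 (g⁻¹ * g')
          · intro h1
            rw [h1] at e
            exact hne (by simp [e])
          · rwa [← e]
        subst hqp
        have := E.free (g⁻¹ * g') q (by simp [h])
        exact h2 (inv_mul_eq_one.1 this).symm
      · exact absurd (hq.1.mono s1) (by simpa using h g'⁻¹)
    · intro hall n q hq hgood
      have h1 := w1 (fun p hp => hall p (Finset.mem_insert_of_mem hp)) n q hq hgood
      rcases hall p (Finset.mem_insert_self _ _) with h | ⟨p'', h⟩
      · have ht := u1 p h hpP
        exact good_tip E s2 ht e2 (r2 (ht.2 g hg)) n q (hq.mono s1) h1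
      · rw [f2 ⟨p'', h.mono s1⟩]
        exact h1


def TrL (ρ : G →* Perm X) (η : Perm X) (R : Finset (X × X)) : List G → X → X → Prop
  | [], p, p' => p = p'
  | g :: l, p, p' => ∃ q, Tr ρ η R p g q ∧ TrL ρ η R l q p'

lemma TrL.mono {R R' : Finset (X × X)} (h : R ⊆ R') : ∀ {l p p'}, TrL ρ η R l p p' →
    TrL ρ η R' l p p'
  | [], _, _, hp => hp
  | _ :: _, _, _, ⟨q, h1, h2⟩ => ⟨q, h1.mono h, h2.mono h⟩

lemma TrL.inj {R : Finset (X × X)} (h : PB R) : ∀ {l p q p'}, TrL ρ η R l p p' →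
    TrL ρ η R l q p' → p = q
  | [], _, _, _, hp, hq => by
      simp only [TrL] at hp hq; rw [hp, hq]
  | _ :: _, _, _, _, ⟨q, h1, h2⟩, ⟨q', h3, h4⟩ => by
      obtain rfl := TrL.inj h h2 h4
      exact h1.inj h h3

lemma Tr.dm {R : Finset (X × X)} {p g p'} (h : Tr ρ η R p g p') : Dm R p' := by
  obtain ⟨b, h1, h2⟩ := h
  exact ⟨_, h2⟩

def Concl (ρ : G →* Perm X) (η : Perm X) {ι : Type*} (R : Finset (X × X)) (c : ι → X) : Prop :=
  ∃ (R' : Finset (X × X)) (l : List G) (c' : ι → X), R ⊆ R' ∧ Ok ρ η R' ∧ (∀ i, TrL ρ η R' l (c i) (c' i)) ∧ ∀ i : ι, Tip ρ R' (c' i)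

lemma Concl.cons {ι : Type*} {R R1 : Finset (X × X)} {c c1 : ι → X} {g : G} (hs : R ⊆ R1)
    (ht : ∀ i, Tr ρ η R1 (c i) g (c1 i)) (h : Concl ρ η R1 c1) : Concl ρ η R c := by
  obtain ⟨R', l, c', h1, h2, h3, h4⟩ := h
  exact ⟨R', g :: l, c', hs.trans h1, h2, fun i => ⟨_, (ht i).mono h1, h3 i⟩, h4⟩

def Bad (ρ : G →* Perm X) {ι : Type*} (R : Finset (X × X)) (c : ι → X) : Set ι :=
  {i | ¬ Tip ρ R (c i)}

lemma progress (E : Env ρ η) {ι : Type*} [Finite ι] {R : Finset (X × X)} {c : ι → X}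
    (hR : Ok ρ η R) (hc : Function.Injective c) (hd : ∀ i, Dm R (c i)) {g : G} (hg : g ≠ 1)
    {j : ι} (hj : ¬ Tip ρ R (c j)) (hin : ¬ ∃ p'', Tr ρ η R (c j) g p'') :
    ∃ R1 c1, R ⊆ R1 ∧ Ok ρ η R1 ∧ (∀ i, Tr ρ η R1 (c i) g (c1 i)) ∧
      (Bad ρ R1 c1).ncard < (Bad ρ R c).ncard := by
  have := Fintype.ofFinite ι
  obtain ⟨R1, s1, ok1, ⟨p', tp, tp'⟩, e1, -, -⟩ := adv1 E hR (p := c j) g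
  obtain ⟨tip', nd⟩ := tp' hin
  obtain ⟨R2, s2, ok2, t2, u2, -, -⟩ := loop E ok1 hg ((Finset.univ.image c).erase (c j)) (by
    intro p hp
    simp only [Finset.mem_erase, Finset.mem_image] at hp
    obtain ⟨_, i, _, rfl⟩ := hp
    exact (hd i).mono s1)
  have key : ∀ i, ∃ q, Tr ρ η R2 (c i) g q ∧ ((Tip ρ R (c i) ∨ i = j) → Tip ρ R2 q) := by
    intro i
    by_cases hij : i = j
    · subst hij
      refine ⟨p', tp.mono s2, fun _ => u2 p' tip' ?_⟩
      simp only [Finset.mem_erase, Finset.mem_image]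
      rintro ⟨_, i', _, rfl⟩
      exact nd (hd i')
    · obtain ⟨q, h1, h2⟩ := t2 (c i) (by
        simp only [Finset.mem_erase, Finset.mem_image]
        exact ⟨fun h => hij (hc h), i, by simp, rfl⟩)
      refine ⟨q, h1, fun h => (h2 ?_).1⟩
      have ht : Tip ρ R (c i) := by tauto
      exact ⟨ht.1.mono s1, fun g' hg' hd' => hij (hc (tip_grow s1 (hd j) e1 ht g' hg' hd').1)⟩
  choose c1 hc1 hc2 using key
  refine ⟨R2, c1, s1.trans s2, ok2, hc1, ?_⟩
  apply Set.ncard_lt_ncard _ (Set.toFinite _)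
  refine ⟨fun i hi ht => hi (hc2 i (Or.inl ht)), fun h => ?_⟩
  exact h hj (hc2 j (Or.inr rfl))

lemma push (E : Env ρ η) {ι : Type*} [Finite ι] : ∀ (N : ℕ) (R : Finset (X × X)) (c : ι → X),
    Ok ρ η R → Function.Injective c → (∀ i, Dm R (c i)) → (Bad ρ R c).ncard ≤ N →
    Concl ρ η R c := by
  intro N
  induction N with
  | zero =>
    intro R c hR hc hd hN
    refine ⟨R, [], c, subset_rfl, hR, fun i => rfl, ?_⟩
    have h0 : (Bad ρ R c) = ∅ := (Set.ncard_eq_zero (Set.toFinite _)).1 (by omega)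
    intro i
    by_contra h
    have : i ∈ Bad ρ R c := h
    simp [h0] at this
  | succ N ihN =>
    have prog : ∀ (R : Finset (X × X)) (c : ι → X) (g : G) (j : ι), Ok ρ η R →
        Function.Injective c → (∀ i, Dm R (c i)) → (Bad ρ R c).ncard ≤ N + 1 →
        g ≠ 1 → ¬ Tip ρ R (c j) → (¬ ∃ p'', Tr ρ η R (c j) g p'') → Concl ρ η R c := by
      intro R c g j hR hc hd hN hg hj hin
      obtain ⟨R1, c1, h1, h2, h3, h4⟩ := progress E hR hc hd hg hj hin
      refine Concl.cons h1 h3 (ihN R1 c1 h2 ?_ (fun i => (h3 i).dm) (by omega))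
      intro i i' h
      have := h3 i
      rw [h] at this
      exact hc (this.inj h2.1 (h3 i'))
    have inner : ∀ (n : ℕ) (R : Finset (X × X)) (c : ι → X) (i : ι), Ok ρ η R →
        Function.Injective c → (∀ i, Dm R (c i)) → (Bad ρ R c).ncard ≤ N + 1 →
        ¬ Tip ρ R (c i) → Good ρ η R n (c i) → Concl ρ η R c := by
      intro n
      induction n with
      | zero =>
        intro R c i hR hc hd hN hi hgood
        cases hgood with
        | endA _ _ g h1 h2 =>
          exact prog R c g i hR hc hd hN h1 hi fun ⟨p, b, h3, h4⟩ => h2 ⟨b, h3⟩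
        | endB _ _ g b h1 h2 h3 =>
          refine prog R c g i hR hc hd hN h1 hi fun ⟨p, b', h4, h5⟩ => h3 ⟨p, ?_⟩
          rwa [hR.1.1 _ _ _ h2 h4]
      | succ n ihn =>
        intro R c i hR hc hd hN hi hgood
        cases hgood with
        | endA _ _ g h1 h2 =>
          exact prog R c g i hR hc hd hN h1 hi fun ⟨p, b, h3, h4⟩ => h2 ⟨b, h3⟩
        | endB _ _ g b h1 h2 h3 =>
          refine prog R c g i hR hc hd hN h1 hi fun ⟨p, b', h4, h5⟩ => h3 ⟨p, ?_⟩
          rwa [hR.1.1 _ _ _ h2 h4]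
        | step _ _ g b p' h1 h2 h3 h4 =>
          by_cases hall : ∀ j, Tip ρ R (c j) ∨ ∃ p'', Tr ρ η R (c j) g p''
          · have := Fintype.ofFinite ι
            obtain ⟨R1, s1, ok1, t1, -, -, w1⟩ := loop E hR h1 (Finset.univ.image c) (by
              simpa using hd)
            have key : ∀ i, ∃ p', Tr ρ η R1 (c i) g p' ∧
              (Tip ρ R (c i) → Tip ρ R1 p' ∧ ¬ Dm R p') := fun i => t1 (c i) (by simp)
            choose c1 hc1 hc2 using key
            have hinj : Function.Injective c1 := by
              intro i i' h
              have := hc1 i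
              rw [h] at this
              exact hc (this.inj ok1.1 (hc1 i'))
            have hsub : Bad ρ R1 c1 ⊆ Bad ρ R c := fun i hi ht => hi (hc2 i ht).1
            refine Concl.cons s1 hc1 ?_
            by_cases hi' : Tip ρ R1 (c1 i)
            · refine ihN R1 c1 ok1 hinj (fun i => (hc1 i).dm) ?_
              have : (Bad ρ R1 c1).ncard < (Bad ρ R c).ncard :=
                Set.ncard_lt_ncard ⟨hsub, fun h => h hi hi'⟩ (Set.toFinite _)
              omega
            · refine ihn R1 c1 i ok1 hinj (fun i => (hc1 i).dm)
                ((Set.ncard_le_ncard hsub (Set.toFinite _)).trans hN) hi' ?_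
              have e : p' = c1 i := Tr.unique ok1.1 (Tr.mono s1 ⟨b, h2, h3⟩) (hc1 i)
              rw [← e]
              exact w1 (by simpa using hall) n p' ⟨_, h3⟩ h4
          · push Not at hall
            obtain ⟨j, hj1, hj2⟩ := hall
            exact prog R c g j hR hc hd hN h1 hj1 (by push Not; exact hj2)
    intro R c hR hc hd hN
    by_cases h : ∀ i, Tip ρ R (c i)
    · exact ⟨R, [], c, subset_rfl, hR, fun i => rfl, h⟩
    · push Not at h
      obtain ⟨i, hi⟩ := h
      obtain ⟨n, hn⟩ := hR.2 (c i) (hd i)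
      exact inner n R c i hR hc hd hN hi hn

lemma conn_loop (E : Env ρ η) {ι κ : Type*} [DecidableEq κ] {R : Finset (X × X)}
    (hR : Ok ρ η R) {α β : G} (hβ : β ≠ 1) (hβα : β * α ≠ 1) {c a : ι → X}
    (hc : Function.Injective c) (ha : Function.Injective a)
    (hca : ∀ s, Tr ρ η R (c s) α (a s)) (hfree : ∀ s, ¬ Dm R (ρ β⁻¹ (a s)))
    (sep1 : ∀ s t, a s ≠ c t) (sep2 : ∀ s t, ρ (β * α) (a s) ≠ c t)
    (sep3 : ∀ s t, ρ (β * α) (a s) ≠ a t) {x y : κ → ι} (hx : Function.Injective x)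
    (hy : Function.Injective y) (hα' : ∀ s, ¬ Dm R (ρ α (a s))) (hβ' : ∀ s, ¬ Dm R (ρ β⁻¹ (c s)))
    (T : Finset κ) :
    ∃ R', R ⊆ R' ∧ Ok ρ η R' ∧ (∀ s, ¬ Dm R' (ρ β⁻¹ (a s))) ∧
      (∀ j, j ∉ T → ¬ Dm R' (ρ α (a (x j))) ∧ ¬ Dm R' (ρ β⁻¹ (c (y j)))) ∧
      ∀ j ∈ T, Tr ρ η R' (a (x j)) α (ρ β⁻¹ (c (y j))) := by
  have inv1 : ∀ u v, ρ β⁻¹ u = v ↔ u = ρ β v := by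
    intro u v
    rw [map_inv, Perm.inv_eq_iff_eq]
  have ne1 : ∀ s t, ρ α (a s) ≠ ρ β⁻¹ (c t) := by
    intro s t h
    apply sep2 s t
    rw [eq_comm, inv1] at h
    simp [h]
  have ne2 : ∀ s t, ρ β⁻¹ (a t) ≠ ρ α (a s) := by
    intro s t h
    apply sep3 s t
    rw [inv1] at h
    simp [h]
  have ne3 : ∀ s t, ρ β⁻¹ (a t) ≠ ρ β⁻¹ (c s) := fun s t h => sep1 t s ((ρ β⁻¹).injective h)
  induction T using Finset.induction_on with
  | empty => exact ⟨R, subset_rfl, hR, hfree, fun j _ => ⟨hα' _, hβ' _⟩, by simp⟩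
  | insert i T hiT ih =>
    obtain ⟨R1, s1, ok1, f1, n1, t1⟩ := ih
    obtain ⟨e, -, e1, e2, e3, e4⟩ := E.fresh R1
    set p0 := ρ α (a (x i)) with hp0
    set f := ρ β⁻¹ (c (y i)) with hf
    have ok2 := commitA E ok1 (n1 i hiT).1 e1 e2 e3
    set R2 := insert (p0, e) R1 with hR2
    have hfd : ¬ Dm R2 f := by
      rw [hR2, dm_ins]
      have := (n1 i hiT).2
      have := ne1 (x i) (y i)
      tauto
    have hed : ¬ Rn R2 (η e) := by
      rw [hR2, rn_ins]
      have := E.nofix e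
      tauto
    have f3 : ∀ s, ¬ Dm (insert (f, η e) R2) (ρ β⁻¹ (a s)) := by
      intro s
      rw [dm_ins, dm_ins]
      have := f1 s
      have := ne2 (x i) s
      have := ne3 (y i) s
      tauto
    have s3 : R1 ⊆ insert (f, η e) R2 :=
      (Finset.subset_insert _ _).trans (Finset.subset_insert _ _)
    have gp0 : Good ρ η (insert (f, η e) R2) 0 p0 := by
      refine .endA _ _ (β⁻¹ * α⁻¹) ?_ ?_
      · intro h
        apply hβα
        have h' := congrArg (fun z => z⁻¹) h
        simp only [mul_inv_rev, inv_inv, inv_one] at h'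
        rw [mul_eq_one_iff_eq_inv] at h' ⊢
        rw [h']; simp
      · have : ρ (β⁻¹ * α⁻¹) p0 = ρ β⁻¹ (a (x i)) := by simp [hp0]
        rw [this]
        exact f3 _
    have ga : ∀ s, Good ρ η (insert (f, η e) R2) 0 (a s) := fun s =>
      .endA _ _ β⁻¹ (by simpa using hβ) (f3 s)
    have gf : Good ρ η (insert (f, η e) R2) 1 f := by
      obtain ⟨b, hb1, hb2⟩ := hca (y i)
      refine .step _ _ (α * β) b (a (y i)) ?_ ?_ (s3 (s1 hb2)) (ga _)
      · intro h
        apply hβα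
        rw [mul_eq_one_iff_eq_inv] at h ⊢
        rw [h]; simp
      · have : ρ (α * β) f = ρ α (c (y i)) := by simp [hf]
        rw [this]
        exact s3 (s1 hb1)
    have key := commit (ρ := ρ) (η := η) (R := R2) (p0 := f) (q0 := η e)
      (Or.inr (by
        by_cases h : Rn (insert (f, η e) R2) (η (η e))
        · right
          rcases rn_ins.1 h with h | h
          · exact absurd h (E.nofix _)
          · rcases rn_ins.1 h with h | h
            · exact ⟨p0, 0, by rw [h]; simp [hR2], gp0⟩
            · exact absurd h e4
        · exact Or.inl h)) (Or.inr ⟨1, gf⟩)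
    refine ⟨insert (f, η e) R2, s1.trans s3, ⟨pb_ins ok2.1 hfd hed, ?_⟩, f3, ?_, ?_⟩
    · intro p hp
      rcases dm_ins.1 hp with rfl | hp
      · exact ⟨1, gf⟩
      · obtain ⟨n, hn⟩ := ok2.2 p hp
        exact key n p hp hn
    · intro j hj
      simp only [Finset.mem_insert, not_or] at hj
      obtain ⟨h1, h2⟩ := n1 j hj.2
      rw [dm_ins, dm_ins, dm_ins, dm_ins]
      have i1 : ρ α (a (x j)) ≠ p0 := fun h => hj.1 (hx (ha ((ρ α).injective h)))
      have i2 : ρ β⁻¹ (c (y j)) ≠ f := fun h => hj.1 (hy (hc ((ρ β⁻¹).injective h)))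
      have i3 := ne1 (x j) (y i)
      have i4 := (ne1 (x i) (y j)).symm
      tauto
    · intro j hj
      rcases Finset.mem_insert.1 hj with rfl | hj
      · exact ⟨e, by simp [hR2, hp0], by simp [hf]⟩
      · exact (t1 j hj).mono s3

lemma connect (E : Env ρ η) {R : Finset (X × X)} (hR : Ok ρ η R) {κ : Type} [Fintype κ]
    [DecidableEq κ] {x y : κ → X} (hx : Function.Injective x) (hy : Function.Injective y) :
    ∃ (R' : Finset (X × X)) (l l' : List G) (β : G), R ⊆ R' ∧ Ok ρ η R' ∧ ∀ i, ∃ u z,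
      TrL ρ η R' l (x i) u ∧ TrL ρ η R' l (y i) z ∧ TrL ρ η R' l' u (ρ β⁻¹ z) := by
  obtain ⟨α, hα, -⟩ := E.third 1
  obtain ⟨β, hβ, hβα'⟩ := E.third α⁻¹
  have hβα : β * α ≠ 1 := fun h => hβα' (mul_eq_one_iff_eq_inv.1 h)
  obtain ⟨R1, s1, ok1, d1⟩ := exists_dm_finset E hR (Finset.univ.image x ∪ Finset.univ.image y)
  generalize hS : Finset.univ.image x ∪ Finset.univ.image y = S at d1
  have hxS : ∀ i, x i ∈ S := fun i => by rw [← hS]; simp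
  have hyS : ∀ i, y i ∈ S := fun i => by rw [← hS]; simp
  obtain ⟨R2, l, c, s2, ok2, t2, tip2⟩ := push E _ R1 (fun s : S => (s : X)) ok1
    Subtype.val_injective (fun s => d1 s s.2) le_rfl
  have hc : Function.Injective c := by
    intro s t h
    have := t2 s
    rw [h] at this
    exact Subtype.ext (this.inj ok2.1 (t2 t))
  obtain ⟨R3, s3, ok3, t3, -, v3, -⟩ := loop E ok2 hα (Finset.univ.image c) (by
    intro p hp
    simp only [Finset.mem_image] at hp
    obtain ⟨i, _, rfl⟩ := hp
    exact (tip2 i).1)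
  have key : ∀ s, ∃ q, Tr ρ η R3 (c s) α q ∧ Tip ρ R3 q ∧ ¬ Dm R2 q := by
    intro s
    obtain ⟨q, h1, h2⟩ := t3 (c s) (by simp)
    exact ⟨q, h1, h2 (tip2 s)⟩
  choose a ha1 ha2 ha3 using key
  have ha : Function.Injective a := by
    intro s t h
    have := ha1 s
    rw [h] at this
    exact hc (this.inj ok3.1 (ha1 t))
  obtain ⟨R4, s4, ok4, -, -, t4⟩ := conn_loop E ok3 hβ hβα hc ha ha1
    (fun s => (ha2 s).2 _ (by simpa using hβ))
    (fun s t h => ha3 s (h ▸ (tip2 t).1))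
    (fun s t h => (ha2 s).2 _ hβα (h ▸ (tip2 t).1.mono s3))
    (fun s t h => (ha2 s).2 _ hβα (h ▸ (ha2 t).1))
    (x := fun i => (⟨x i, hxS i⟩ : S)) (y := fun i => (⟨y i, hyS i⟩ : S))
    (fun i j h => hx (congrArg Subtype.val h)) (fun i j h => hy (congrArg Subtype.val h))
    (fun s => (ha2 s).2 _ hα)
    (fun s => v3 _ (tip2 s) _ (by simpa using hβ) (by
      rintro rfl; exact hβα (by simp))) Finset.univ
  refine ⟨R4, l, [α, α], β, s1.trans (s2.trans (s3.trans s4)), ok4, fun i => ?_⟩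
  exact ⟨_, _, (t2 ⟨x i, hxS i⟩).mono (s3.trans s4), (t2 ⟨y i, hyS i⟩).mono (s3.trans s4),
    _, (ha1 _).mono s4, _, t4 i (Finset.mem_univ _), rfl⟩

end

section concrete
open Monoid Coprod

/-- family used to compare `Coprod` with `CoprodI` -/
def Fam.{u, v} (G : Type u) (H : Type v) : Bool → Type (max u v)
  | true => ULift.{v} G
  | false => ULift.{u} H

instance famGroup.{u, v} (G : Type u) (H : Type v) [Group G] [Group H] :
    ∀ b, Group (Fam G H b)
  | true => inferInstanceAs (Group (ULift.{v} G))
  | false => inferInstanceAs (Group (ULift.{u} H))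

lemma infinite_order.{u, v} {G : Type u} {H : Type v} [Group G] [Group H] {α : G} {h : H}
    (hα : α ≠ 1) (hh : h ≠ 1) (m : ℕ) (hm : m ≠ 0) :
    ((inr h * inl α : Coprod G H)) ^ m ≠ 1 := by
  classical
  let A : Fam G H true := (ULift.up α : ULift.{v} G)
  let B : Fam G H false := (ULift.up h : ULift.{u} H)
  have hA : A ≠ 1 := fun e => hα (congrArg ULift.down (show (ULift.up α : ULift.{v} G) = 1 from e))
  have hB : B ≠ 1 := fun e => hh (congrArg ULift.down (show (ULift.up h : ULift.{u} H) = 1 from e))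
  let f1 : G →* CoprodI (Fam G H) :=
    (CoprodI.of (M := Fam G H) (i := true)).comp
      (MulEquiv.ulift.symm.toMonoidHom : G →* ULift.{v} G)
  let f2 : H →* CoprodI (Fam G H) :=
    (CoprodI.of (M := Fam G H) (i := false)).comp
      (MulEquiv.ulift.symm.toMonoidHom : H →* ULift.{u} H)
  let F := Coprod.lift f1 f2
  have hF : F (inr h * inl α) = CoprodI.of B * CoprodI.of A := by
    rw [map_mul]; rfl
  have key : ∀ m : ℕ, ∃ w : CoprodI.Word (Fam G H), w.fstIdx ≠ some true ∧
      w.prod = (CoprodI.of B * CoprodI.of A) ^ m ∧ (m ≠ 0 → w.toList ≠ []) := by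
    intro m
    induction m with
    | zero => exact ⟨CoprodI.Word.empty, by simp [CoprodI.Word.fstIdx, CoprodI.Word.empty],
        by simp, by simp⟩
    | succ m ih =>
      obtain ⟨w, h1, h2, h3⟩ := ih
      refine ⟨CoprodI.Word.cons B (CoprodI.Word.cons A w h1 hA) (by simp) hB, by simp, ?_, ?_⟩
      · rw [CoprodI.Word.prod_cons, CoprodI.Word.prod_cons, h2, pow_succ', mul_assoc]
      · intro _
        simp [CoprodI.Word.cons]
  intro e
  obtain ⟨w, h1, h2, h3⟩ := key m
  have h4 : w.prod = 1 := by rw [h2, ← hF, ← map_pow, e, map_one]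
  have h5 : w = CoprodI.Word.empty := by
    apply CoprodI.Word.equiv.symm.injective
    change w.prod = CoprodI.Word.empty.prod
    rw [h4, CoprodI.Word.prod_empty]
  apply h3 hm
  rw [h5]; rfl

variable (G H : Type*) [Group G] [Group H]

def act : Coprod G H →* Perm (ℕ × Coprod G H) where
  toFun w := (Equiv.refl ℕ).prodCongr (Equiv.mulLeft w)
  map_one' := by ext x <;> simp
  map_mul' a b := by ext x <;> simp [mul_assoc]

variable {G H}

@[simp] lemma act_apply (w : Coprod G H) (n : ℕ) (y : Coprod G H) :
    act G H w (n, y) = (n, w * y) := rfl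

def phi (σ : Perm (ℕ × Coprod G H)) : Coprod G H →* Perm (ℕ × Coprod G H) :=
  Coprod.lift ((act G H).comp inl) ((MulAut.conj σ⁻¹).toMonoidHom.comp ((act G H).comp inr))

lemma phi_inl (σ : Perm (ℕ × Coprod G H)) (g : G) (p) : phi σ (inl g) p = act G H (inl g) p := rfl

lemma phi_inr (σ : Perm (ℕ × Coprod G H)) (k : H) (p) :
    phi σ (inr k) p = σ⁻¹ (act G H (inr k) (σ p)) := by
  simp [phi]

lemma traj (w : Coprod G H) : ∀ y, ∃ E : Finset (Coprod G H), ∀ n (σ : Perm (ℕ × Coprod G H)),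
    (∀ z ∈ E, σ (n, z) = (n, z)) → phi σ w (n, y) = (n, w * y) := by
  classical
  induction w using Coprod.induction_on with
  | inl g => exact fun y => ⟨∅, fun n σ _ => rfl⟩
  | inr k =>
    intro y
    refine ⟨{y, inr k * y}, fun n σ h => ?_⟩
    rw [phi_inr, h y (by simp), Perm.inv_eq_iff_eq, act_apply, h _ (by simp)]
  | mul w1 w2 h1 h2 =>
    intro y
    obtain ⟨E2, h2⟩ := h2 y
    obtain ⟨E1, h1⟩ := h1 (w2 * y)
    refine ⟨E1 ∪ E2, fun n σ h => ?_⟩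
    rw [map_mul, Perm.mul_apply, h2 n σ fun z hz => h z (by simp [hz]),
      h1 n σ fun z hz => h z (by simp [hz]), mul_assoc]

def wordOf (h : H) : List G → Coprod G H
  | [] => 1
  | g :: l => wordOf h l * (inr h * inl g)

lemma wordOf_spec (h : H) {R : Finset ((ℕ × Coprod G H) × (ℕ × Coprod G H))}
    {σ : Perm (ℕ × Coprod G H)} (hσ : ∀ a b, (a, b) ∈ R → σ a = b) :
    ∀ l p p', TrL ((act G H).comp inl) (act G H (inr h)) R l p p' → phi σ (wordOf h l) p = p'
  | [], p, p', hp => hp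
  | g :: l, p, p', ⟨q, ⟨b, h1, h2⟩, h3⟩ => by
    have : phi σ (inr h * inl g) p = q := by
      rw [map_mul, Perm.mul_apply, phi_inr, phi_inl]
      rw [Perm.inv_eq_iff_eq, hσ _ _ h2]
      exact congrArg _ (hσ _ _ h1)
    rw [wordOf, map_mul, Perm.mul_apply, this]
    exact wordOf_spec h hσ l q p' h3

lemma fresh_copy (R : Finset ((ℕ × Coprod G H) × (ℕ × Coprod G H))) :
    ∃ n, (∀ y, ¬ Dm R (n, y)) ∧ ∀ y, ¬ Rn R (n, y) := by
  classical
  obtain ⟨n, hn⟩ := Infinite.exists_notMem_finset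
    (R.image (fun z => z.1.1) ∪ R.image (fun z => z.2.1))
  simp only [Finset.mem_union, Finset.mem_image, not_or, not_exists, not_and] at hn
  exact ⟨n, fun y ⟨b, hb⟩ => hn.1 _ hb rfl, fun y ⟨b, hb⟩ => hn.2 _ hb rfl⟩

lemma env (h3 : ∀ g : G, ∃ g', g' ≠ 1 ∧ g' ≠ g) {h : H} (hh : h ≠ 1) :
    Env ((act G H).comp inl) (act G H (inr h)) where
  free := by
    rintro g ⟨n, y⟩ e
    simp only [MonoidHom.comp_apply, act_apply, Prod.mk.injEq, true_and, mul_eq_right] at e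
    exact inl_injective (by simpa using e)
  nofix := by
    rintro ⟨n, y⟩ e
    simp only [act_apply, Prod.mk.injEq, true_and, mul_eq_right] at e
    exact hh (inr_injective (by simpa using e))
  fresh := by
    intro R
    obtain ⟨n, h1, h2⟩ := fresh_copy R
    refine ⟨(n, 1), fun g => h1 _, h2 _, h2 _, ?_, h2 _⟩
    rintro ⟨m, y⟩ hc e
    simp only [act_apply, Prod.mk.injEq] at e
    obtain ⟨rfl, -⟩ := e
    exact h2 _ hc
  third := h3

lemma faithful_ext [DecidableEq (Coprod G H)] (h3 : ∀ g : G, ∃ g', g' ≠ 1 ∧ g' ≠ g) {h : H}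
    (hh : h ≠ 1)
    {R : Finset ((ℕ × Coprod G H) × (ℕ × Coprod G H))}
    (hR : Ok ((act G H).comp inl) (act G H (inr h)) R) (E : Finset (Coprod G H)) :
    ∃ R' n, R ⊆ R' ∧ Ok ((act G H).comp inl) (act G H (inr h)) R' ∧
      ∀ z ∈ E, ((n, z), (n, z)) ∈ R' := by
  obtain ⟨n, h1, h2⟩ := fresh_copy R
  obtain ⟨α, hα, -⟩ := h3 1
  set R' := R ∪ E.image (fun z => (((n, z), (n, z)) : (ℕ × Coprod G H) × (ℕ × Coprod G H))) with hR'
  have mem : ∀ a b, (a, b) ∈ R' ↔ (a, b) ∈ R ∨ ∃ z ∈ E, a = (n, z) ∧ b = (n, z) := by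
    intro a b
    simp only [hR', Finset.mem_union, Finset.mem_image, Prod.mk.injEq]
    grind
  have dm : ∀ a, Dm R' a ↔ Dm R a ∨ ∃ z ∈ E, a = (n, z) := by
    intro a; simp only [Dm, mem]; grind
  have rn : ∀ a, Rn R' a ↔ Rn R a ∨ ∃ z ∈ E, a = (n, z) := by
    intro a; simp only [Rn, mem]; grind
  refine ⟨R', n, Finset.subset_union_left, ⟨⟨?_, ?_⟩, ?_⟩, fun z hz => ?_⟩
  · intro a b b' hb hb'
    rw [mem] at hb hb'
    rcases hb with hb | ⟨z, hz, rfl, rfl⟩ <;> rcases hb' with hb' | ⟨z', hz', e, rfl⟩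
    · exact hR.1.1 _ _ _ hb hb'
    · exact absurd ⟨b, e ▸ hb⟩ (h1 z')
    · exact absurd ⟨b', hb'⟩ (h1 z)
    · exact e
  · intro a a' b hb hb'
    rw [mem] at hb hb'
    rcases hb with hb | ⟨z, hz, rfl, rfl⟩ <;> rcases hb' with hb' | ⟨z', hz', rfl, e⟩
    · exact hR.1.2 _ _ _ hb hb'
    · exact absurd ⟨a, e ▸ hb⟩ (h2 z')
    · exact absurd ⟨a', hb'⟩ (h2 z)
    · exact e
  · intro p hp
    rw [dm] at hp
    rcases hp with hp | ⟨z, hz, rfl⟩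
    · obtain ⟨m, hm⟩ := hR.2 p hp
      refine ⟨m, ?_⟩
      induction hm with
      | endA m p g k1 k2 =>
        refine .endA _ _ g k1 ?_
        rw [dm]
        rintro (k | ⟨z, hz, k⟩)
        · exact k2 k
        · obtain ⟨n', y⟩ := p
          simp only [MonoidHom.comp_apply, act_apply, Prod.mk.injEq] at k
          exact h1 y (k.1 ▸ hp)
      | endB m p g b k1 k2 k3 =>
        refine .endB _ _ g b k1 ((mem _ _).2 (Or.inl k2)) ?_
        rw [rn]
        rintro (k | ⟨z, hz, k⟩)
        · exact k3 k
        · obtain ⟨n', y⟩ := b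
          simp only [act_apply, Prod.mk.injEq] at k
          exact h2 y (k.1 ▸ ⟨_, k2⟩)
      | step m p g b p' k1 k2 k3 k4 ih =>
        exact .step _ _ g b p' k1 ((mem _ _).2 (Or.inl k2)) ((mem _ _).2 (Or.inl k3)) (ih ⟨_, k3⟩)
    · by_contra hbad
      push Not at hbad
      have key : ∀ m : ℕ, (∀ j, ¬ Good ((act G H).comp inl) (act G H (inr h)) R' j
          (n, (inr h * inl α) ^ m * z)) ∧ (inr h * inl α) ^ m * z ∈ E := by
        intro m
        induction m with
        | zero => simpa using ⟨hbad, hz⟩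
        | succ m ih =>
          obtain ⟨ih, -⟩ := ih
          set y := (inr h * inl α : Coprod G H) ^ m * z with hy
          have e : (inr h * inl α : Coprod G H) ^ (m + 1) * z = inr h * (inl α * y) := by
            rw [hy, pow_succ']; simp only [mul_assoc]
          have m1 : inl α * y ∈ E := by
            by_contra hn
            refine ih 0 (.endA _ _ α hα ?_)
            rw [dm]
            rintro (k | ⟨z', hz', k⟩)
            · exact h1 _ k
            · simp only [MonoidHom.comp_apply, act_apply, Prod.mk.injEq, true_and] at k
              exact hn (k ▸ hz')
          have m1' : (((act G H).comp inl) α (n, y), (n, inl α * y)) ∈ R' :=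
            (mem _ _).2 (Or.inr ⟨_, m1, rfl, rfl⟩)
          have m2 : inr h * (inl α * y) ∈ E := by
            by_contra hn
            refine ih 0 (.endB _ _ α _ hα m1' ?_)
            rw [rn]
            rintro (k | ⟨z', hz', k⟩)
            · exact h2 _ k
            · simp only [act_apply, Prod.mk.injEq, true_and] at k
              exact hn (k ▸ hz')
          rw [e]
          refine ⟨fun j hj => ?_, m2⟩
          exact ih (j+1) (.step _ _ α _ _ hα m1' ((mem _ _).2 (Or.inr ⟨_, m2, rfl, rfl⟩)) hj)
      have : Function.Injective fun m : ℕ => (⟨_, (key m).2⟩ : E) := by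
        intro i j hij
        have hij : (inr h * inl α : Coprod G H) ^ i * z = (inr h * inl α) ^ j * z :=
          congrArg Subtype.val hij
        have hij := mul_right_cancel hij
        by_contra hne
        rcases lt_or_gt_of_ne hne with hlt | hlt
        · apply infinite_order hα hh (j - i) (by omega)
          rw [pow_sub _ hlt.le, hij]; simp
        · apply infinite_order hα hh (i - j) (by omega)
          rw [pow_sub _ hlt.le, hij]; simp
      exact not_injective_infinite_finite _ this
  · exact (mem _ _).2 (Or.inr ⟨z, hz, rfl, rfl⟩)

end concrete

section generic
open Monoid Coprod

lemma exists_action {G H : Type*} [Group G] [Group H] [Countable G] [Countable H]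
    (h3 : ∀ g : G, ∃ g', g' ≠ 1 ∧ g' ≠ g) {h : H} (hh : h ≠ 1) :
    ∃ σ : Perm (ℕ × Coprod G H), Function.Injective (phi σ) ∧ IsHighlyTransitiveHom (phi σ) := by
  classical
  have E := env h3 hh
  have cK : Countable (Coprod G H) :=
    have : Countable (FreeMonoid (G ⊕ H)) := inferInstanceAs (Countable (List (G ⊕ H)))
    Coprod.mk_surjective.countable
  let X := ℕ × Coprod G H
  let S := {R : Finset (X × X) // Ok ((act G H).comp inl) (act G H (inr h)) R}
  let p0 : S := ⟨∅, ⟨⟨by simp, by simp⟩, by rintro p ⟨b, hb⟩; simp at hb⟩⟩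
  let I := X ⊕ X ⊕ {w : Coprod G H // w ≠ 1} ⊕ (Σ k, (Fin k ↪ X) × (Fin k ↪ X))
  have cI : Countable I := by
    have : ∀ k, Countable (Fin k ↪ X) := fun k => DFunLike.coe_injective.countable
    infer_instance
  have encI : Encodable I := Encodable.ofCountable I
  let Ext : S → Perm X → Prop := fun R σ => ∀ a b, (a, b) ∈ R.1 → σ a = b
  let D : I → Order.Cofinal S := fun i => match i with
    | .inl p => ⟨{R | Dm R.1 p}, fun R => by
        obtain ⟨R', s, ok, d⟩ := exists_dm E R.2 p
        exact ⟨⟨R', ok⟩, d, s⟩⟩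
    | .inr (.inl q) => ⟨{R | Rn R.1 q}, fun R => by
        obtain ⟨R', s, ok, d⟩ := exists_rn E R.2 q
        exact ⟨⟨R', ok⟩, d, s⟩⟩
    | .inr (.inr (.inl w)) => ⟨{R | ∀ σ, Ext R σ → phi σ w.1 ≠ 1}, fun R => by
        obtain ⟨F, hF⟩ := traj w.1 1
        obtain ⟨R', n, s, ok, d⟩ := faithful_ext h3 hh R.2 F
        refine ⟨⟨R', ok⟩, fun σ hσ e => w.2 ?_, s⟩
        have := hF n σ fun z hz => hσ _ _ (d z hz)
        rw [e] at this
        simpa using this.symm⟩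
    | .inr (.inr (.inr ⟨k, x, y⟩)) => ⟨{R | ∃ w, ∀ σ, Ext R σ → ∀ i, phi σ w (x i) = y i},
      fun R => by
        obtain ⟨R', l, l', β, s, ok, d⟩ := connect E R.2 x.injective y.injective
        refine ⟨⟨R', ok⟩, ⟨(wordOf h l)⁻¹ * (inl β * (wordOf h l' * wordOf h l)),
          fun σ hσ i => ?_⟩, s⟩
        obtain ⟨u, z, h1, h2, h3⟩ := d i
        have h1 := wordOf_spec h hσ _ _ _ h1
        have h2 := wordOf_spec h hσ _ _ _ h2
        have h3 := wordOf_spec h hσ _ _ _ h3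
        rw [map_mul, map_mul, map_mul, map_inv, Perm.mul_apply, Perm.mul_apply, Perm.mul_apply,
          Perm.inv_eq_iff_eq, h1, h2, h3, phi_inl]
        change ((act G H).comp inl) β _ = _
        simp⟩
  have seqmono := Order.sequenceOfCofinals.monotone p0 D
  have meets := Order.sequenceOfCofinals.encode_mem p0 D
  set s := Order.sequenceOfCofinals p0 D with hs
  have hdm : ∀ p, ∃ b n, (p, b) ∈ (s n).1 := fun p => by
    obtain ⟨b, hb⟩ : Dm _ _ := meets (.inl p)
    exact ⟨b, _, hb⟩
  have hrn : ∀ q, ∃ a n, (a, q) ∈ (s n).1 := fun q => by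
    obtain ⟨b, hb⟩ : Rn _ _ := meets (.inr (.inl q))
    exact ⟨b, _, hb⟩
  choose f nf hf using hdm
  choose g ng hg using hrn
  have up : ∀ {m n : ℕ}, m ≤ n → (s m).1 ⊆ (s n).1 := fun hmn => seqmono hmn
  let σ : Perm X :=
    { toFun := f
      invFun := g
      left_inv := fun p => by
        have h1 := up (le_max_left (nf p) (ng (f p))) (hf p)
        have h2 := up (le_max_right (nf p) (ng (f p))) (hg (f p))
        exact (s _).2.1.2 _ _ _ h2 h1
      right_inv := fun p => by
        have h1 := up (le_max_left (ng p) (nf (g p))) (hg p)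
        have h2 := up (le_max_right (ng p) (nf (g p))) (hf (g p))
        exact (s _).2.1.1 _ _ _ h2 h1 }
  have hσ : ∀ n, Ext (s n) σ := by
    intro n a b hab
    have h1 := up (le_max_left (nf a) n) (hf a)
    have h2 := up (le_max_right (nf a) n) hab
    exact (s _).2.1.1 _ _ _ h1 h2
  refine ⟨σ, ?_, ?_⟩
  · rw [injective_iff_map_eq_one]
    intro w hw
    by_contra hne
    exact (meets (.inr (.inr (.inl ⟨w, hne⟩)))) σ (hσ _) hw
  · intro k x y
    obtain ⟨w, hw⟩ := meets (.inr (.inr (.inr ⟨k, x, y⟩)))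
    exact ⟨w, hw σ (hσ _)⟩

lemma exists_action_nat {G H : Type*} [Group G] [Group H] [Countable G] [Countable H]
    (h3 : ∀ g : G, ∃ g', g' ≠ 1 ∧ g' ≠ g) {h : H} (hh : h ≠ 1) :
    ∃ φ : Coprod G H →* Perm ℕ, Function.Injective φ ∧ IsHighlyTransitiveHom φ := by
  obtain ⟨σ, h1, h2⟩ := exists_action h3 hh
  have cK : Countable (Coprod G H) :=
    have : Countable (FreeMonoid (G ⊕ H)) := inferInstanceAs (Countable (List (G ⊕ H)))
    Coprod.mk_surjective.countable
  obtain ⟨e⟩ : Nonempty (ℕ × Coprod G H ≃ ℕ) := nonempty_equiv_of_countable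
  refine ⟨e.permCongrHom.toMonoidHom.comp (phi σ), e.permCongrHom.injective.comp h1, ?_⟩
  intro k x y
  obtain ⟨w, hw⟩ := h2 k (x.trans e.symm.toEmbedding) (y.trans e.symm.toEmbedding)
  refine ⟨w, fun i => ?_⟩
  have := hw i
  simp only [Function.Embedding.trans_apply, Equiv.coe_toEmbedding] at this
  change e (phi σ w (e.symm (x i))) = _
  rw [this]; simp

lemma third_of_not {G : Type*} [Group G] [Nontrivial G]
    (h : ¬ Nonempty (G ≃* Multiplicative (ZMod 2))) : ∀ g : G, ∃ g', g' ≠ 1 ∧ g' ≠ g := by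
  by_contra hc
  push Not at hc
  obtain ⟨g, hg⟩ := hc
  apply h
  obtain ⟨k, hk⟩ := exists_ne (1 : G)
  have hk' := hg k hk
  subst hk'
  have hcard : Nat.card G = 2 := by
    rw [Nat.card_eq_two_iff]
    refine ⟨1, k, hk.symm, ?_⟩
    ext x
    have := hg x
    simp only [Set.mem_insert_iff, Set.mem_singleton_iff, Set.mem_univ, iff_true]
    tauto
  have : Fact (Nat.Prime 2) := ⟨Nat.prime_two⟩
  exact ⟨mulEquivOfPrimeCardEq (p := 2) hcard (by simp)⟩

lemma sq_one_of {G : Type*} [Group G] (e : G ≃* Multiplicative (ZMod 2)) :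
    ∃ a : G, a * a = 1 ∧ ∀ g, g = 1 ∨ g = a := by
  refine ⟨e.symm (Multiplicative.ofAdd 1), ?_, fun g => ?_⟩
  · rw [← map_mul, ← ofAdd_add]
    exact (map_eq_one_iff _ e.symm.injective).2 (by decide)
  · have : ∀ z : Multiplicative (ZMod 2), z = 1 ∨ z = Multiplicative.ofAdd 1 := by decide
    rcases this (e g) with h | h
    · left; exact (map_eq_one_iff _ e.injective).1 h
    · right; rw [← h]; simp

lemma dihedral_comm {G H : Type*} [Group G] [Group H] (e : G ≃* Multiplicative (ZMod 2))
    (f : H ≃* Multiplicative (ZMod 2)) (u v : Coprod G H) :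
    (u * u) * (v * v) = (v * v) * (u * u) := by
  obtain ⟨a, ha, ha'⟩ := sq_one_of e
  obtain ⟨b, hb, hb'⟩ := sq_one_of f
  generalize hA : (inl a : Coprod G H) = A
  generalize hB : (inr b : Coprod G H) = B
  have hAA : A * A = 1 := by rw [← hA, ← map_mul, ha, map_one]
  have hBB : B * B = 1 := by rw [← hB, ← map_mul, hb, map_one]
  have hAi : A⁻¹ = A := inv_eq_of_mul_eq_one_left hAA
  have hBi : B⁻¹ = B := inv_eq_of_mul_eq_one_left hBB
  have sc : SemiconjBy A (A * B) (A * B)⁻¹ := by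
    unfold SemiconjBy
    rw [mul_inv_rev, hAi, hBi, ← mul_assoc, hAA, one_mul, mul_assoc, hAA, mul_one]
  generalize ht : A * B = t at sc
  have sw : ∀ n : ℤ, A * t ^ n = t ^ (-n) * A := by
    intro n
    have := (sc.zpow_right n).eq
    rwa [inv_zpow, ← zpow_neg] at this
  have P : ∀ w : Coprod G H, ∃ n : ℤ, w = t ^ n ∨ w = t ^ n * A := by
    intro w
    induction w using Coprod.induction_on with
    | inl g =>
      rcases ha' g with rfl | rfl
      · exact ⟨0, by simp⟩
      · exact ⟨0, by simp [hA]⟩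
    | inr g =>
      rcases hb' g with rfl | rfl
      · exact ⟨0, by simp⟩
      · refine ⟨-1, Or.inr ?_⟩
        rw [hB, ← ht, zpow_neg_one, mul_inv_rev, hAi, hBi, mul_assoc, hAA, mul_one]
    | mul x y hx hy =>
      obtain ⟨n, rfl | rfl⟩ := hx <;> obtain ⟨m, rfl | rfl⟩ := hy
      · exact ⟨n + m, Or.inl (by rw [zpow_add])⟩
      · exact ⟨n + m, Or.inr (by rw [zpow_add, mul_assoc])⟩
      · exact ⟨n + -m, Or.inr (by rw [mul_assoc, sw, zpow_add, mul_assoc])⟩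
      · exact ⟨n + -m, Or.inl (by
          rw [mul_assoc, ← mul_assoc A, sw, mul_assoc, hAA, mul_one, zpow_add])⟩
  have Q : ∀ w : Coprod G H, ∃ n : ℤ, w * w = t ^ n := by
    intro w
    obtain ⟨n, rfl | rfl⟩ := P w
    · exact ⟨n + n, by rw [zpow_add]⟩
    · exact ⟨0, by rw [mul_assoc, ← mul_assoc A, sw, mul_assoc, hAA, mul_one, zpow_neg]; simp⟩
  obtain ⟨n, hn⟩ := Q u
  obtain ⟨m, hm⟩ := Q v
  rw [hn, hm, ← zpow_add, ← zpow_add, add_comm]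

lemma not_ht {G H : Type*} [Group G] [Group H] (e : G ≃* Multiplicative (ZMod 2))
    (f : H ≃* Multiplicative (ZMod 2)) (φ : Coprod G H →* Perm ℕ) :
    ¬ IsHighlyTransitiveHom φ := by
  intro hφ
  obtain ⟨u, hu⟩ := hφ 2 ⟨![0, 1], by decide⟩ ⟨![1, 2], by decide⟩
  obtain ⟨v, hv⟩ := hφ 4 ⟨![2, 3, 0, 5], by decide⟩ ⟨![3, 4, 5, 0], by decide⟩
  have u0 : φ u 0 = 1 := hu 0
  have u1 : φ u 1 = 2 := hu 1
  have v0 : φ v 2 = 3 := hv 0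
  have v1 : φ v 3 = 4 := hv 1
  have v2 : φ v 0 = 5 := hv 2
  have v3 : φ v 5 = 0 := hv 3
  have := congrArg (fun w => φ w 0) (dihedral_comm e f u v)
  simp [u0, u1, v0, v1, v2, v3] at this

end generic
end FP

theorem free_product_faithful_highly_transitive_iff
    (G H : Type*) [Group G] [Group H] [Countable G] [Countable H]
    [Nontrivial G] [Nontrivial H] :
    (∃ φ : Coprod G H →* Equiv.Perm ℕ,
        Function.Injective φ ∧ IsHighlyTransitiveHom φ) ↔
      ¬ (Nonempty (G ≃* Multiplicative (ZMod 2)) ∧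
          Nonempty (H ≃* Multiplicative (ZMod 2))) := by
  constructor
  · rintro ⟨φ, -, hφ⟩ ⟨⟨e⟩, ⟨f⟩⟩
    exact FP.not_ht e f φ hφ
  · intro hn
    rw [not_and_or] at hn
    rcases hn with hn | hn
    · obtain ⟨h, hh⟩ := exists_ne (1 : H)
      exact FP.exists_action_nat (FP.third_of_not hn) hh
    · obtain ⟨g, hg⟩ := exists_ne (1 : G)
      obtain ⟨φ, h1, h2⟩ := FP.exists_action_nat (FP.third_of_not hn) hg
      refine ⟨φ.comp (Coprod.swap G H), h1.comp Coprod.swap_injective, fun k x y => ?_⟩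
      obtain ⟨w, hw⟩ := h2 k x y
      exact ⟨Coprod.swap H G w, fun i => by simpa using hw i⟩
end

section
/- The group PSL₂(Z) admits a faithful and highly transitive action on a countable set. -/
set_option linter.unusedSimpArgs false

/-- The underlying countable set: a disjoint union of triangles. -/
abbrev XX := ℕ × Fin 3

/-- Rotation of all triangles. -/
def tau : Equiv.Perm XX := Equiv.prodCongr (Equiv.refl ℕ) (Equiv.addRight (1 : Fin 3))

theorem tau_apply (p : XX) : tau p = (p.1, p.2 + 1) := rfl

/-- `tau` or its inverse. -/
def te (e : Bool) : Equiv.Perm XX := tau ^ (if e then 1 else 2)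

theorem te_true (p : XX) : te true p = (p.1, p.2 + 1) := by
  simp [te, tau_apply]

theorem te_false (p : XX) : te false p = (p.1, p.2 + 2) := by
  simp [te, tau_apply, pow_two, add_assoc]

theorem te_fst (e : Bool) (p : XX) : (te e p).1 = p.1 := by
  cases e <;> simp [te_true, te_false]

/-- A finite partial fixed-point-free involution without finite closed components. -/
structure St where
  σ : Equiv.Perm XX
  inv : ∀ p, σ (σ p) = p
  fin : {p | σ p ≠ p}.Finite
  C : ∀ A : Set XX, (∀ p ∈ A, σ p ≠ p) → (∀ p ∈ A, σ p ∈ A) → (∀ p ∈ A, tau p ∈ A) → A = ∅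

/-- `π` extends `σ`. -/
def Extd (σ π : Equiv.Perm XX) : Prop := ∀ p, σ p ≠ p → π p = σ p

theorem Extd.refl (σ : Equiv.Perm XX) : Extd σ σ := fun _ _ => rfl

theorem Extd.trans {a b c : Equiv.Perm XX} (h1 : Extd a b) (h2 : Extd b c) : Extd a c := by
  intro p hp
  have := h1 p hp
  rw [h2 p (by rw [this]; exact hp), this]

theorem Extd.supp {a b : Equiv.Perm XX} (h1 : Extd a b) {p : XX} (hp : a p ≠ p) : b p ≠ p := by
  rw [h1 p hp]; exact hp

theorem St.exists_bound (s : St) : ∃ M : ℕ, ∀ p : XX, s.σ p ≠ p → p.1 < M := by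
  obtain ⟨M, hM⟩ := (s.fin.image Prod.fst).bddAbove
  exact ⟨M + 1, fun p hp => Nat.lt_succ_of_le (hM ⟨p, hp, rfl⟩)⟩

theorem tau_closed_te {A : Set XX} (h : ∀ p ∈ A, tau p ∈ A) (e : Bool) {p : XX} (hp : p ∈ A) :
    te e p ∈ A := by
  cases e
  · have := h _ (h p hp)
    simpa [te, pow_two] using this
  · simpa [te] using h p hp

/-- Adding one transposition. -/
theorem St.swap (s : St) (b c : XX) (hbc : b ≠ c) (hb : s.σ b = b) (hc : s.σ c = c)
    (hd : ∃ e, s.σ (te e c) = te e c ∧ te e c ≠ b) :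
    ∃ s' : St, Extd s.σ s'.σ ∧ s'.σ b = c ∧ s'.σ c = b ∧
      ∀ p, p ≠ b → p ≠ c → s'.σ p = s.σ p := by
  have key : ∀ p, p ≠ b → p ≠ c → (s.σ * Equiv.swap b c) p = s.σ p := by
    intro p h1 h2
    simp [Equiv.swap_apply_of_ne_of_ne h1 h2]
  have kb : (s.σ * Equiv.swap b c) b = c := by simp [hc]
  have kc : (s.σ * Equiv.swap b c) c = b := by simp [hb]
  have hne : ∀ p, p ≠ b → p ≠ c → s.σ p ≠ b ∧ s.σ p ≠ c := by
    intro p h1 h2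
    constructor
    · intro h; apply h1; rw [← s.inv p, h, hb]
    · intro h; apply h2; rw [← s.inv p, h, hc]
  refine ⟨⟨s.σ * Equiv.swap b c, ?_, ?_, ?_⟩, ?_, kb, kc, key⟩
  · intro p
    by_cases h1 : p = b
    · subst h1; rw [kb, kc]
    by_cases h2 : p = c
    · subst h2; rw [kc, kb]
    rw [key p h1 h2, key _ (hne p h1 h2).1 (hne p h1 h2).2, s.inv]
  · refine (s.fin.union (Set.toFinite {b, c})).subset ?_
    intro p hp
    by_cases h1 : p = b
    · right; simp [h1]
    by_cases h2 : p = c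
    · right; simp [h2]
    left
    have : (s.σ * Equiv.swap b c) p ≠ p := hp
    rw [key p h1 h2] at this
    exact this
  · intro A hA hs ht
    have hcA : c ∉ A := by
      intro h
      obtain ⟨e, he, heb⟩ := hd
      have h3 := tau_closed_te ht e h
      apply hA _ h3
      rw [key _ heb _, he]
      cases e
      · rw [te_false]; intro h; have := congrArg Prod.snd h; simp at this
      · rw [te_true]; intro h; have := congrArg Prod.snd h; simp at this
    have hbA : b ∉ A := by
      intro h
      have := hs _ h
      rw [kb] at this
      exact hcA this
    have hk : ∀ p ∈ A, (s.σ * Equiv.swap b c) p = s.σ p := fun p hp =>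
      key p (fun h => hbA (h ▸ hp)) (fun h => hcA (h ▸ hp))
    apply s.C A
    · intro p hp; rw [← hk p hp]; exact hA p hp
    · intro p hp; rw [← hk p hp]; exact hs p hp
    · exact ht
  · intro p hp
    apply key
    · rintro rfl; exact hp hb
    · rintro rfl; exact hp hc

/-- Adding finitely many transpositions. -/
theorem St.swaps {κ : Type*} [DecidableEq κ] (s : St) (b c : κ → XX) (J : Finset κ)
    (hbi : ∀ i ∈ J, ∀ j ∈ J, b i = b j → i = j) (hci : ∀ i ∈ J, ∀ j ∈ J, c i = c j → i = j)
    (hbc : ∀ i ∈ J, ∀ j ∈ J, b i ≠ c j) (hb : ∀ i ∈ J, s.σ (b i) = b i)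
    (hc : ∀ i ∈ J, s.σ (c i) = c i)
    (hd : ∀ i ∈ J, ∃ e, s.σ (te e (c i)) = te e (c i) ∧
      ∀ j ∈ J, te e (c i) ≠ b j ∧ te e (c i) ≠ c j) :
    ∃ s' : St, Extd s.σ s'.σ ∧ (∀ i ∈ J, s'.σ (b i) = c i ∧ s'.σ (c i) = b i) ∧
      ∀ p, (∀ i ∈ J, p ≠ b i ∧ p ≠ c i) → s'.σ p = s.σ p := by
  induction J using Finset.induction_on with
  | empty => exact ⟨s, Extd.refl _, by simp, by simp⟩
  | insert a J ha ih =>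
    have hJ : ∀ i ∈ J, i ∈ insert a J := fun i hi => Finset.mem_insert_of_mem hi
    have haa := Finset.mem_insert_self a J
    obtain ⟨s1, h1, h2, h3⟩ := ih (fun i hi j hj => hbi i (hJ i hi) j (hJ j hj))
      (fun i hi j hj => hci i (hJ i hi) j (hJ j hj))
      (fun i hi j hj => hbc i (hJ i hi) j (hJ j hj))
      (fun i hi => hb i (hJ i hi)) (fun i hi => hc i (hJ i hi))
      (fun i hi => by
        obtain ⟨e, he, hh⟩ := hd i (hJ i hi)
        exact ⟨e, he, fun j hj => hh j (hJ j hj)⟩)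
    have hne : ∀ i ∈ J, i ≠ a := by rintro i hi rfl; exact ha hi
    obtain ⟨s2, g1, g2, g3, g4⟩ := s1.swap (b a) (c a) (hbc a haa a haa)
      (by
        rw [h3, hb a haa]
        intro i hi
        exact ⟨fun h => hne i hi (hbi _ haa _ (hJ i hi) h).symm, hbc a haa i (hJ i hi)⟩)
      (by
        rw [h3, hc a haa]
        intro i hi
        exact ⟨(hbc i (hJ i hi) a haa).symm, fun h => hne i hi (hci _ haa _ (hJ i hi) h).symm⟩)
      (by
        obtain ⟨e, he, hh⟩ := hd a haa
        exact ⟨e, by rw [h3 _ (fun j hj => hh j (hJ j hj)), he], (hh a haa).1⟩)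
    refine ⟨s2, h1.trans g1, ?_, ?_⟩
    · intro i hi
      rcases Finset.mem_insert.1 hi with rfl | hi'
      · exact ⟨g2, g3⟩
      · have hia := hne i hi'
        rw [g4, g4]
        · exact h2 i hi'
        · exact fun h => hbc a haa i hi h.symm
        · exact fun h => hia (hci _ hi _ haa h)
        · exact fun h => hia (hbi _ hi _ haa h)
        · exact hbc i hi a haa
    · intro p hp
      rw [g4 p (hp a haa).1 (hp a haa).2, h3 p (fun i hi => hp i (hJ i hi))]

/-- Nice indices: those sitting in a triangle alone with both other points open. -/
def Nice {n : ℕ} (σ : Equiv.Perm XX) (x : Fin n → XX) (N : Finset (Fin n)) : Prop :=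
  ∀ i ∈ N, (∀ e, σ (te e (x i)) = te e (x i)) ∧ ∀ j, j ≠ i → (x j).1 ≠ (x i).1

theorem St.step {n : ℕ} (s : St) (x : Fin n → XX) (hx : Function.Injective x) (e : Bool)
    (N : Finset (Fin n)) (hN : Nice s.σ x N) (M₀ : ℕ) :
    ∃ (s' : St) (N' : Finset (Fin n)), Extd s.σ s'.σ ∧
      (∀ i, s'.σ (te e (x i)) ≠ te e (x i)) ∧
      Nice s'.σ (fun i => s'.σ (te e (x i))) N' ∧ N ⊆ N' ∧
      (∀ i, s.σ (te e (x i)) = te e (x i) → i ∈ N') ∧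
      (∀ i ∈ N', M₀ ≤ (s'.σ (te e (x i))).1) ∧
      (∀ p, s'.σ p ≠ p → s.σ p ≠ p ∨ (∃ i ∈ N', p = te e (x i)) ∨ M₀ ≤ p.1) := by
  classical
  obtain ⟨M₁, hM₁⟩ := s.exists_bound
  obtain ⟨M₂, hM₂⟩ := (Set.finite_range (fun i => (x i).1)).bddAbove
  have hM₂ : ∀ i, (x i).1 ≤ M₂ := fun i => hM₂ ⟨i, rfl⟩
  obtain ⟨M, m0, m1, m2⟩ : ∃ M, M₀ ≤ M ∧ M₁ ≤ M ∧ M₂ < M :=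
    ⟨M₀ + M₁ + M₂ + 1, by omega, by omega, by omega⟩
  let J : Finset (Fin n) := Finset.univ.filter (fun i => s.σ (te e (x i)) = te e (x i))
  have hJ : ∀ i, i ∈ J ↔ s.σ (te e (x i)) = te e (x i) := by intro i; simp [J]
  have open_ : ∀ p : XX, M ≤ p.1 → s.σ p = p := by
    intro p hp
    by_contra h
    have := hM₁ p h
    omega
  have tlt : ∀ i, (te e (x i)).1 < M := by
    intro i; rw [te_fst]; have := hM₂ i; omega
  obtain ⟨s', h1, h2, h3⟩ := s.swaps (fun i => te e (x i)) (fun i : Fin n => ((M + i, 0) : XX)) J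
    (fun i _ j _ h => hx ((te e).injective h))
    (fun i _ j _ h => by
      have := congrArg Prod.fst h
      exact Fin.ext (by simpa using this))
    (fun i _ j _ h => by
      have h4 := tlt i
      rw [h] at h4
      simp at h4)
    (fun i hi => (hJ i).1 hi)
    (fun i hi => open_ _ (by simp))
    (fun i hi => ⟨true, open_ _ (by simp [te_true]), fun j hj => ⟨fun h => by
        have h4 := tlt j
        rw [← h] at h4
        simp [te_true] at h4, fun h => by
        have := congrArg Prod.snd h
        simp [te_true] at this⟩⟩)
  refine ⟨s', J, h1, ?_, ?_, ?_, ?_, ?_, ?_⟩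
  · intro i
    by_cases hi : i ∈ J
    · rw [(h2 i hi).1]
      intro h
      have h4 := tlt i
      rw [← h] at h4
      simp at h4
    · exact h1.supp (fun h => hi ((hJ i).2 h))
  · intro i hi
    have e1 : s'.σ (te e (x i)) = (M + i, 0) := (h2 i hi).1
    constructor
    · intro e'
      simp only [e1]
      rw [h3, open_]
      · rw [te_fst]; simp
      · intro j hj
        constructor
        · intro h
          have h4 := tlt j
          rw [← h, te_fst] at h4
          simp at h4
        · intro h
          have := congrArg Prod.snd h
          cases e' <;> simp [te_true, te_false] at this
    · intro j hj
      simp only [e1]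
      by_cases hjJ : j ∈ J
      · have e2 : s'.σ (te e (x j)) = (M + j, 0) := (h2 j hjJ).1
        rw [e2]
        intro h
        exact hj (Fin.ext (by simpa using h))
      · have h5 : s.σ (te e (x j)) ≠ te e (x j) := fun h => hjJ ((hJ j).2 h)
        rw [h1 _ h5]
        have h6 : s.σ (s.σ (te e (x j))) ≠ s.σ (te e (x j)) := by
          rw [s.inv]; exact h5.symm
        have := hM₁ _ h6
        intro h
        omega
  · intro i hi
    exact (hJ i).2 ((hN i hi).1 e)
  · intro i hi
    exact (hJ i).2 hi
  · intro i hi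
    rw [(h2 i hi).1]
    simp only
    omega
  · intro p hp
    by_contra hcon
    push Not at hcon
    obtain ⟨c1, c2, c3⟩ := hcon
    apply hp
    rw [h3 p, c1]
    intro i hi
    refine ⟨c2 i hi, ?_⟩
    rintro rfl
    simp only at c3
    omega

/-- `x` can be moved to `y` using only the part of the involution fixed by `σ`. -/
def Reach (σ : Equiv.Perm XX) {ι : Type} (x y : ι → XX) : Prop :=
  ∀ π : Equiv.Perm XX, Extd σ π →
    ∃ g ∈ Subgroup.closure ({π, tau} : Set (Equiv.Perm XX)), ∀ i, g (x i) = y i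

theorem Reach.refl (σ : Equiv.Perm XX) {ι : Type} (x : ι → XX) : Reach σ x x :=
  fun _ _ => ⟨1, Subgroup.one_mem _, fun _ => rfl⟩

theorem Reach.mono {σ σ' : Equiv.Perm XX} {ι : Type} {x y : ι → XX} (h : Reach σ x y)
    (hs : Extd σ σ') : Reach σ' x y := fun π hπ => h π (hs.trans hπ)

theorem Reach.trans {σ : Equiv.Perm XX} {ι : Type} {x y z : ι → XX} (h : Reach σ x y)
    (h' : Reach σ y z) : Reach σ x z := by
  intro π hπ
  obtain ⟨g, hg, h1⟩ := h π hπ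
  obtain ⟨g', hg', h2⟩ := h' π hπ
  exact ⟨g' * g, Subgroup.mul_mem _ hg' hg, fun i => by simp [h1, h2]⟩

theorem Reach.symm {σ : Equiv.Perm XX} {ι : Type} {x y : ι → XX} (h : Reach σ x y) :
    Reach σ y x := by
  intro π hπ
  obtain ⟨g, hg, h1⟩ := h π hπ
  exact ⟨g⁻¹, Subgroup.inv_mem _ hg, fun i => by simp [← h1]⟩

theorem Reach.comp {σ : Equiv.Perm XX} {ι κ : Type} {x y : ι → XX} (h : Reach σ x y)
    (f : κ → ι) : Reach σ (x ∘ f) (y ∘ f) := by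
  intro π hπ
  obtain ⟨g, hg, h1⟩ := h π hπ
  exact ⟨g, hg, fun i => h1 _⟩

theorem Reach.te (σ : Equiv.Perm XX) {ι : Type} (x : ι → XX) (e : Bool) :
    Reach σ x (fun i => te e (x i)) := by
  intro π _
  exact ⟨_root_.te e, Subgroup.pow_mem _ (Subgroup.subset_closure (by simp)) _, fun _ => rfl⟩

theorem Reach.sig (σ : Equiv.Perm XX) {ι : Type} (x : ι → XX) (h : ∀ i, σ (x i) ≠ x i) :
    Reach σ x (fun i => σ (x i)) := by
  intro π hπ
  exact ⟨π, Subgroup.subset_closure (by simp), fun i => hπ _ (h i)⟩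

/-- Paths of steps inside the support. -/
def TPath (σ : Equiv.Perm XX) : List Bool → XX → XX → Prop
  | [], z, y => z = y
  | e :: w, z, y => σ (te e z) ≠ te e z ∧ TPath σ w (σ (te e z)) y

theorem TPath.snoc {σ : Equiv.Perm XX} {w : List Bool} {z y : XX} (h : TPath σ w z y) (e : Bool)
    (he : σ (te e y) ≠ te e y) : TPath σ (w ++ [e]) z (σ (te e y)) := by
  induction w generalizing z with
  | nil => cases h; exact ⟨he, rfl⟩
  | cons a w ih => exact ⟨h.1, ih h.2⟩

theorem TPath.mono {σ σ' : Equiv.Perm XX} (hs : Extd σ σ') {w : List Bool} {z y : XX}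
    (h : TPath σ w z y) : TPath σ' w z y := by
  induction w generalizing z with
  | nil => exact h
  | cons a w ih =>
    refine ⟨hs.supp h.1, ?_⟩
    rw [hs _ h.1]
    exact ih h.2

theorem TPath.end_supp (s : St) {w : List Bool} {z y : XX} (hw : w ≠ [])
    (h : TPath s.σ w z y) : s.σ y ≠ y := by
  induction w generalizing z with
  | nil => exact absurd rfl hw
  | cons a w ih =>
    by_cases hw' : w = []
    · subst hw'
      have h2 : s.σ (te a z) = y := h.2
      rw [← h2, s.inv]
      exact h.1.symm
    · exact ih hw' h.2

theorem tau_tau_tau (p : XX) : tau (tau (tau p)) = p := by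
  simp only [tau_apply, add_assoc]
  ext <;> simp

theorem St.exists_path (s : St) (z : XX) :
    ∃ w y e, TPath s.σ w z y ∧ s.σ (te e y) = te e y := by
  by_contra hcon
  push Not at hcon
  let A : Set XX := {y | ∃ w, TPath s.σ w z y}
  have hopen : ∀ y ∈ A, ∀ e, s.σ (te e y) ≠ te e y := by
    rintro y ⟨w, hw⟩ e
    exact hcon w y e hw
  have hcl : ∀ y ∈ A, ∀ e, s.σ (te e y) ∈ A := by
    rintro y ⟨w, hw⟩ e
    exact ⟨_, hw.snoc e (hcon w y e hw)⟩
  have hfin : A.Finite := by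
    refine (s.fin.union (Set.finite_singleton z)).subset ?_
    rintro y ⟨w, hw⟩
    by_cases h : w = []
    · subst h; right; exact hw.symm
    · left; exact TPath.end_supp s h hw
  have hsurj : ∀ v ∈ A, ∃ u ∈ A, s.σ (tau u) = v := by
    have hinj : Set.InjOn (fun u => s.σ (tau u)) A :=
      fun a _ b _ h => tau.injective (s.σ.injective h)
    have hm : Set.MapsTo (fun u => s.σ (tau u)) A A := by
      intro u hu
      have := hcl u hu true
      simpa [te] using this
    have := (Set.Finite.injOn_iff_bijOn_of_mapsTo hfin hm).1 hinj
    intro v hv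
    obtain ⟨u, hu, h⟩ := this.surjOn hv
    exact ⟨u, hu, h⟩
  have htau : ∀ y ∈ A, tau y ∈ A := by
    intro y hy
    obtain ⟨u, hu, h⟩ := hsurj _ (hcl y hy false)
    have h2 := s.σ.injective h
    have h3 : tau u = tau (tau y) := by rw [h2]; simp [te, pow_two]
    rw [← tau.injective h3]
    exact hu
  have hsig : ∀ y ∈ A, s.σ y ∈ A := by
    intro y hy
    obtain ⟨u, hu, h⟩ := hsurj y hy
    rw [← h, s.inv]
    exact htau u hu
  have hE : A = ∅ := by
    refine s.C A ?_ hsig htau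
    intro p hp
    have := hopen _ (htau _ (htau _ hp)) true
    simpa [te, tau_tau_tau] using this
  have : z ∈ A := ⟨[], rfl⟩
  rw [hE] at this
  exact this

theorem push_aux {n : ℕ} (w : List Bool) : ∀ (s : St) (x : Fin n → XX) (_ : Function.Injective x)
    (N : Finset (Fin n)) (_ : Nice s.σ x N) (z : Fin n) (_ : z ∉ N) (y : XX) (e : Bool)
    (_ : TPath s.σ w (x z) y) (_ : s.σ (te e y) = te e y)
    (_ : ∀ a w', w = a :: w' → ∀ j ∈ N, te e y ≠ te a (x j)),
    ∃ (s' : St) (x' : Fin n → XX) (N' : Finset (Fin n)), Extd s.σ s'.σ ∧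
      Function.Injective x' ∧ Reach s'.σ x x' ∧ Nice s'.σ x' N' ∧ N.card < N'.card := by
  induction w with
  | nil =>
    intro s x hx N hN z hz y e hp ho _
    cases hp
    obtain ⟨s', N', h1, h2, h3, h4, h5, h6, h7⟩ := s.step x hx e N hN 0
    refine ⟨s', _, N', h1, ?_, (Reach.te _ x e).trans (Reach.sig _ _ h2), h3, ?_⟩
    · intro i j h; exact hx ((te e).injective (s'.σ.injective h))
    · exact Finset.card_lt_card ⟨h4, fun h => hz (h (h5 z ho))⟩
  | cons a w ih =>
    intro s x hx N hN z hz y e hp ho hb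
    obtain ⟨s', N', h1, h2, h3, h4, h5, h6, h7⟩ := s.step x hx a N hN (y.1 + 1)
    have hinj : Function.Injective (fun i => s'.σ (te a (x i))) :=
      fun i j h => hx ((te a).injective (s'.σ.injective h))
    have hr : Reach s'.σ x (fun i => s'.σ (te a (x i))) :=
      (Reach.te _ x a).trans (Reach.sig _ _ h2)
    by_cases hNN : N' ⊆ N
    · have hE : N' = N := Finset.Subset.antisymm hNN h4
      subst hE
      obtain ⟨s'', x'', N'', g1, g2, g3, g4, g5⟩ := ih s' _ hinj N' h3 z hz y e
        (by
          have := hp.2.mono h1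
          rw [← h1 _ hp.1] at this
          exact this)
        (by
          by_contra hcon
          rcases h7 _ hcon with h | ⟨i, hi, h⟩ | h
          · exact h ho
          · exact hb a w rfl i hi h
          · rw [te_fst] at h; omega)
        (by
          intro a' w' _ j hj h
          have h8 := h6 j hj
          have h9 := congrArg Prod.fst h
          rw [te_fst, te_fst] at h9
          omega)
      exact ⟨s'', x'', N'', h1.trans g1, g2, (hr.mono g1).trans g3, g4, g5⟩
    · exact ⟨s', _, N', h1, hinj, hr, h3, Finset.card_lt_card ⟨h4, hNN⟩⟩

theorem te_cases (p q : XX) (h : p.1 = q.1) : p = q ∨ ∃ e, p = te e q := by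
  obtain ⟨a, i⟩ := p
  obtain ⟨b, j⟩ := q
  simp only at h
  subst h
  have : ∀ i j : Fin 3, i = j ∨ i = j + 1 ∨ i = j + 2 := by decide
  rcases this i j with h | h | h
  · left; rw [h]
  · right; exact ⟨true, by rw [te_true, h]⟩
  · right; exact ⟨false, by rw [te_false, h]⟩

theorem te_not_ne (e : Bool) (p : XX) : te (!e) p ≠ te e p := by
  cases e
  · simp only [Bool.not_false, te_true, te_false]
    intro h; have := congrArg Prod.snd h; simp at this
  · simp only [Bool.not_true, te_true, te_false]
    intro h; have := congrArg Prod.snd h; simp at this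

theorem push_one {n : ℕ} (s : St) (x : Fin n → XX) (hx : Function.Injective x)
    (N : Finset (Fin n)) (hN : Nice s.σ x N) (z : Fin n) (hz : z ∉ N) :
    ∃ (s' : St) (x' : Fin n → XX) (N' : Finset (Fin n)), Extd s.σ s'.σ ∧
      Function.Injective x' ∧ Reach s'.σ x x' ∧ Nice s'.σ x' N' ∧ N.card < N'.card := by
  obtain ⟨w, y, e, hp, ho⟩ := s.exists_path (x z)
  by_cases hbad : ∃ a w', w = a :: w' ∧ ∃ j ∈ N, te e y = te a (x j)
  · obtain ⟨a, w', rfl, j, hj, h⟩ := hbad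
    have hy : y = x j := by
      have hf := congrArg Prod.fst h
      rw [te_fst, te_fst] at hf
      rcases te_cases _ _ hf with h' | ⟨e', h'⟩
      · exact h'
      · exfalso
        apply TPath.end_supp s (by simp) hp
        rw [h']
        exact (hN j hj).1 e'
    subst hy
    refine push_aux (a :: w') s x hx N hN z hz (x j) (!a) hp ((hN j hj).1 _) ?_
    intro a' w'' hw i hi hcon
    cases hw
    by_cases hij : i = j
    · subst hij
      exact te_not_ne _ _ hcon
    · have hf := congrArg Prod.fst hcon
      rw [te_fst, te_fst] at hf
      exact (hN j hj).2 i hij hf.symm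
  · push Not at hbad
    exact push_aux w s x hx N hN z hz y e hp ho (fun a w' h j hj => hbad a w' h j hj)

theorem push_all {n : ℕ} (m : ℕ) : ∀ (s : St) (x : Fin n → XX) (_ : Function.Injective x)
    (N : Finset (Fin n)) (_ : Nice s.σ x N) (_ : n - N.card = m),
    ∃ (s' : St) (x' : Fin n → XX), Extd s.σ s'.σ ∧
      Function.Injective x' ∧ Reach s'.σ x x' ∧ Nice s'.σ x' Finset.univ := by
  induction m using Nat.strong_induction_on with
  | _ m ih =>
    intro s x hx N hN hm
    by_cases h : N = Finset.univ
    · subst h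
      exact ⟨s, x, Extd.refl _, hx, Reach.refl _ _, hN⟩
    · have : ∃ z, z ∉ N := by
        by_contra hc
        push Not at hc
        exact h (Finset.eq_univ_of_forall hc)
      obtain ⟨z, hz⟩ := this
      obtain ⟨s', x', N', h1, h2, h3, h4, h5⟩ := push_one s x hx N hN z hz
      have hle : N'.card ≤ n := by simpa using Finset.card_le_univ N'
      obtain ⟨s'', x'', g1, g2, g3, g4⟩ := ih (n - N'.card) (by omega) s' x' h2 N' h4 rfl
      exact ⟨s'', x'', h1.trans g1, g2, (h3.mono g1).trans g3, g4⟩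

theorem St.connect {n k : ℕ} (s : St) (z : Fin n → XX) (hz : Nice s.σ z Finset.univ)
    (α β : Fin k → Fin n) (hα : Function.Injective α) (hβ : Function.Injective β) :
    ∃ s' : St, Extd s.σ s'.σ ∧ Reach s'.σ (z ∘ α) (z ∘ β) := by
  classical
  obtain ⟨M₁, hM₁⟩ := s.exists_bound
  obtain ⟨M₂, hM₂⟩ := (Set.finite_range (fun i => (z i).1)).bddAbove
  have hM₂ : ∀ i, (z i).1 ≤ M₂ := fun i => hM₂ ⟨i, rfl⟩
  obtain ⟨M, m1, m2⟩ : ∃ M, M₁ ≤ M ∧ M₂ < M := ⟨M₁ + M₂ + 1, by omega, by omega⟩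
  have open_ : ∀ p : XX, M ≤ p.1 → s.σ p = p := by
    intro p hp
    by_contra h
    have := hM₁ p h
    omega
  have tlt : ∀ e i, (te e (z i)).1 < M := by
    intro e i; rw [te_fst]; have := hM₂ i; omega
  have hzi : ∀ i j, (z i).1 = (z j).1 → i = j := by
    intro i j h
    by_contra hij
    exact (hz j (Finset.mem_univ _)).2 i hij h
  let γ : Bool → Fin k → Fin n := fun e => if e then α else β
  have hγ : ∀ e, Function.Injective (γ e) := by intro e; cases e <;> simpa [γ]
  let b : Bool × Fin k → XX := fun q => te q.1 (z (γ q.1 q.2))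
  let c : Bool × Fin k → XX := fun q => (M + q.2, if q.1 then 0 else 1)
  have hbM : ∀ q, (b q).1 < M := fun q => tlt _ _
  have hcM : ∀ q, M ≤ (c q).1 := fun q => by simp [c]
  have hd2 : ∀ q : Bool × Fin k, ((M + q.2, 2) : XX) = te (!q.1) (c q) := by
    rintro ⟨e, i⟩
    cases e <;> simp [c, te_true, te_false]
  obtain ⟨s', h1, h2, h3⟩ := s.swaps b c Finset.univ
    (by
      rintro ⟨e, i⟩ _ ⟨e', j⟩ _ h
      have hf := congrArg Prod.fst h
      simp only [b, te_fst] at hf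
      have hg := hzi _ _ hf
      have he : e = e' := by
        by_contra hne
        have : e = !e' := by cases e <;> cases e' <;> simp_all
        subst this
        simp only [b, hg] at h
        exact te_not_ne _ _ h
      subst he
      rw [hγ e hg])
    (by
      rintro ⟨e, i⟩ _ ⟨e', j⟩ _ h
      have hf := congrArg Prod.fst h
      have hs := congrArg Prod.snd h
      simp only [c] at hf hs
      have : i = j := Fin.ext (by omega)
      subst this
      cases e <;> cases e' <;> simp at hs ⊢)
    (by
      intro i _ j _ h
      have h4 := hbM i
      have h5 := hcM j
      rw [h] at h4
      omega)
    (fun q _ => (hz _ (Finset.mem_univ _)).1 _)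
    (fun q _ => open_ _ (hcM q))
    (by
      intro q _
      refine ⟨!q.1, open_ _ (by rw [te_fst]; exact hcM q), fun j _ => ⟨?_, ?_⟩⟩
      · intro h
        have h4 := hbM j
        have h5 := hcM q
        rw [← h, te_fst] at h4
        omega
      · intro h
        rw [← hd2] at h
        have hs := congrArg Prod.snd h
        rcases j with ⟨e, j⟩
        cases e <;> simp [c] at hs)
  refine ⟨s', h1, ?_⟩
  have hne : ∀ q, b q ≠ c q := by
    intro q h
    have h4 := hbM q
    have h5 := hcM q
    rw [h] at h4
    omega
  have hbc : ∀ e, Reach s'.σ (fun i => b (e, i)) (fun i => c (e, i)) := by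
    intro e
    have := Reach.sig s'.σ (fun i => b (e, i)) (fun i => by
      rw [(h2 (e, i) (Finset.mem_univ _)).1]; exact (hne _).symm)
    have hE : (fun i => s'.σ (b (e, i))) = fun i => c (e, i) := by
      funext i; exact (h2 (e, i) (Finset.mem_univ _)).1
    rw [hE] at this
    exact this
  have hcc : Reach s'.σ (fun i => c (true, i)) (fun i => c (false, i)) := by
    have := Reach.te s'.σ (fun i => c (true, i)) true
    have hE : (fun i => te true (c (true, i))) = fun i => c (false, i) := by
      funext i; simp [c, te_true]
    rw [hE] at this
    exact this
  have hzb : ∀ e, Reach s'.σ (z ∘ γ e) (fun i => b (e, i)) := fun e => Reach.te _ _ e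
  have := (((hzb true).trans (hbc true)).trans hcc).trans ((hzb false).trans (hbc false)).symm
  simpa [γ] using this

theorem St.dense_trans (s : St) {k : ℕ} (x y : Fin k → XX) (hx : Function.Injective x)
    (hy : Function.Injective y) : ∃ s' : St, Extd s.σ s'.σ ∧ Reach s'.σ x y := by
  classical
  let Z : Finset XX := Finset.univ.image x ∪ Finset.univ.image y
  let f : Fin Z.card ≃ Z := Z.equivFin.symm
  let α : Fin k → Fin Z.card := fun i => f.symm ⟨x i, by simp [Z]⟩
  let β : Fin k → Fin Z.card := fun i => f.symm ⟨y i, by simp [Z]⟩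
  let z : Fin Z.card → XX := fun i => f i
  have hα : z ∘ α = x := by funext i; simp [z, α]
  have hβ : z ∘ β = y := by funext i; simp [z, β]
  have hαi : Function.Injective α := by
    apply Function.Injective.of_comp (f := z); rw [hα]; exact hx
  have hβi : Function.Injective β := by
    apply Function.Injective.of_comp (f := z); rw [hβ]; exact hy
  have hz : Function.Injective z := Subtype.val_injective.comp f.injective
  obtain ⟨s1, z', h1, h2, h3, h4⟩ := push_all _ s z hz ∅ (by intro i hi; simp at hi) rfl
  obtain ⟨s2, g1, g2⟩ := s1.connect z' h4 α β hαi hβi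
  refine ⟨s2, h1.trans g1, ?_⟩
  rw [← hα, ← hβ]
  exact (((h3.comp α).mono g1).trans g2).trans ((h3.comp β).mono g1).symm

/-- Words in `s t` and `s t⁻¹`. -/
def WW {K : Type*} [Group K] (s t : K) : List Bool → K
  | [] => 1
  | e :: w => s * t ^ (if e then 1 else 2) * WW s t w

instance : Preorder St where
  le a b := Extd a.σ b.σ
  le_refl a := Extd.refl _
  le_trans _ _ _ h1 h2 := h1.trans h2

theorem run_word (w : List Bool) (s : St) (q : Fin 1 → XX) (hq : Nice s.σ q Finset.univ) (M : ℕ) :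
    ∃ (s' : St) (q' : Fin 1 → XX), Extd s.σ s'.σ ∧ Nice s'.σ q' Finset.univ ∧
      (∀ π, Extd s'.σ π → WW π tau w (q 0) = q' 0) ∧ (w = [] → q' = q) ∧
      (w ≠ [] → M ≤ (q' 0).1) := by
  induction w with
  | nil => exact ⟨s, q, Extd.refl _, hq, fun _ _ => rfl, fun _ => rfl, fun h => absurd rfl h⟩
  | cons e w ih =>
    obtain ⟨s1, q1, h1, h2, h3, -, -⟩ := ih
    obtain ⟨s', N', g1, g2, g3, g4, g5, g6, g7⟩ :=
      s1.step q1 (Function.injective_of_subsingleton q1) e Finset.univ h2 M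
    have hN : N' = Finset.univ := Finset.univ_subset_iff.1 g4
    subst hN
    refine ⟨s', _, h1.trans g1, g3, ?_, by simp, fun _ => g6 0 (Finset.mem_univ _)⟩
    intro π hπ
    have := h3 π (g1.trans hπ)
    simp only [WW, Equiv.Perm.mul_apply, this]
    exact hπ _ (g2 0)

theorem St.dense_faithful (s : St) (w : List Bool) (d : Bool) (h : w ≠ [] ∨ d = true) :
    ∃ s' : St, Extd s.σ s'.σ ∧ ∃ x : XX, ∀ π, Extd s'.σ π →
      ((WW π tau w * π ^ (if d then 1 else 0)) x).1 ≠ x.1 := by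
  obtain ⟨M, hM⟩ := s.exists_bound
  have open_ : ∀ p : XX, M ≤ p.1 → s.σ p = p := by
    intro p hp
    by_contra h
    have := hM p h
    omega
  obtain ⟨s1, h1, h2, h3, h4⟩ := s.swap (M, 0) (M + 1, 0) (by simp) (open_ _ (by simp))
    (open_ _ (by simp)) ⟨true, open_ _ (by simp [te_true]), by simp [te_true]⟩
  obtain ⟨s2, q', g1, g2, g3, g4, g5⟩ := run_word w s1 (fun _ => (M + 1, 0)) (by
    intro i _
    constructor
    · intro e
      have ho : s.σ (te e (M + 1, 0)) = te e (M + 1, 0) := open_ _ (by simp [te_fst])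
      rw [h4, ho]
      · intro h; have := congrArg Prod.fst h; simp [te_fst] at this
      · intro h; have := congrArg Prod.snd h; cases e <;> simp [te_true, te_false] at this
    · intro j hj
      exact absurd (Subsingleton.elim j i) hj) (M + 2)
  refine ⟨s2, h1.trans g1, if d then (M, 0) else (M + 1, 0), ?_⟩
  intro π hπ
  have hstart : (π ^ (if d then 1 else 0)) (if d then (M, 0) else (M + 1, 0) : XX)
      = (M + 1, 0) := by
    cases d
    · simp
    · simp only [if_true, pow_one]
      rw [(g1.trans hπ) (M, 0) (by rw [h2]; simp), h2]
  rw [Equiv.Perm.mul_apply, hstart, g3 π hπ]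
  by_cases hw : w = []
  · rw [g4 hw]
    have hd : d = true := by tauto
    simp [hd]
  · have := g5 hw
    cases d <;> simp <;> omega

theorem St.dense_dom (s : St) (p : XX) : ∃ s' : St, Extd s.σ s'.σ ∧ s'.σ p ≠ p := by
  by_cases hp : s.σ p = p
  · obtain ⟨M₁, hM⟩ := s.exists_bound
    obtain ⟨M, m1, m2⟩ : ∃ M, M₁ ≤ M ∧ p.1 < M := ⟨M₁ + p.1 + 1, by omega, by omega⟩
    have open_ : ∀ p : XX, M ≤ p.1 → s.σ p = p := by
      intro p hp
      by_contra h
      have := hM p h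
      omega
    have hne : ∀ i, p ≠ (M, i) := by rintro i rfl; simp at m2
    obtain ⟨s1, h1, h2, h3, h4⟩ := s.swap p (M, 0) (hne 0) hp
      (open_ _ (by simp)) ⟨true, open_ _ (by simp [te_true]), by
        rw [te_true]; exact (hne _).symm⟩
    exact ⟨s1, h1, by rw [h2]; exact (hne 0).symm⟩
  · exact ⟨s, Extd.refl _, hp⟩

/-- The trivial starting state. -/
def St.start : St where
  σ := 1
  inv _ := rfl
  fin := by simp
  C A h _ _ := by
    ext p
    constructor
    · intro hp; exact absurd rfl (h p hp)
    · intro hp; exact absurd hp (Set.notMem_empty p)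

/-- Indices for the dense sets. -/
abbrev Idx := XX ⊕ ((Σ k : ℕ, (Fin k → XX) × (Fin k → XX)) ⊕ (List Bool × Bool))

/-- The dense conditions. -/
def DD : Idx → St → Prop
  | .inl p, s => s.σ p ≠ p
  | .inr (.inl ⟨_, x, y⟩), s => Function.Injective x → Function.Injective y → Reach s.σ x y
  | .inr (.inr (w, d)), s => (w ≠ [] ∨ d = true) → ∃ x : XX, ∀ π, Extd s.σ π →
      ((WW π tau w * π ^ (if d then 1 else 0)) x).1 ≠ x.1

theorem DD_dense (i : Idx) (s : St) : ∃ s' : St, Extd s.σ s'.σ ∧ DD i s' := by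
  rcases i with p | ⟨k, x, y⟩ | ⟨w, d⟩
  · exact s.dense_dom p
  · by_cases hx : Function.Injective x
    · by_cases hy : Function.Injective y
      · obtain ⟨s', h1, h2⟩ := s.dense_trans x y hx hy
        exact ⟨s', h1, fun _ _ => h2⟩
      · exact ⟨s, Extd.refl _, fun _ h => absurd h hy⟩
    · exact ⟨s, Extd.refl _, fun h => absurd h hx⟩
  · by_cases h : w ≠ [] ∨ d = true
    · obtain ⟨s', h1, h2⟩ := s.dense_faithful w d h
      exact ⟨s', h1, fun _ => h2⟩
    · exact ⟨s, Extd.refl _, fun h' => absurd h' h⟩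

theorem exists_seq : ∃ f : ℕ → St, (∀ n m, n ≤ m → Extd (f n).σ (f m).σ) ∧
    ∀ i : Idx, ∃ n, DD i (f n) := by
  let _ : Encodable Idx := Encodable.ofCountable _
  let 𝒟 : Idx → Order.Cofinal St := fun i => ⟨{s | DD i s}, fun s => by
    obtain ⟨s', h1, h2⟩ := DD_dense i s
    exact ⟨s', h2, h1⟩⟩
  refine ⟨Order.sequenceOfCofinals St.start 𝒟, fun n m h => Order.sequenceOfCofinals.monotone St.start 𝒟 h,
    fun i => ⟨_, Order.sequenceOfCofinals.encode_mem St.start 𝒟 i⟩⟩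

theorem exists_generic : ∃ π : Equiv.Perm XX, (∀ p, π (π p) = p) ∧
    (∀ (k : ℕ) (x y : Fin k → XX), Function.Injective x → Function.Injective y →
      ∃ g ∈ Subgroup.closure ({π, tau} : Set (Equiv.Perm XX)), ∀ i, g (x i) = y i) ∧
    ∀ w d, (w ≠ [] ∨ d = true) →
      ∃ x : XX, ((WW π tau w * π ^ (if d then 1 else 0)) x).1 ≠ x.1 := by
  obtain ⟨f, hmono, hD⟩ := exists_seq
  have hdom : ∀ p : XX, ∃ n, (f n).σ p ≠ p := fun p => hD (.inl p)
  choose N hN using hdom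
  let g : XX → XX := fun p => (f (N p)).σ p
  have hg : ∀ n p, (f n).σ p ≠ p → g p = (f n).σ p := by
    intro n p hp
    rcases le_total n (N p) with h | h
    · exact hmono _ _ h p hp
    · exact (hmono _ _ h p (hN p)).symm
  have hinv : Function.Involutive g := by
    intro p
    have h1 : (f (N p)).σ (g p) ≠ g p := by
      change (f (N p)).σ ((f (N p)).σ p) ≠ (f (N p)).σ p
      rw [(f (N p)).inv]; exact (hN p).symm
    rw [hg _ _ h1]
    exact (f (N p)).inv p
  have hext : ∀ n, Extd (f n).σ hinv.toPerm := fun n p hp => hg n p hp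
  refine ⟨hinv.toPerm, hinv, ?_, ?_⟩
  · intro k x y hx hy
    obtain ⟨n, hn⟩ := hD (.inr (.inl ⟨k, x, y⟩))
    exact hn hx hy _ (hext n)
  · intro w d h
    obtain ⟨n, hn⟩ := hD (.inr (.inr (w, d)))
    obtain ⟨x, hx⟩ := hn h
    exact ⟨x, hx _ (hext n)⟩

theorem normal_form {K : Type*} [Group K] (s t : K) (hs : s * s = 1) (ht : t ^ 3 = 1) (g : K)
    (hg : g ∈ Subgroup.closure ({s, t} : Set K)) :
    ∃ (c : ℕ) (w : List Bool) (d : Bool), c < 3 ∧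
      g = t ^ c * WW s t w * s ^ (if d then 1 else 0) := by
  have hsinv : s⁻¹ = s := inv_eq_of_mul_eq_one_left hs
  have htinv : t⁻¹ = t * t := by
    apply inv_eq_of_mul_eq_one_left
    rw [← ht]; simp [pow_succ]
  have stepT : ∀ y : K, (∃ (c : ℕ) (w : List Bool) (d : Bool), c < 3 ∧
      y = t ^ c * WW s t w * s ^ (if d then 1 else 0)) → ∃ (c : ℕ) (w : List Bool) (d : Bool),
      c < 3 ∧ t * y = t ^ c * WW s t w * s ^ (if d then 1 else 0) := by
    rintro y ⟨c, w, d, hc, rfl⟩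
    by_cases h : c + 1 < 3
    · exact ⟨c + 1, w, d, h, by rw [pow_succ']; simp only [mul_assoc]⟩
    · refine ⟨0, w, d, by omega, ?_⟩
      have : c = 2 := by omega
      subst this
      rw [← mul_assoc, ← mul_assoc, ← pow_succ', ht]; simp
  have stepS : ∀ y : K, (∃ (c : ℕ) (w : List Bool) (d : Bool), c < 3 ∧
      y = t ^ c * WW s t w * s ^ (if d then 1 else 0)) → ∃ (c : ℕ) (w : List Bool) (d : Bool),
      c < 3 ∧ s * y = t ^ c * WW s t w * s ^ (if d then 1 else 0) := by
    rintro y ⟨c, w, d, hc, rfl⟩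
    interval_cases c
    · rcases w with _ | ⟨e, w⟩
      · refine ⟨0, [], !d, by omega, ?_⟩
        cases d <;> simp [WW, hs]
      · refine ⟨if e then 1 else 2, w, d, by split <;> omega, ?_⟩
        simp only [WW, pow_zero, one_mul, ← mul_assoc, hs]
    · exact ⟨0, true :: w, d, by omega, by simp [WW, mul_assoc]⟩
    · exact ⟨0, false :: w, d, by omega, by simp [WW, mul_assoc]⟩
  induction hg using Subgroup.closure_induction_left with
  | one => exact ⟨0, [], false, by omega, by simp [WW]⟩
  | mul_left x hx y hy ih =>
    rcases hx with rfl | hx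
    · exact stepS y ih
    · rw [Set.mem_singleton_iff] at hx
      subst hx
      exact stepT y ih
  | inv_mul_cancel x hx y hy ih =>
    rcases hx with rfl | hx
    · rw [hsinv]; exact stepS y ih
    · rw [Set.mem_singleton_iff] at hx
      subst hx
      rw [htinv, mul_assoc]
      exact stepT _ (stepT y ih)

/-- Normal forms are unique at the identity. -/
def NFree {K : Type*} [Group K] (s t : K) : Prop :=
  ∀ (c : ℕ) (w : List Bool) (d : Bool), c < 3 →
    t ^ c * WW s t w * s ^ (if d then 1 else 0) = 1 → c = 0 ∧ w = [] ∧ d = false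

theorem WW_prod {K L : Type*} [Group K] [Group L] (s t : K × L) (w : List Bool) :
    WW s t w = (WW s.1 t.1 w, WW s.2 t.2 w) := by
  induction w with
  | nil => rfl
  | cons e w ih => simp only [WW, ih]; rfl

/-- Two groups generated by free pairs of order 2 and 3. -/
theorem exists_hom {K L : Type*} [Group K] [Group L] (s t : K) (s' t' : L)
    (hs : s * s = 1) (ht : t ^ 3 = 1) (hs' : s' * s' = 1) (ht' : t' ^ 3 = 1)
    (hF : NFree s t) (hF' : NFree s' t') (hgen : Subgroup.closure ({s, t} : Set K) = ⊤) :
    ∃ φ : K →* L, Function.Injective φ ∧ φ s = s' ∧ φ t = t' := by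
  let Γ : Subgroup (K × L) := Subgroup.closure {(s, s'), (t, t')}
  have hnf := normal_form (s, s') (t, t') (by simp [hs, hs']) (by simp [ht, ht'])
  have h1 : ∀ p ∈ Γ, p.1 = 1 → p = 1 := by
    intro p hp h
    obtain ⟨c, w, d, hc, rfl⟩ := hnf p hp
    rw [WW_prod] at h
    obtain ⟨rfl, rfl, rfl⟩ := hF c w d hc (by cases d <;> simpa using h)
    simp [WW]
  have h2 : ∀ p ∈ Γ, p.2 = 1 → p = 1 := by
    intro p hp h
    obtain ⟨c, w, d, hc, rfl⟩ := hnf p hp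
    rw [WW_prod] at h
    obtain ⟨rfl, rfl, rfl⟩ := hF' c w d hc (by cases d <;> simpa using h)
    simp [WW]
  let p1 : Γ →* K := (MonoidHom.fst K L).comp Γ.subtype
  let p2 : Γ →* L := (MonoidHom.snd K L).comp Γ.subtype
  have i1 : Function.Injective p1 := by
    rw [injective_iff_map_eq_one]
    intro p hp
    exact Subtype.ext (h1 p.1 p.2 hp)
  have i2 : Function.Injective p2 := by
    rw [injective_iff_map_eq_one]
    intro p hp
    exact Subtype.ext (h2 p.1 p.2 hp)
  let gs : Γ := ⟨(s, s'), Subgroup.subset_closure (by simp)⟩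
  let gt : Γ := ⟨(t, t'), Subgroup.subset_closure (by simp)⟩
  have su : Function.Surjective p1 := by
    rw [← MonoidHom.range_eq_top, eq_top_iff, ← hgen, Subgroup.closure_le]
    rintro x (rfl | rfl)
    · exact ⟨gs, rfl⟩
    · exact ⟨gt, rfl⟩
  let E : Γ ≃* K := MulEquiv.ofBijective p1 ⟨i1, su⟩
  refine ⟨p2.comp E.symm.toMonoidHom, i2.comp E.symm.injective, ?_, ?_⟩
  · have : E.symm s = gs := by rw [MulEquiv.symm_apply_eq]; rfl
    change p2 (E.symm s) = s'
    rw [this]; rfl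
  · have : E.symm t = gt := by rw [MulEquiv.symm_apply_eq]; rfl
    change p2 (E.symm t) = t'
    rw [this]; rfl

section PSL
open Matrix Matrix.SpecialLinearGroup ModularGroup

/-- The order three generator. -/
def t0 : SpecialLinearGroup (Fin 2) ℤ := ⟨!![0, 1; -1, -1], by simp [Matrix.det_fin_two]⟩

/-- The lower triangular generator. -/
def L0 : SpecialLinearGroup (Fin 2) ℤ := ⟨!![1, 0; 1, 1], by simp [Matrix.det_fin_two]⟩

theorem coe_t0 : (t0 : Matrix (Fin 2) (Fin 2) ℤ) = !![0, 1; -1, -1] := rfl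

theorem coe_L0 : (L0 : Matrix (Fin 2) (Fin 2) ℤ) = !![1, 0; 1, 1] := rfl

/-- PSL₂(ℤ). -/
abbrev PG := SpecialLinearGroup (Fin 2) ℤ ⧸ Subgroup.center (SpecialLinearGroup (Fin 2) ℤ)

/-- The quotient map. -/
abbrev qm : SpecialLinearGroup (Fin 2) ℤ →* PG := QuotientGroup.mk' _

theorem qm_neg_one : qm (-1) = 1 := by
  rw [QuotientGroup.mk'_apply, QuotientGroup.eq_one_iff, Subgroup.mem_center_iff]
  intro g; simp

theorem S_mul_t0 : S * t0 = T := by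
  ext i j
  fin_cases i <;> fin_cases j <;> simp [coe_S, coe_T, coe_t0, coe_L0, pow_succ, Matrix.mul_apply, Fin.sum_univ_two]

theorem S_sq : S * S = (-1 : SpecialLinearGroup (Fin 2) ℤ) := by
  ext i j
  fin_cases i <;> fin_cases j <;> simp [coe_S, coe_T, coe_t0, coe_L0, pow_succ, Matrix.mul_apply, Fin.sum_univ_two]

theorem t0_cube : t0 ^ 3 = 1 := by
  ext i j
  fin_cases i <;> fin_cases j <;>
    simp [coe_S, coe_T, coe_t0, coe_L0, pow_succ, Matrix.mul_apply, Fin.sum_univ_two]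

theorem S_t0_sq : S * t0 ^ 2 = -1 * L0 := by
  ext i j
  fin_cases i <;> fin_cases j <;>
    simp [coe_S, coe_T, coe_t0, coe_L0, pow_succ, Matrix.mul_apply, Fin.sum_univ_two]

theorem pg_gen : Subgroup.closure ({qm S, qm t0} : Set PG) = ⊤ := by
  have h := SpecialLinearGroup.SL2Z_generators
  have hq : Subgroup.map qm ⊤ = ⊤ :=
    Subgroup.map_top_of_surjective _ (QuotientGroup.mk'_surjective _)
  rw [eq_top_iff, ← hq, ← h, Subgroup.map_le_iff_le_comap, Subgroup.closure_le]
  have hS : qm S ∈ Subgroup.closure ({qm S, qm t0} : Set PG) := Subgroup.subset_closure (by simp)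
  have ht : qm t0 ∈ Subgroup.closure ({qm S, qm t0} : Set PG) := Subgroup.subset_closure (by simp)
  rintro x (rfl | rfl)
  · exact hS
  · change qm T ∈ Subgroup.closure ({qm S, qm t0} : Set PG)
    rw [← S_mul_t0, map_mul]
    exact Subgroup.mul_mem _ hS ht

theorem WW_pg (w : List Bool) : ∃ A : SpecialLinearGroup (Fin 2) ℤ, WW (qm S) (qm t0) w = qm A ∧
    0 ≤ A 0 0 ∧ 0 ≤ A 0 1 ∧ 0 ≤ A 1 0 ∧ 0 ≤ A 1 1 ∧
    2 + (w.length : ℤ) ≤ A 0 0 + A 0 1 + A 1 0 + A 1 1 := by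
  induction w with
  | nil => exact ⟨1, by simp [WW], by simp, by simp, by simp, by simp, by simp⟩
  | cons e w ih =>
    obtain ⟨A, hA, h1, h2, h3, h4, h5⟩ := ih
    have hdet : A 0 0 * A 1 1 - A 0 1 * A 1 0 = 1 := by
      have := A.2
      rwa [Matrix.det_fin_two] at this
    have r1 : 1 ≤ A 1 0 + A 1 1 := by
      by_contra h
      have e1 : A 1 0 = 0 := by omega
      have e2 : A 1 1 = 0 := by omega
      rw [e1, e2] at hdet; simp at hdet
    have r0 : 1 ≤ A 0 0 + A 0 1 := by
      by_contra h
      have e1 : A 0 0 = 0 := by omega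
      have e2 : A 0 1 = 0 := by omega
      rw [e1, e2] at hdet; simp at hdet
    cases e
    · refine ⟨L0 * A, ?_, ?_⟩
      · simp only [WW, hA]
        have := congrArg qm S_t0_sq
        rw [map_mul, map_mul, map_pow, qm_neg_one, one_mul] at this
        simp only [Bool.false_eq_true, if_false]
        rw [this, ← map_mul]
      · have e00 : (L0 * A) 0 0 = A 0 0 := by simp [coe_S, coe_T, coe_t0, coe_L0, pow_succ, Matrix.mul_apply, Fin.sum_univ_two]
        have e01 : (L0 * A) 0 1 = A 0 1 := by simp [coe_S, coe_T, coe_t0, coe_L0, pow_succ, Matrix.mul_apply, Fin.sum_univ_two]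
        have e10 : (L0 * A) 1 0 = A 0 0 + A 1 0 := by
          simp [coe_S, coe_T, coe_t0, coe_L0, pow_succ, Matrix.mul_apply, Fin.sum_univ_two]
        have e11 : (L0 * A) 1 1 = A 0 1 + A 1 1 := by
          simp [coe_S, coe_T, coe_t0, coe_L0, pow_succ, Matrix.mul_apply, Fin.sum_univ_two]
        rw [e00, e01, e10, e11, List.length_cons]
        push_cast
        omega
    · refine ⟨T * A, ?_, ?_⟩
      · simp only [WW, hA]
        have := congrArg qm S_mul_t0
        rw [map_mul] at this
        simp only [if_true, pow_one]
        rw [this, ← map_mul]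
      · have e00 : (T * A) 0 0 = A 0 0 + A 1 0 := by
          simp [coe_S, coe_T, coe_t0, coe_L0, pow_succ, Matrix.mul_apply, Fin.sum_univ_two]
        have e01 : (T * A) 0 1 = A 0 1 + A 1 1 := by
          simp [coe_S, coe_T, coe_t0, coe_L0, pow_succ, Matrix.mul_apply, Fin.sum_univ_two]
        have e10 : (T * A) 1 0 = A 1 0 := by simp [coe_S, coe_T, coe_t0, coe_L0, pow_succ, Matrix.mul_apply, Fin.sum_univ_two]
        have e11 : (T * A) 1 1 = A 1 1 := by simp [coe_S, coe_T, coe_t0, coe_L0, pow_succ, Matrix.mul_apply, Fin.sum_univ_two]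
        rw [e00, e01, e10, e11, List.length_cons]
        push_cast
        omega

theorem t0_mat_sq : (!![0, 1; -1, -1] : Matrix (Fin 2) (Fin 2) ℤ) ^ 2 = !![-1, -1; 1, 0] := by
  decide

theorem pg_free : NFree (qm S) (qm t0) := by
  intro c w d hc h
  obtain ⟨A, hA, h1, h2, h3, h4, h5⟩ := WW_pg w
  rw [hA, ← map_pow, ← map_pow, ← map_mul, ← map_mul, QuotientGroup.mk'_apply,
    QuotientGroup.eq_one_iff, Matrix.SpecialLinearGroup.mem_center_iff] at h
  obtain ⟨r, hr, hE⟩ := h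
  have hr' : r = 1 ∨ r = -1 := by simpa using hr
  have q00 := congrFun (congrFun hE 0) 0
  have q01 := congrFun (congrFun hE 0) 1
  have q10 := congrFun (congrFun hE 1) 0
  have q11 := congrFun (congrFun hE 1) 1
  rcases hr' with rfl | rfl <;> interval_cases c <;> cases d <;>
    simp [coe_S, coe_t0, t0_mat_sq, Matrix.mul_apply, Fin.sum_univ_two, Matrix.scalar_apply,
      Matrix.diagonal_apply] at q00 q01 q10 q11
  · refine ⟨rfl, ?_, rfl⟩
    apply List.length_eq_zero_iff.1
    omega
  all_goals first
    | omega
    | (simp [Matrix.vecMul, dotProduct, Fin.sum_univ_two] at q00 q01 q10 q11; omega)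

end PSL

theorem generic_free (π : Equiv.Perm XX)
    (h : ∀ w d, (w ≠ [] ∨ d = true) →
      ∃ x : XX, ((WW π tau w * π ^ (if d then 1 else 0)) x).1 ≠ x.1) : NFree π tau := by
  have hfst : ∀ (c : ℕ) (p : XX), ((tau ^ c) p).1 = p.1 := by
    intro c
    induction c with
    | zero => intro p; rfl
    | succ c ih => intro p; rw [pow_succ, Equiv.Perm.mul_apply, ih]; rfl
  intro c w d hc hE
  by_cases hwd : w ≠ [] ∨ d = true
  · obtain ⟨x, hx⟩ := h w d hwd
    exfalso
    apply hx
    rw [← hfst c, ← Equiv.Perm.mul_apply, ← mul_assoc, hE]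
    rfl
  · push Not at hwd
    obtain ⟨rfl, hd⟩ := hwd
    have hd : d = false := by simpa using hd
    subst hd
    refine ⟨?_, rfl, rfl⟩
    simp [WW] at hE
    have h0 := DFunLike.congr_fun hE ((0, 0) : XX)
    interval_cases c
    · rfl
    · simp [tau_apply] at h0
    · simp [tau_apply, pow_two] at h0

theorem psl2z_admits_faithful_highly_transitive :
    ∃ φ : (Matrix.SpecialLinearGroup (Fin 2) ℤ ⧸
        Subgroup.center (Matrix.SpecialLinearGroup (Fin 2) ℤ)) →* Equiv.Perm ℕ,
      Function.Injective φ ∧ IsHighlyTransitiveHom φ := by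
  obtain ⟨π, h1, h2, h3⟩ := exists_generic
  have ht : tau ^ 3 = 1 := by
    ext1 p
    simpa [pow_succ] using tau_tau_tau p
  have hs : π * π = 1 := by ext1 p; exact h1 p
  obtain ⟨φ, hφ, hφs, hφt⟩ := exists_hom (qm ModularGroup.S) (qm t0) π tau
    (by rw [← map_mul, S_sq, qm_neg_one]) (by rw [← map_pow, t0_cube, map_one]) hs ht
    pg_free (generic_free π h3) pg_gen
  obtain ⟨e⟩ : Nonempty (XX ≃ ℕ) := nonempty_equiv_of_countable
  refine ⟨(e.permCongrHom).toMonoidHom.comp φ, (e.permCongrHom).injective.comp hφ, ?_⟩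
  intro k x y
  obtain ⟨g, hg, hgx⟩ := h2 k (fun i => e.symm (x i)) (fun i => e.symm (y i))
    (e.symm.injective.comp x.injective) (e.symm.injective.comp y.injective)
  have hr : g ∈ φ.range := by
    have hle : Subgroup.closure ({π, tau} : Set (Equiv.Perm XX)) ≤ φ.range := by
      rw [Subgroup.closure_le]
      rintro u (rfl | rfl)
      · exact ⟨_, hφs⟩
      · exact ⟨_, hφt⟩
    exact hle hg
  obtain ⟨u, rfl⟩ := hr
  refine ⟨u, fun i => ?_⟩
  change e (φ u (e.symm (x i))) = y i
  rw [hgx i]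
  simp
end

section
/- Let G be nontrivial, H finite with |H| ≥ 3, and X = ⨆_{j∈N} G with G acting by left multiplication on each copy. Then within the Baire space A of admissible H-actions on X, the set of σ ∈ A such that the action of ⟨G, σ(H)⟩ on X is both faithful and highly transitive is comeager. -/
open Monoid

/-- The induced topology on the space `Hom(H, Sym(X)) ⊆ Sym(X)^H` of `H`-actions on `X`. -/
def homTop (H X : Type*) [Group H] : TopologicalSpace (H →* Equiv.Perm X) :=
  TopologicalSpace.induced (fun σ => (σ : H → Equiv.Perm X))
    (@Pi.topologicalSpace H (fun _ => Equiv.Perm X) (fun _ => permTop X))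

/-- The action of `G` on `X = G × ℕ` (a disjoint union of countably many copies of `G`)
by left multiplication on each copy. -/
def leftMulPerm (G : Type*) [Group G] : G →* Equiv.Perm (G × ℕ) where
  toFun g := (Equiv.mulLeft g).prodCongr (Equiv.refl ℕ)
  map_one' := by ext ⟨a, n⟩ <;> simp
  map_mul' g₁ g₂ := by ext ⟨a, n⟩ <;> simp [mul_assoc]

/-- An `H`-action `σ` on `X = G × ℕ` is admissible if every orbit of the subgroup
`⟨G, σ(H)⟩` of `Sym(X)` is infinite. -/
def Admissible (G H : Type*) [Group G] [Group H] (σ : H →* Equiv.Perm (G × ℕ)) : Prop :=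
  ∀ x : G × ℕ,
    (MulAction.orbit (((leftMulPerm G).range ⊔ σ.range : Subgroup (Equiv.Perm (G × ℕ)))) x).Infinite

/-- The `G ∗ H`-action on `X = G × ℕ` induced by the `G`-action and an `H`-action `σ`. -/
noncomputable def inducedAction (G H : Type*) [Group G] [Group H]
    (σ : H →* Equiv.Perm (G × ℕ)) : Coprod G H →* Equiv.Perm (G × ℕ) :=
  Coprod.lift (leftMulPerm G) σ


lemma lm_apply {G : Type*} [Group G] (g : G) (p : G × ℕ) :
    leftMulPerm G g p = (g * p.1, p.2) := rfl

lemma homTop_eq (H X : Type*) [Group H] : homTop H X =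
    TopologicalSpace.induced (fun σ (p : H × X) => σ p.1 p.2)
      (@Pi.topologicalSpace (H × X) (fun _ => X) (fun _ => ⊥)) := by
  letI : TopologicalSpace X := ⊥
  apply le_antisymm
  · letI := permTop X
    letI := homTop H X
    rw [← continuous_iff_le_induced]
    refine continuous_pi fun p => ?_
    have h1 : Continuous (fun σ : H →* Equiv.Perm X => (σ : H → Equiv.Perm X)) :=
      continuous_induced_dom
    have h2 : Continuous (fun σ : Equiv.Perm X => ((σ : X → X), ((σ.symm : X → X)))) :=
      continuous_induced_dom
    exact (continuous_apply p.2).comp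
      (continuous_fst.comp (h2.comp ((continuous_apply p.1).comp h1)))
  · letI := permTop X
    letI : TopologicalSpace (H →* Equiv.Perm X) :=
      TopologicalSpace.induced (fun σ (p : H × X) => σ p.1 p.2)
      (@Pi.topologicalSpace (H × X) (fun _ => X) (fun _ => ⊥))
    have h1 : Continuous (fun (σ : H →* Equiv.Perm X) (p : H × X) => σ p.1 p.2) :=
      continuous_induced_dom
    have h2 : ∀ (h : H) (x : X), Continuous (fun (σ : H →* Equiv.Perm X) => σ h x) :=
      fun h x => (continuous_apply (h, x)).comp h1
    change _ ≤ TopologicalSpace.induced _ _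
    rw [← continuous_iff_le_induced]
    refine continuous_pi fun h => ?_
    refine continuous_induced_rng.2 ?_
    refine Continuous.prodMk (continuous_pi fun x => h2 h x) (continuous_pi fun x => ?_)
    have : (fun (σ : H →* Equiv.Perm X) => (σ h).symm x) = fun σ => σ h⁻¹ x := by
      ext σ; simp
    exact this ▸ h2 h⁻¹ x

/-- Basic neighbourhoods. -/
lemma isOpen_homTop_iff (H X : Type*) [Group H] (U : Set (H →* Equiv.Perm X)) [Finite H] :
    @IsOpen _ (homTop H X) U ↔ ∀ σ ∈ U, ∃ F : Set X, F.Finite ∧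
      ∀ σ' : H →* Equiv.Perm X, (∀ x ∈ F, ∀ h, σ' h x = σ h x) → σ' ∈ U := by
  letI : TopologicalSpace X := ⊥
  haveI : DiscreteTopology X := ⟨rfl⟩
  rw [homTop_eq]
  letI : TopologicalSpace (H →* Equiv.Perm X) :=
      TopologicalSpace.induced (fun σ (p : H × X) => σ p.1 p.2)
      (@Pi.topologicalSpace (H × X) (fun _ => X) (fun _ => ⊥))
  have h1 : Continuous (fun (σ : H →* Equiv.Perm X) (p : H × X) => σ p.1 p.2) :=
      continuous_induced_dom
  have h2 : ∀ (h : H) (x : X), Continuous (fun (σ : H →* Equiv.Perm X) => σ h x) :=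
      fun h x => (continuous_apply (h, x)).comp h1
  constructor
  · intro hU σ hσ
    obtain ⟨V, hV, rfl⟩ := isOpen_induced_iff.1 hU
    obtain ⟨I, u, hu, hI⟩ := isOpen_pi_iff.1 hV _ hσ
    refine ⟨Prod.snd '' (I : Set (H × X)), I.finite_toSet.image _, fun σ' h' => hI ?_⟩
    intro p hp
    change σ' p.1 p.2 ∈ u p
    rw [h' p.2 ⟨p, hp, rfl⟩]
    exact (hu p hp).2
  · intro hU
    change IsOpen U
    rw [isOpen_iff_mem_nhds]
    intro σ hσ
    obtain ⟨F, hF, hU'⟩ := hU σ hσ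
    have : (⋂ x ∈ F, ⋂ h : H, {σ' : H →* Equiv.Perm X | σ' h x = σ h x}) ∈ nhds σ := by
      rw [Filter.biInter_mem hF]
      intro x hx
      rw [Filter.iInter_mem]
      intro h
      exact ((isOpen_discrete {σ h x}).preimage (h2 h x)).mem_nhds rfl
    refine Filter.mem_of_superset this fun σ' h' => hU' σ' ?_
    simpa using h'

lemma adm_iff {G H : Type*} [Group G] [Group H] (σ : H →* Equiv.Perm (G × ℕ)) :
    Admissible G H σ ↔ ∀ R : Set (G × ℕ), R.Finite → (∀ g, ∀ r ∈ R, leftMulPerm G g r ∈ R) →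
      (∀ h, ∀ r ∈ R, σ h r ∈ R) → R = ∅ := by
  constructor
  · intro hA R hR hg hh
    by_contra hne
    obtain ⟨x, hx⟩ := Set.nonempty_iff_ne_empty.2 hne
    refine hA x (hR.subset ?_)
    rintro _ ⟨⟨w, hw⟩, rfl⟩
    change w x ∈ R
    let P : Submonoid (Equiv.Perm (G × ℕ)) :=
      { carrier := {w | ∀ r ∈ R, w r ∈ R}
        one_mem' := fun r hr => hr
        mul_mem' := fun ha hb r hr => ha _ (hb r hr) }
    have : ∀ w ∈ ((leftMulPerm G).range ⊔ σ.range : Subgroup (Equiv.Perm (G × ℕ))),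
        ∀ r ∈ R, w r ∈ R := by
      intro w hw
      rw [Subgroup.sup_eq_closure] at hw
      induction hw using Subgroup.closure_induction'' with
      | mem x hx =>
        rcases hx with ⟨g, rfl⟩ | ⟨h, rfl⟩
        · exact hg g
        · exact hh h
      | inv_mem x hx =>
        rcases hx with ⟨g, rfl⟩ | ⟨h, rfl⟩
        · rw [← map_inv]; exact hg _
        · rw [← map_inv]; exact hh _
      | one => exact fun r hr => hr
      | mul x y _ _ hx hy => exact fun r hr => hx _ (hy r hr)
    exact this w hw x hx
  · intro hA x hfin
    have := hA _ hfin ?_ ?_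
    · have hx := MulAction.mem_orbit_self
        (M := ((leftMulPerm G).range ⊔ σ.range : Subgroup (Equiv.Perm (G × ℕ)))) x
      rw [this] at hx
      exact hx
    · rintro g _ ⟨w, rfl⟩
      exact ⟨⟨leftMulPerm G g, Subgroup.mem_sup_left ⟨g, rfl⟩⟩ * w, rfl⟩
    · rintro h _ ⟨w, rfl⟩
      exact ⟨⟨σ h, Subgroup.mem_sup_right ⟨h, rfl⟩⟩ * w, rfl⟩

open Classical in
lemma extendAction {X H ι : Type*} [Group H] (σ : H →* Equiv.Perm X) (F : Set X)
    (hF : ∀ h, ∀ x ∈ F, σ h x ∈ F) (e : ι × H → X) (he : Function.Injective e)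
    (heF : ∀ p, e p ∉ F) :
    ∃ σ' : H →* Equiv.Perm X, (∀ h, ∀ x ∈ F, σ' h x = σ h x) ∧
      (∀ i k h, σ' h (e (i, k)) = e (i, h * k)) ∧
      (∀ h x, x ∉ F → x ∉ Set.range e → σ' h x = x) := by
  let f : H → X → X := fun h x => if x ∈ F then σ h x else
    if hx : ∃ p, e p = x then e (hx.choose.1, h * hx.choose.2) else x
  have f1 : ∀ h, ∀ x ∈ F, f h x = σ h x := fun h x hx => by simp only [f, if_pos hx]
  have f2 : ∀ i k h, f h (e (i, k)) = e (i, h * k) := by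
    intro i k h
    have hx : ∃ p, e p = e (i, k) := ⟨_, rfl⟩
    have h2 : hx.choose = (i, k) := he hx.choose_spec
    simp only [f, if_neg (heF _), dif_pos hx]
    rw [h2]
  have f3 : ∀ h x, x ∉ F → x ∉ Set.range e → f h x = x := by
    intro h x hx hx'
    have : ¬ ∃ p, e p = x := hx'
    simp only [f, if_neg hx, dif_neg this]
  have tri : ∀ x, x ∈ F ∨ (∃ i k, x = e (i, k)) ∨ (x ∉ F ∧ x ∉ Set.range e) := by
    intro x
    by_cases h1 : x ∈ F
    · exact Or.inl h1
    by_cases h2 : x ∈ Set.range e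
    · obtain ⟨⟨i, k⟩, rfl⟩ := h2
      exact Or.inr (Or.inl ⟨i, k, rfl⟩)
    · exact Or.inr (Or.inr ⟨h1, h2⟩)
  have f_one : ∀ x, f 1 x = x := by
    intro x
    rcases tri x with h | ⟨i, k, rfl⟩ | ⟨h, h'⟩
    · simp [f1 _ _ h]
    · simp [f2]
    · exact f3 _ _ h h'
  have f_mul : ∀ a b x, f (a * b) x = f a (f b x) := by
    intro a b x
    rcases tri x with h | ⟨i, k, rfl⟩ | ⟨h, h'⟩
    · rw [f1 _ _ h, f1 _ _ h, f1 _ _ (hF _ _ h)]; simp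
    · simp [f2, mul_assoc]
    · simp only [f3 _ _ h h']
  letI : MulAction H X := { smul := f, one_smul := f_one, mul_smul := f_mul }
  exact ⟨MulAction.toPermHom H X, f1, fun i k h => f2 i k h, f3⟩

open Classical in
lemma tree {G H : Type*} [Group G] [Group H] [Countable G] [Nontrivial G]
    [Fintype H] (hH : 3 ≤ Fintype.card H) (σ : H →* Equiv.Perm (G × ℕ)) (hσ : Admissible G H σ)
    (F : Set (G × ℕ)) (hFf : F.Finite) (hF : ∀ h, ∀ x ∈ F, σ h x ∈ F)
    (k : ℕ) (z u : Fin k → G × ℕ) (hz : Function.Injective z) (hu : Function.Injective u)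
    (hzu : ∀ i j, z i ≠ u j) (hzF : ∀ i, z i ∉ F) (huF : ∀ i, u i ∉ F) (h0 : H) (hh0 : h0 ≠ 1) :
    ∃ (σ' : H →* Equiv.Perm (G × ℕ)) (B : Set (G × ℕ)) (c : G × ℕ → H → ℕ),
      (∀ h, ∀ x ∈ F, σ' h x = σ h x) ∧
      Admissible G H σ' ∧
      (∀ b ∈ B, b ∉ F) ∧
      (∀ b ∈ B, ∀ h, h ≠ 1 → (h ≠ h0 ∨ b ∉ Set.range z) → σ' h b = (1, c b h)) ∧
      (∀ b h, b.2 < c b h) ∧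
      (∀ b h b' h', c b h = c b' h' → b = b' ∧ h = h') ∧
      (∀ g, g ≠ 1 → ∀ b h, (g, c b h) ∈ B) ∧
      (∀ b h, (1, c b h) ∉ B) ∧
      (k = 0 → ∀ x, x ∉ F → x ∈ B ∨ ∃ h, h ≠ 1 ∧ ∀ g, g ≠ 1 → leftMulPerm G g (σ' h x) ∈ B) ∧
      (∃ n, ∀ g, (g, n) ∈ B) ∧
      (∀ i, σ' h0 (z i) = u i) := by
  obtain ⟨N, hN⟩ : ∃ N, ∀ p ∈ F ∪ Set.range z ∪ Set.range u, p.2 < N := by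
    have : (Prod.snd '' (F ∪ Set.range z ∪ Set.range u)).Finite :=
      ((hFf.union (Set.finite_range z)).union (Set.finite_range u)).image _
    obtain ⟨M, hM⟩ := this.bddAbove
    exact ⟨M + 1, fun p hp => Nat.lt_succ_of_le (hM ⟨p, hp, rfl⟩)⟩
  have hNF : ∀ p ∈ F, p.2 < N := fun p hp => hN p (Or.inl (Or.inl hp))
  have hNz : ∀ i, (z i).2 < N := fun i => hN _ (Or.inl (Or.inr ⟨i, rfl⟩))
  have hNu : ∀ i, (u i).2 < N := fun i => hN _ (Or.inr ⟨i, rfl⟩)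
  obtain ⟨enc, henc⟩ := exists_injective_nat ((G × ℕ) × H)
  obtain ⟨c, c_lt, c_N, c_inj⟩ : ∃ c : G × ℕ → H → ℕ, (∀ b h, b.2 < c b h) ∧ (∀ b h, N < c b h) ∧
      (∀ b h b' h', c b h = c b' h' → b = b' ∧ h = h') := by
    refine ⟨fun p h => Nat.pair p.2 (enc (p, h)) + N + 1, ?_, ?_, ?_⟩
    · intro b h
      have := Nat.left_le_pair b.2 (enc (b, h))
      dsimp only; omega
    · intro b h
      dsimp only; omega
    · intro b h b' h' hh
      have h1 : Nat.pair b.2 (enc (b, h)) = Nat.pair b'.2 (enc (b', h')) := by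
        dsimp only at hh; omega
      have h2 := henc (Nat.pair_eq_pair.1 h1).2
      exact Prod.mk.inj h2
  let B : Set (G × ℕ) := {p | p ∉ F ∧ p ∉ Set.range u ∧ ∀ q h, p ≠ (1, c q h)}
  have zB : ∀ i, z i ∈ B := fun i => ⟨hzF i, fun ⟨j, hj⟩ => hzu i j hj.symm, fun q h hq => by
    have h1 := hNz i
    have h2 := c_N q h
    rw [hq] at h1
    dsimp only at h1; omega⟩
  have gB : ∀ g, g ≠ 1 → ∀ b h, (g, c b h) ∈ B := by
    intro g hg b h
    have h2 := c_N b h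
    refine ⟨fun hm => ?_, ?_, fun q h' hq => hg (Prod.mk.inj hq).1⟩
    · have := hNF _ hm
      dsimp only at this; omega
    · rintro ⟨j, hj⟩
      have := hNu j
      rw [hj] at this
      dsimp only at this; omega
  let e : B × H → G × ℕ := fun p => if p.2 = 1 then p.1 else
    if hz : p.2 = h0 ∧ ∃ i, z i = p.1 then u hz.2.choose else (1, c p.1 p.2)
  have e1 : ∀ b : B, e (b, 1) = b := fun b => by simp [e]
  have e2 : ∀ i, e (⟨z i, zB i⟩, h0) = u i := by
    intro i
    have hx : h0 = h0 ∧ ∃ j, z j = z i := ⟨rfl, i, rfl⟩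
    have : hx.2.choose = i := hz hx.2.choose_spec
    exact (if_neg hh0).trans ((dif_pos hx).trans (congrArg u this))
  have e3 : ∀ (b : B) h, h ≠ 1 → (h ≠ h0 ∨ (b : G × ℕ) ∉ Set.range z) → e (b, h) = (1, c b h) := by
    intro b h h1 h2
    have : ¬ (h = h0 ∧ ∃ i, z i = b) := by
      rintro ⟨h3, h4⟩
      rcases h2 with h2 | h2
      · exact h2 h3
      · exact h2 h4
    simp only [e, if_neg h1]
    rw [dif_neg this]
  have etri : ∀ (b : B) h, (h = 1 ∧ e (b, h) = b) ∨ (∃ i, h = h0 ∧ z i = b ∧ e (b, h) = u i) ∨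
      e (b, h) = (1, c b h) := by
    intro b h
    by_cases h1 : h = 1
    · subst h1
      exact Or.inl ⟨rfl, e1 b⟩
    by_cases h2 : h = h0 ∧ (b : G × ℕ) ∈ Set.range z
    · obtain ⟨rfl, i, hi⟩ := h2
      have : b = ⟨z i, zB i⟩ := Subtype.ext hi.symm
      subst this
      exact Or.inr (Or.inl ⟨i, rfl, rfl, e2 i⟩)
    · refine Or.inr (Or.inr (e3 b h h1 ?_))
      by_cases h3 : h = h0
      · exact Or.inr fun h4 => h2 ⟨h3, h4⟩
      · exact Or.inl h3
  have uc : ∀ i q h, u i ≠ (1, c q h) := by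
    intro i q h hq
    have h1 := hNu i
    have h2 := c_N q h
    rw [hq] at h1
    dsimp only at h1; omega
  have e_inj : Function.Injective e := by
    rintro ⟨b, h⟩ ⟨b', h'⟩ heq
    have hb := b.2
    have hb' := b'.2
    rcases etri b h with ⟨a1, a2⟩ | ⟨i, a1, a2, a3⟩ | a1 <;>
    rcases etri b' h' with ⟨b1, b2⟩ | ⟨j, b1, b2, b3⟩ | b1
    · rw [a2, b2] at heq
      rw [a1, b1, Subtype.ext heq]
    · rw [a2, b3] at heq
      exact absurd ⟨j, heq.symm⟩ hb.2.1
    · rw [a2, b1] at heq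
      exact absurd heq (hb.2.2 _ _)
    · rw [a3, b2] at heq
      exact absurd ⟨i, heq⟩ hb'.2.1
    · rw [a3, b3] at heq
      have := hu heq
      subst this
      rw [a1, b1, Subtype.ext (a2.symm.trans b2)]
    · rw [a3, b1] at heq
      exact absurd heq (uc _ _ _)
    · rw [a1, b2] at heq
      exact absurd heq.symm (hb'.2.2 _ _)
    · rw [a1, b3] at heq
      exact absurd heq.symm (uc _ _ _)
    · rw [a1, b1] at heq
      obtain ⟨c1, c2⟩ := c_inj _ _ _ _ (Prod.mk.inj heq).2
      rw [c2, Subtype.ext c1]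
  have e_F : ∀ p, e p ∉ F := by
    rintro ⟨b, h⟩
    rcases etri b h with ⟨a1, a2⟩ | ⟨i, a1, a2, a3⟩ | a1
    · rw [a2]; exact b.2.1
    · rw [a3]; exact huF i
    · rw [a1]
      intro hm
      have h1 := hNF _ hm
      have h2 := c_N b h
      dsimp only at h1; omega
  obtain ⟨σ', s1, s2, s3⟩ := extendAction σ F hF e e_inj e_F
  have s4 : ∀ b ∈ B, ∀ h, h ≠ 1 → (h ≠ h0 ∨ b ∉ Set.range z) → σ' h b = (1, c b h) := by
    intro b hb h h1 h2
    have := s2 ⟨b, hb⟩ 1 h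
    rw [e1, mul_one, e3 _ _ h1 h2] at this
    exact this
  have s5 : ∀ i, σ' h0 (z i) = u i := by
    intro i
    have := s2 ⟨z i, zB i⟩ 1 h0
    rw [e1, mul_one, e2] at this
    exact this
  have avoid : ∀ a : H, ∃ h : H, h ≠ 1 ∧ h ≠ a := by
    intro a
    have : ∃ h, h ∉ ({1, a} : Finset H) := by
      by_contra hcon
      push Not at hcon
      have h1 : (Finset.univ : Finset H) ⊆ {1, a} := fun h _ => hcon h
      have h2 := Finset.card_le_card h1
      have h3 : ({1, a} : Finset H).card ≤ 2 := Finset.card_le_two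
      rw [Finset.card_univ] at h2
      omega
    obtain ⟨h, hh⟩ := this
    simp at hh
    exact ⟨h, hh.1, hh.2⟩
  obtain ⟨g1, hg1⟩ := exists_ne (1 : G)
  refine ⟨σ', B, c, s1, ?_, fun b hb => hb.1, s4, c_lt, c_inj, gB, fun b h hb => hb.2.2 _ _ rfl,
    ?_, ?_, s5⟩
  · rw [adm_iff] at hσ ⊢
    intro R hR Rg Rh
    have noB : ∀ b ∈ B, b ∉ R := by
      intro b hb hbR
      obtain ⟨m, ⟨hmR, hmB⟩, hmax⟩ := Set.exists_max_image (R ∩ B) Prod.snd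
        (hR.inter_of_left _) ⟨b, hbR, hb⟩
      obtain ⟨h, h1, h2⟩ := avoid h0
      have h3 := Rg g1 _ (Rh h _ hmR)
      rw [s4 m hmB h h1 (Or.inl h2), lm_apply] at h3
      simp only [mul_one] at h3
      have h4 := hmax _ ⟨h3, gB g1 hg1 m h⟩
      have h5 := c_lt m h
      dsimp only at h4; omega
    have RF : ∀ r ∈ R, r ∈ F := by
      intro r hr
      by_contra hrF
      by_cases hru : r ∈ Set.range u
      · obtain ⟨i, rfl⟩ := hru
        refine noB _ (zB i) ?_
        have := Rh h0⁻¹ _ hr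
        rw [← s5 i] at this
        simpa using this
      by_cases hrc : ∃ q h, r = (1, c q h)
      · obtain ⟨q, h, rfl⟩ := hrc
        have := Rg g1 _ hr
        rw [lm_apply] at this
        simp only [mul_one] at this
        exact noB _ (gB g1 hg1 q h) this
      · push Not at hrc
        exact noB r ⟨hrF, hru, hrc⟩ hr
    refine hσ R hR Rg fun h r hr => ?_
    rw [← s1 h r (RF r hr)]
    exact Rh h r hr
  · rintro rfl x hx
    by_cases hrc : ∃ q h, x = (1, c q h)
    swap
    · push Not at hrc
      exact Or.inl ⟨hx, fun ⟨i, _⟩ => i.elim0, hrc⟩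
    right
    have key : ∃ h, h ≠ 1 ∧ ∃ q h', σ' h x = (1, c q h') := by
      by_cases hxe : x ∈ Set.range e
      · obtain ⟨⟨b, h1⟩, rfl⟩ := hxe
        obtain ⟨h, hh1, hh2⟩ := avoid h1⁻¹
        refine ⟨h, hh1, b, h * h1, ?_⟩
        rw [s2]
        refine e3 _ _ (fun h3 => hh2 (eq_inv_of_mul_eq_one_left h3)) (Or.inr ?_)
        rintro ⟨i, _⟩
        exact i.elim0
      · obtain ⟨q, h', rfl⟩ := hrc
        exact ⟨h0, hh0, q, h', s3 _ _ hx hxe⟩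
    obtain ⟨h, hh, q, h', hq⟩ := key
    refine ⟨h, hh, fun g hg => ?_⟩
    rw [hq, lm_apply]
    simp only [mul_one]
    exact gB g hg q h'
  · refine ⟨N, fun g => ⟨fun hm => ?_, ?_, fun q h hq => ?_⟩⟩
    · have := hNF _ hm
      dsimp only at this; omega
    · rintro ⟨j, hj⟩
      have := hNu j
      rw [hj] at this
      dsimp only at this; omega
    · have := c_N q h
      have := (Prod.mk.inj hq).2
      omega

lemma ia_inl {G H : Type*} [Group G] [Group H] (σ : H →* Equiv.Perm (G × ℕ)) (g : G) :
    inducedAction G H σ (Coprod.inl g) = leftMulPerm G g := Coprod.lift_apply_inl _ _ _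

lemma ia_inr {G H : Type*} [Group G] [Group H] (σ : H →* Equiv.Perm (G × ℕ)) (h : H) :
    inducedAction G H σ (Coprod.inr h) = σ h := Coprod.lift_apply_inr _ _ _

lemma loc_const {G H : Type*} [Group G] [Group H] (σ : H →* Equiv.Perm (G × ℕ))
    (w : Coprod G H) (x : G × ℕ) : ∃ T : Set (G × ℕ), T.Finite ∧
      ∀ σ' : H →* Equiv.Perm (G × ℕ), (∀ t ∈ T, ∀ h, σ' h t = σ h t) →
        inducedAction G H σ' w x = inducedAction G H σ w x := by
  induction w using Coprod.induction_on generalizing x with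
  | inl g => exact ⟨∅, Set.finite_empty, fun σ' _ => by rw [ia_inl, ia_inl]⟩
  | inr h => exact ⟨{x}, Set.finite_singleton x, fun σ' h' => by
      rw [ia_inr, ia_inr]; exact h' x rfl h⟩
  | mul a b ha hb =>
    obtain ⟨T1, hT1, h1⟩ := hb x
    obtain ⟨T2, hT2, h2⟩ := ha (inducedAction G H σ b x)
    refine ⟨T1 ∪ T2, hT1.union hT2, fun σ' h' => ?_⟩
    rw [map_mul, map_mul, Equiv.Perm.mul_apply, Equiv.Perm.mul_apply,
      h1 σ' fun t ht => h' t (Or.inl ht), h2 σ' fun t ht => h' t (Or.inr ht)]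

lemma reach {G H : Type*} [Group G] [Group H] [Nontrivial G] [Nontrivial H]
    (σ : H →* Equiv.Perm (G × ℕ)) (hσ : Admissible G H σ)
    (F B : Set (G × ℕ)) (hFf : F.Finite) (hF : ∀ h, ∀ x ∈ F, σ h x ∈ F)
    (hstep : ∀ b ∈ B, ∀ h, h ≠ 1 → ∀ g, g ≠ 1 → leftMulPerm G g (σ h b) ∈ B)
    (hout : ∀ x, x ∉ F → x ∈ B ∨ ∃ h, h ≠ 1 ∧ ∀ g, g ≠ 1 → leftMulPerm G g (σ h x) ∈ B)
    (s : Finset (G × ℕ)) : ∃ w : Coprod G H, ∀ x ∈ s, inducedAction G H σ w x ∈ B := by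
  classical
  let M : Submonoid (Coprod G H) := Submonoid.closure
    {w | ∃ g h, g ≠ 1 ∧ h ≠ 1 ∧ w = Coprod.inl g * Coprod.inr h}
  have gen : ∀ g h, g ≠ 1 → h ≠ 1 → (Coprod.inl g * Coprod.inr h : Coprod G H) ∈ M :=
    fun g h hg hh => Submonoid.subset_closure ⟨g, h, hg, hh, rfl⟩
  have act : ∀ g h w x, inducedAction G H σ (Coprod.inl g * Coprod.inr h * w) x =
      leftMulPerm G g (σ h (inducedAction G H σ w x)) := by
    intro g h w x
    rw [map_mul, map_mul, ia_inl, ia_inr]; rfl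
  have MB : ∀ w ∈ M, ∀ b ∈ B, inducedAction G H σ w b ∈ B := by
    intro w hw
    induction hw using Submonoid.closure_induction with
    | mem w hw =>
      obtain ⟨g, h, hg, hh, rfl⟩ := hw
      intro b hb
      rw [map_mul, ia_inl, ia_inr]
      exact hstep b hb h hh g hg
    | one => intro b hb; simpa using hb
    | mul a b _ _ ha hb =>
      intro x hx
      rw [map_mul]
      exact ha _ (hb _ hx)
  obtain ⟨g1, hg1⟩ := exists_ne (1 : G)
  obtain ⟨h1, hh1⟩ := exists_ne (1 : H)
  have single : ∀ x, ∃ w ∈ M, inducedAction G H σ w x ∈ B := by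
    intro x
    by_contra hcon
    push Not at hcon
    let RA : Set (G × ℕ) := {y | ∃ w ∈ M, inducedAction G H σ w x = y}
    let RB : Set (G × ℕ) := {y | ∃ r ∈ RA, ∃ h, h ≠ 1 ∧ σ h r = y}
    have RAF : RA ⊆ F := by
      rintro y ⟨w, hw, rfl⟩
      by_contra hy
      rcases hout _ hy with h | ⟨h, hh, h2⟩
      · exact hcon w hw h
      · refine hcon _ (M.mul_mem (gen g1 h hg1 hh) hw) ?_
        rw [act]
        exact h2 g1 hg1
    have RBF : RB ⊆ F := by
      rintro y ⟨r, hr, h, _, rfl⟩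
      exact hF h r (RAF hr)
    have fA := hFf.subset RAF
    have fB := hFf.subset RBF
    have AB : ∀ h, h ≠ 1 → σ h '' RA ⊆ RB := by
      rintro h hh _ ⟨r, hr, rfl⟩
      exact ⟨r, hr, h, hh, rfl⟩
    have BA : ∀ g, g ≠ 1 → leftMulPerm G g '' RB ⊆ RA := by
      rintro g hg _ ⟨_, ⟨_, ⟨w, hw, rfl⟩, h, hh, rfl⟩, rfl⟩
      exact ⟨_, M.mul_mem (gen g h hg hh) hw, act g h w x⟩
    have c1 : RA.ncard ≤ RB.ncard := by
      rw [← Set.ncard_image_of_injective RA (σ h1).injective]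
      exact Set.ncard_le_ncard (AB h1 hh1) fB
    have c2 : RB.ncard ≤ RA.ncard := by
      rw [← Set.ncard_image_of_injective RB (leftMulPerm G g1).injective]
      exact Set.ncard_le_ncard (BA g1 hg1) fA
    have AB' : ∀ h, h ≠ 1 → σ h '' RA = RB := by
      intro h hh
      refine Set.eq_of_subset_of_ncard_le (AB h hh) ?_ fB
      rwa [Set.ncard_image_of_injective RA (σ h).injective]
    have BA' : ∀ g, g ≠ 1 → leftMulPerm G g '' RB = RA := by
      intro g hg
      refine Set.eq_of_subset_of_ncard_le (BA g hg) ?_ fA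
      rwa [Set.ncard_image_of_injective RB (leftMulPerm G g).injective]
    have hx : x ∈ RA := ⟨1, M.one_mem, by simp⟩
    have := (adm_iff σ).1 hσ (RA ∪ RB) (fA.union fB) ?_ ?_
    · have hx' : x ∈ RA ∪ RB := Or.inl hx
      rw [this] at hx'
      exact hx'
    · intro g r hr
      by_cases hg : g = 1
      · subst hg; simpa using hr
      rcases hr with hr | hr
      · right
        rw [← BA' g⁻¹ (inv_ne_one.2 hg)] at hr
        obtain ⟨q, hq, rfl⟩ := hr
        simpa using hq
      · exact Or.inl (BA g hg ⟨r, hr, rfl⟩)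
    · intro h r hr
      by_cases hh : h = 1
      · subst hh; simpa using hr
      rcases hr with hr | hr
      · exact Or.inr (AB h hh ⟨r, hr, rfl⟩)
      · left
        rw [← AB' h⁻¹ (inv_ne_one.2 hh)] at hr
        obtain ⟨q, hq, rfl⟩ := hr
        simpa using hq
  suffices ∃ w ∈ M, ∀ x ∈ s, inducedAction G H σ w x ∈ B by
    obtain ⟨w, _, hw⟩ := this
    exact ⟨w, hw⟩
  induction s using Finset.induction_on with
  | empty => exact ⟨1, M.one_mem, by simp⟩
  | insert a s _ ih =>
    obtain ⟨w, hw, hws⟩ := ih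
    obtain ⟨v, hv, hva⟩ := single (inducedAction G H σ w a)
    refine ⟨v * w, M.mul_mem hv hw, fun x hx => ?_⟩
    rw [map_mul, Equiv.Perm.mul_apply]
    rcases Finset.mem_insert.1 hx with rfl | hx
    · exact hva
    · exact MB v hv _ (hws x hx)

/-- A normal form for elements of the free product: index 1 elements start with a letter
of `H`, index 2 ones with a letter of `G`, index 0 ones lie in `G`. -/
inductive RedW (G H : Type*) [Group G] [Group H] : ℕ → Coprod G H → Prop
  | base (g : G) : RedW G H 0 (Coprod.inl g)
  | consH0 (h : H) (hh : h ≠ 1) (t : Coprod G H) (ht : RedW G H 0 t) :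
      RedW G H 1 (Coprod.inr h * t)
  | consH2 (h : H) (hh : h ≠ 1) (t : Coprod G H) (ht : RedW G H 2 t) :
      RedW G H 1 (Coprod.inr h * t)
  | consG (g : G) (hg : g ≠ 1) (t : Coprod G H) (ht : RedW G H 1 t) :
      RedW G H 2 (Coprod.inl g * t)

lemma redW_inl {G H : Type*} [Group G] [Group H] (g : G) (n : ℕ) (w : Coprod G H)
    (hw : RedW G H n w) : ∃ m, RedW G H m (Coprod.inl g * w) := by
  have aux : ∀ (g : G) (t : Coprod G H), RedW G H 1 t → ∃ m, RedW G H m (Coprod.inl g * t) := by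
    intro g t ht
    by_cases hg : g = 1
    · subst hg
      exact ⟨1, by simpa using ht⟩
    · exact ⟨2, RedW.consG g hg t ht⟩
  cases hw with
  | base g' => exact ⟨0, by rw [← map_mul]; exact RedW.base _⟩
  | consH0 h hh t ht => exact aux g _ (RedW.consH0 h hh t ht)
  | consH2 h hh t ht => exact aux g _ (RedW.consH2 h hh t ht)
  | consG g' hg t ht =>
    rw [← mul_assoc, ← map_mul]
    exact aux _ t ht

lemma redW_inr {G H : Type*} [Group G] [Group H] (h : H) (n : ℕ) (w : Coprod G H)
    (hw : RedW G H n w) : ∃ m, RedW G H m (Coprod.inr h * w) := by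
  have aux : ∀ (h : H) (t : Coprod G H), (RedW G H 0 t ∨ RedW G H 2 t) →
      ∃ m, RedW G H m (Coprod.inr h * t) := by
    intro h t ht
    by_cases hh : h = 1
    · subst hh
      rcases ht with ht | ht
      · exact ⟨0, by simpa using ht⟩
      · exact ⟨2, by simpa using ht⟩
    · rcases ht with ht | ht
      · exact ⟨1, RedW.consH0 h hh t ht⟩
      · exact ⟨1, RedW.consH2 h hh t ht⟩
  cases hw with
  | base g' => exact aux h _ (Or.inl (RedW.base g'))
  | consH0 h' hh t ht =>
    rw [← mul_assoc, ← map_mul]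
    exact aux _ t (Or.inl ht)
  | consH2 h' hh t ht =>
    rw [← mul_assoc, ← map_mul]
    exact aux _ t (Or.inr ht)
  | consG g' hg t ht => exact aux h _ (Or.inr (RedW.consG g' hg t ht))

lemma redW_exists {G H : Type*} [Group G] [Group H] (w : Coprod G H) : ∃ n, RedW G H n w := by
  induction w using Coprod.induction_on' with
  | one => exact ⟨0, by rw [← map_one Coprod.inl]; exact RedW.base 1⟩
  | inl_mul g t ih =>
    obtain ⟨n, hn⟩ := ih
    exact redW_inl g n t hn
  | inr_mul h t ih =>
    obtain ⟨n, hn⟩ := ih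
    exact redW_inr h n t hn

lemma faithful_of_tree {G H : Type*} [Group G] [Group H]
    (σ : H →* Equiv.Perm (G × ℕ)) (B : Set (G × ℕ)) (c : G × ℕ → H → ℕ)
    (s4 : ∀ b ∈ B, ∀ h, h ≠ 1 → σ h b = (1, c b h))
    (c_lt : ∀ b h, b.2 < c b h)
    (gB : ∀ g, g ≠ 1 → ∀ b h, (g, c b h) ∈ B)
    (n : ℕ) (hn : ∀ g, (g, n) ∈ B) (w : Coprod G H) (hw : w ≠ 1) :
    ∃ x, inducedAction G H σ w x ≠ x := by
  refine ⟨(1, n), fun hfix => ?_⟩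
  have key : ∀ m w, RedW G H m w →
      (m = 0 → ∃ g, w = Coprod.inl g) ∧
      (m = 1 → ∃ b h, n < c b h ∧ inducedAction G H σ w (1, n) = (1, c b h)) ∧
      (m = 2 → inducedAction G H σ w (1, n) ∈ B ∧ n < (inducedAction G H σ w (1, n)).2) := by
    intro m w hw
    induction hw with
    | base g => exact ⟨fun _ => ⟨g, rfl⟩, by omega, by omega⟩
    | consH0 h hh t ht ih =>
      refine ⟨by omega, fun _ => ?_, by omega⟩
      obtain ⟨g, rfl⟩ := ih.1 rfl
      refine ⟨(g, n), h, c_lt (g, n) h, ?_⟩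
      rw [map_mul, ia_inl, ia_inr, Equiv.Perm.mul_apply, lm_apply]
      simp only [mul_one]
      exact s4 _ (hn g) h hh
    | consH2 h hh t ht ih =>
      refine ⟨by omega, fun _ => ?_, by omega⟩
      obtain ⟨h1, h2⟩ := ih.2.2 rfl
      refine ⟨_, h, h2.trans (c_lt _ h), ?_⟩
      rw [map_mul, ia_inr, Equiv.Perm.mul_apply]
      exact s4 _ h1 h hh
    | consG g hg t ht ih =>
      refine ⟨by omega, by omega, fun _ => ?_⟩
      obtain ⟨b, h, h1, h2⟩ := ih.2.1 rfl
      rw [map_mul, ia_inl, Equiv.Perm.mul_apply, h2, lm_apply]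
      simp only [mul_one]
      exact ⟨gB g hg b h, h1⟩
  obtain ⟨m, hm⟩ := redW_exists w
  obtain ⟨k0, k1, k2⟩ := key m w hm
  have hm3 : m = 0 ∨ m = 1 ∨ m = 2 := by cases hm <;> simp
  rcases hm3 with h | h | h
  · obtain ⟨g, rfl⟩ := k0 h
    rw [ia_inl, lm_apply] at hfix
    have := (Prod.mk.inj hfix).1
    simp only [mul_one] at this
    exact hw (by rw [this, map_one])
  · obtain ⟨b, h', h1, h2⟩ := k1 h
    rw [hfix] at h2
    have := (Prod.mk.inj h2).2
    omega
  · have := (k2 h).2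
    rw [hfix] at this
    exact lt_irrefl _ this

lemma sat_exists {X H : Type*} [Group H] [Finite H] (σ : H →* Equiv.Perm X) (T : Set X)
    (hT : T.Finite) : ∃ F : Set X, F.Finite ∧ T ⊆ F ∧ (∀ h, ∀ x ∈ F, σ h x ∈ F) ∧
      ∀ y ∈ F, ∃ t ∈ T, ∃ h, y = σ h t := by
  refine ⟨⋃ h : H, σ h '' T, Set.finite_iUnion fun h => hT.image _, ?_, ?_, ?_⟩
  · intro t ht
    exact Set.mem_iUnion.2 ⟨1, t, ht, by simp⟩
  · intro h x hx
    obtain ⟨h', t, ht, rfl⟩ := Set.mem_iUnion.1 hx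
    exact Set.mem_iUnion.2 ⟨h * h', t, ht, by simp⟩
  · intro y hy
    obtain ⟨h', t, ht, rfl⟩ := Set.mem_iUnion.1 hy
    exact ⟨t, ht, h', rfl⟩

lemma two_ne {H : Type*} [Group H] [Fintype H] (hH : 3 ≤ Fintype.card H) :
    ∃ h1 h2 : H, h1 ≠ 1 ∧ h2 ≠ 1 ∧ h1 ≠ h2 := by
  obtain ⟨a, b, c, hab, hac, hbc⟩ := Fintype.two_lt_card_iff.1 (by omega : 2 < Fintype.card H)
  by_cases ha : a = 1
  · exact ⟨b, c, fun h => hab (ha.trans h.symm), fun h => hac (ha.trans h.symm), hbc⟩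
  by_cases hb : b = 1
  · exact ⟨a, c, ha, fun h => hbc (hb.trans h.symm), hac⟩
  · exact ⟨a, b, ha, hb, hab⟩

lemma dense_faithful {G H : Type*} [Group G] [Group H] [Countable G] [Nontrivial G]
    [Fintype H] (hH : 3 ≤ Fintype.card H) (σ : H →* Equiv.Perm (G × ℕ)) (hσ : Admissible G H σ)
    (F0 : Set (G × ℕ)) (hF0 : F0.Finite) (w : Coprod G H) (hw : w ≠ 1) :
    ∃ σ' : H →* Equiv.Perm (G × ℕ), Admissible G H σ' ∧ (∀ x ∈ F0, ∀ h, σ' h x = σ h x) ∧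
      ∃ x, inducedAction G H σ' w x ≠ x := by
  obtain ⟨F, hFf, hF0F, hF, -⟩ := sat_exists σ F0 hF0
  obtain ⟨h1, h2, hh1, hh2, h12⟩ := two_ne hH
  obtain ⟨σ', B, c, s1, s2, s3, s4, s5, s6, s7, s8, s9, ⟨n, hn⟩, s11⟩ :=
    tree hH σ hσ F hFf hF 0 Fin.elim0 Fin.elim0 (fun i => i.elim0) (fun i => i.elim0)
      (fun i => i.elim0) (fun i => i.elim0) (fun i => i.elim0) h1 hh1
  refine ⟨σ', s2, fun x hx h => s1 h x (hF0F hx), ?_⟩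
  exact faithful_of_tree σ' B c (fun b hb h hh => s4 b hb h hh (Or.inr fun ⟨i, _⟩ => i.elim0))
    s5 s7 n hn w hw

lemma dense_ht {G H : Type*} [Group G] [Group H] [Countable G] [Nontrivial G]
    [Fintype H] (hH : 3 ≤ Fintype.card H) (σ : H →* Equiv.Perm (G × ℕ)) (hσ : Admissible G H σ)
    (F0 : Set (G × ℕ)) (hF0 : F0.Finite) (k : ℕ) (x y : Fin k ↪ G × ℕ) (hxy : ∀ i j, x i ≠ y j) :
    ∃ σ' : H →* Equiv.Perm (G × ℕ), Admissible G H σ' ∧ (∀ x ∈ F0, ∀ h, σ' h x = σ h x) ∧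
      ∃ w : Coprod G H, ∀ i, inducedAction G H σ' w (x i) = y i := by
  classical
  obtain ⟨F, hFf, hF0F, hF, -⟩ := sat_exists σ F0 hF0
  obtain ⟨h1, h2, hh1, hh2, h12⟩ := two_ne hH
  haveI : Nontrivial H := ⟨h1, h2, h12⟩
  obtain ⟨g0, hg0⟩ := exists_ne (1 : G)
  obtain ⟨σ1, B, c, s1, s2, s3, s4', s5, s6, s7, s8, s9, -, -⟩ :=
    tree hH σ hσ F hFf hF 0 Fin.elim0 Fin.elim0 (fun i => i.elim0) (fun i => i.elim0)
      (fun i => i.elim0) (fun i => i.elim0) (fun i => i.elim0) h1 hh1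
  have s4 : ∀ b ∈ B, ∀ h, h ≠ 1 → σ1 h b = (1, c b h) :=
    fun b hb h hh => s4' b hb h hh (Or.inr fun ⟨i, _⟩ => i.elim0)
  have step : ∀ b ∈ B, ∀ h, h ≠ 1 → ∀ g, leftMulPerm G g (σ1 h b) = (g, c b h) := by
    intro b hb h hh g
    rw [s4 b hb h hh, lm_apply]
    simp only [mul_one]
  have hF1 : ∀ h, ∀ x ∈ F, σ1 h x ∈ F := fun h x hx => by rw [s1 h x hx]; exact hF h x hx
  let s : Finset (G × ℕ) := Finset.univ.image x ∪ Finset.univ.image y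
  obtain ⟨w, hw⟩ := reach σ1 s2 F B hFf hF1
    (fun b hb h hh g hg => by rw [step b hb h hh]; exact s7 g hg b h) (s9 rfl) s
  have hxs : ∀ i, x i ∈ s := fun i => by simp [s]
  have hys : ∀ i, y i ∈ s := fun i => by simp [s]
  choose T hTf hT using loc_const σ1 w
  let Tw : Set (G × ℕ) := ⋃ q ∈ s, T q
  have hTw : Tw.Finite := s.finite_toSet.biUnion fun q _ => hTf q
  let P : Set (G × ℕ) := inducedAction G H σ1 w '' s
  have hP : P.Finite := s.finite_toSet.image _
  have PB : ∀ p ∈ P, p ∈ B := by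
    rintro _ ⟨q, hq, rfl⟩
    exact hw q hq
  obtain ⟨E, hEf, hTE, hEinv, -⟩ := sat_exists σ1 Tw hTw
  obtain ⟨L, hL⟩ : ∃ L, ∀ p ∈ E ∪ P, p.2 < L := by
    have : (Prod.snd '' (E ∪ P)).Finite := (hEf.union hP).image _
    obtain ⟨M, hM⟩ := this.bddAbove
    exact ⟨M + 1, fun p hp => Nat.lt_succ_of_le (hM ⟨p, hp, rfl⟩)⟩
  let α : Coprod G H := Coprod.inl g0 * Coprod.inr h1
  let β : Coprod G H := Coprod.inl g0 * Coprod.inr h2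
  have actα : ∀ (τ : H →* Equiv.Perm (G × ℕ)) i p, inducedAction G H τ (α ^ (i + 1)) p =
      leftMulPerm G g0 (τ h1 (inducedAction G H τ (α ^ i) p)) := by
    intro τ i p
    rw [pow_succ', map_mul, map_mul, ia_inl, ia_inr]; rfl
  have actβ : ∀ (τ : H →* Equiv.Perm (G × ℕ)) i p, inducedAction G H τ (β * α ^ i) p =
      leftMulPerm G g0 (τ h2 (inducedAction G H τ (α ^ i) p)) := by
    intro τ i p
    rw [map_mul, map_mul, ia_inl, ia_inr]; rfl
  have aB : ∀ p ∈ B, ∀ i, inducedAction G H σ1 (α ^ i) p ∈ B ∧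
      i ≤ (inducedAction G H σ1 (α ^ i) p).2 := by
    intro p hp i
    induction i with
    | zero => simpa using hp
    | succ i ih =>
      rw [actα, step _ ih.1 h1 hh1]
      refine ⟨s7 g0 hg0 _ _, ?_⟩
      have := s5 (inducedAction G H σ1 (α ^ i) p) h1
      dsimp only; omega
  have vstep : ∀ p ∈ P, inducedAction G H σ1 (β * α ^ L) p =
      (g0, c (inducedAction G H σ1 (α ^ L) p) h2) := by
    intro p hp
    rw [actβ, step _ (aB p (PB p hp) L).1 h2 hh2]
  have vB : ∀ p ∈ P, inducedAction G H σ1 (β * α ^ L) p ∈ B := by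
    intro p hp
    rw [vstep p hp]
    exact s7 g0 hg0 _ _
  have vL : ∀ p ∈ P, L < (inducedAction G H σ1 (β * α ^ L) p).2 := by
    intro p hp
    rw [vstep p hp]
    exact (aB p (PB p hp) L).2.trans_lt (s5 _ _)
  let D : Set (G × ℕ) := ⋃ i ∈ Finset.range (L + 1), inducedAction G H σ1 (α ^ i) '' P
  have hD : D.Finite := (Finset.finite_toSet _).biUnion fun i _ => hP.image _
  obtain ⟨F2, hF2f, hF2sub, hF2, hF2'⟩ := sat_exists σ1 (F ∪ Tw ∪ D) ((hFf.union hTw).union hD)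
  have vF2 : ∀ p ∈ P, inducedAction G H σ1 (β * α ^ L) p ∉ F2 := by
    intro p hp hmem
    obtain ⟨t, ht, h, hth⟩ := hF2' _ hmem
    rcases ht with (ht | ht) | ht
    · exact s3 _ (vB p hp) (by rw [hth]; exact hF1 h t ht)
    · have e1 := hL _ (Or.inl (hEinv h t (hTE ht)))
      rw [← hth] at e1
      exact absurd (vL p hp) (by omega)
    · obtain ⟨i, -, q, hq, rfl⟩ := Set.mem_iUnion₂.1 ht
      have hB := aB q (PB q hq) i
      by_cases hh : h = 1
      · subst hh
        rw [map_one, Equiv.Perm.one_apply] at hth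
        cases i with
        | zero =>
          rw [pow_zero, map_one, Equiv.Perm.one_apply] at hth
          have e1 := hL q (Or.inr hq)
          have e2 := vL p hp
          rw [hth] at e2
          omega
        | succ i =>
          rw [actα, step _ (aB q (PB q hq) i).1 h1 hh1, vstep p hp] at hth
          exact h12 (s6 _ _ _ _ (Prod.mk.inj hth).2).2.symm
      · have := vB p hp
        rw [hth, s4 _ hB.1 h hh] at this
        exact s8 _ _ this
  let z : Fin k → G × ℕ := fun i => inducedAction G H σ1 (β * α ^ L) (inducedAction G H σ1 w (x i))
  let u : Fin k → G × ℕ := fun i => inducedAction G H σ1 (β * α ^ L) (inducedAction G H σ1 w (y i))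
  have hxP : ∀ i, inducedAction G H σ1 w (x i) ∈ P := fun i => ⟨_, hxs i, rfl⟩
  have hyP : ∀ i, inducedAction G H σ1 w (y i) ∈ P := fun i => ⟨_, hys i, rfl⟩
  obtain ⟨σ2, -, -, t1, t2, -, -, -, -, -, -, -, -, t3⟩ := tree hH σ1 s2 F2 hF2f hF2 k z u
    (fun i j hij => x.injective (Equiv.injective _ (Equiv.injective _ hij)))
    (fun i j hij => y.injective (Equiv.injective _ (Equiv.injective _ hij)))
    (fun i j hij => hxy i j (Equiv.injective _ (Equiv.injective _ hij)))
    (fun i => vF2 _ (hxP i)) (fun i => vF2 _ (hyP i)) h1 hh1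
  refine ⟨σ2, t2, fun p hp h => ?_, ?_⟩
  · rw [t1 h p (hF2sub (Or.inl (Or.inl (hF0F hp)))), s1 h p (hF0F hp)]
  have ew : ∀ q ∈ s, inducedAction G H σ2 w q = inducedAction G H σ1 w q := by
    intro q hq
    refine hT q σ2 fun t ht h => t1 h t (hF2sub (Or.inl (Or.inr ?_)))
    exact Set.mem_iUnion₂.2 ⟨q, hq, ht⟩
  have memD : ∀ p ∈ P, ∀ i, i ≤ L → inducedAction G H σ1 (α ^ i) p ∈ F2 := by
    intro p hp i hi
    refine hF2sub (Or.inr (Set.mem_iUnion₂.2 ⟨i, Finset.mem_range.2 (by omega), p, hp, rfl⟩))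
  have eα : ∀ p ∈ P, ∀ i, i ≤ L →
      inducedAction G H σ2 (α ^ i) p = inducedAction G H σ1 (α ^ i) p := by
    intro p hp i
    induction i with
    | zero => intro _; simp
    | succ i ih =>
      intro hi
      rw [actα, actα, ih (by omega), t1 _ _ (memD p hp i (by omega))]
  have eβ : ∀ p ∈ P, inducedAction G H σ2 (β * α ^ L) p = inducedAction G H σ1 (β * α ^ L) p := by
    intro p hp
    rw [actβ, actβ, eα p hp L le_rfl, t1 _ _ (memD p hp L le_rfl)]
  have ex : ∀ i, inducedAction G H σ2 (β * α ^ L * w) (x i) = z i := by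
    intro i
    rw [map_mul, Equiv.Perm.mul_apply, ew _ (hxs i), eβ _ (hxP i)]
  have ey : ∀ i, inducedAction G H σ2 (β * α ^ L * w) (y i) = u i := by
    intro i
    rw [map_mul, Equiv.Perm.mul_apply, ew _ (hys i), eβ _ (hyP i)]
  refine ⟨(β * α ^ L * w)⁻¹ * Coprod.inr h1 * (β * α ^ L * w), fun i => ?_⟩
  rw [map_mul, map_mul, map_inv, Equiv.Perm.mul_apply, Equiv.Perm.mul_apply, ex, ia_inr, t3,
    Equiv.Perm.inv_eq_iff_eq, ey]

theorem generic_faithful_highly_transitive_finite_factor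
    (G H : Type*) [Group G] [Group H] [Countable G] [Nontrivial G]
    [Fintype H] (hH : 3 ≤ Fintype.card H) :
    {σ : {σ : H →* Equiv.Perm (G × ℕ) // Admissible G H σ} |
        Function.Injective (inducedAction G H σ.val) ∧
        ∀ (k : ℕ) (x y : Fin k ↪ G × ℕ), ∃ w : Coprod G H, ∀ i,
          inducedAction G H σ.val w (x i) = y i}
      ∈ @residual {σ : H →* Equiv.Perm (G × ℕ) // Admissible G H σ}
          (@instTopologicalSpaceSubtype _ (fun σ => Admissible G H σ) (homTop H (G × ℕ))) := by

  letI τ := homTop H (G × ℕ)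
  haveI : Countable (Coprod G H) := by
    haveI : Countable (FreeMonoid (G ⊕ H)) := inferInstanceAs (Countable (List (G ⊕ H)))
    exact (Coprod.mk_surjective (M := G) (N := H)).countable
  haveI : ∀ k : ℕ, Countable (Fin k ↪ G × ℕ) := fun k =>
    (DFunLike.coe_injective (F := Fin k ↪ G × ℕ)).countable
  -- a criterion for membership in the residual filter
  have crit : ∀ Q : (H →* Equiv.Perm (G × ℕ)) → Prop,
      (∀ σ, Q σ → ∃ T : Set (G × ℕ), T.Finite ∧
        ∀ σ' : H →* Equiv.Perm (G × ℕ), (∀ t ∈ T, ∀ h, σ' h t = σ h t) → Q σ') →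
      (∀ σ, Admissible G H σ → ∀ F0 : Set (G × ℕ), F0.Finite →
        ∃ σ', Admissible G H σ' ∧ (∀ x ∈ F0, ∀ h, σ' h x = σ h x) ∧ Q σ') →
      {σ : {σ : H →* Equiv.Perm (G × ℕ) // Admissible G H σ} | Q σ.val} ∈
        residual {σ : H →* Equiv.Perm (G × ℕ) // Admissible G H σ} := by
    intro Q hopen hdense
    have ho : IsOpen {σ | Q σ} := (isOpen_homTop_iff _ _ _).2 hopen
    refine residual_of_dense_open (ho.preimage continuous_subtype_val) ?_
    rw [dense_iff_inter_open]
    rintro U hU ⟨σ, hσU⟩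
    obtain ⟨V, hV, rfl⟩ := isOpen_induced_iff.1 hU
    obtain ⟨F0, hF0, h1⟩ := (isOpen_homTop_iff _ _ _).1 hV σ.val hσU
    obtain ⟨σ', h2, h3, h4⟩ := hdense σ.val σ.2 F0 hF0
    exact ⟨⟨σ', h2⟩, h1 σ' h3, h4⟩
  have A1 : ∀ w : Coprod G H, ∀ᶠ σ in residual {σ : H →* Equiv.Perm (G × ℕ) // Admissible G H σ},
      w ≠ 1 → ∃ x, inducedAction G H σ.val w x ≠ x := by
    intro w
    by_cases hw : w = 1
    · exact Filter.Eventually.of_forall fun σ h => absurd hw h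
    have := crit (fun σ => ∃ x, inducedAction G H σ w x ≠ x) ?_ ?_
    · filter_upwards [this] with σ hσ _ using hσ
    · rintro σ ⟨x, hx⟩
      obtain ⟨T, hT, h⟩ := loc_const σ w x
      exact ⟨T, hT, fun σ' h' => ⟨x, by rw [h σ' h']; exact hx⟩⟩
    · intro σ hσ F0 hF0
      exact dense_faithful hH σ hσ F0 hF0 w hw
  have A2 : ∀ (k : ℕ) (x y : Fin k ↪ G × ℕ),
      ∀ᶠ σ in residual {σ : H →* Equiv.Perm (G × ℕ) // Admissible G H σ},
      (∀ i j, x i ≠ y j) → ∃ w : Coprod G H, ∀ i, inducedAction G H σ.val w (x i) = y i := by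
    intro k x y
    by_cases hxy : ∀ i j, x i ≠ y j
    swap
    · exact Filter.Eventually.of_forall fun σ h => absurd h hxy
    have := crit (fun σ => ∃ w : Coprod G H, ∀ i, inducedAction G H σ w (x i) = y i) ?_ ?_
    · filter_upwards [this] with σ hσ _ using hσ
    · rintro σ ⟨w, hw⟩
      choose T hT h using fun i => loc_const σ w (x i)
      refine ⟨⋃ i, T i, Set.finite_iUnion hT, fun σ' h' => ⟨w, fun i => ?_⟩⟩
      rw [h i σ' fun t ht => h' t (Set.mem_iUnion.2 ⟨i, ht⟩), hw i]
    · intro σ hσ F0 hF0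
      exact dense_ht hH σ hσ F0 hF0 k x y hxy
  have B1 := eventually_countable_forall.2 A1
  have B2 := eventually_countable_forall.2 fun k =>
    eventually_countable_forall.2 fun x => eventually_countable_forall.2 fun y => A2 k x y
  change ∀ᶠ σ in residual {σ : H →* Equiv.Perm (G × ℕ) // Admissible G H σ}, _ ∧ _
  filter_upwards [B1, B2] with σ h1 h2
  constructor
  · rw [injective_iff_map_eq_one]
    intro w hw
    by_contra hne
    obtain ⟨x, hx⟩ := h1 w hne
    rw [hw] at hx
    exact hx rfl
  · intro k x y
    have hfin : (Set.range x ∪ Set.range y).Finite := (Set.finite_range x).union (Set.finite_range y)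
    let t0 := hfin.infinite_compl.natEmbedding
    let t : Fin k ↪ G × ℕ :=
      (Fin.valEmbedding.trans t0).trans (Function.Embedding.subtype _)
    have ht : ∀ i, t i ∉ Set.range x ∪ Set.range y := fun i => (t0 i.val).2
    obtain ⟨w1, hw1⟩ := h2 k x t fun i j hij => ht j (Or.inl ⟨i, hij⟩)
    obtain ⟨w2, hw2⟩ := h2 k t y fun i j hij => ht i (Or.inr ⟨j, hij.symm⟩)
    exact ⟨w2 * w1, fun i => by rw [map_mul, Equiv.Perm.mul_apply, hw1, hw2]⟩
end
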